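/- arXiv:2002.12072 — 2 statements merged into one kernel-verified Lean document; each statement's English description precedes it below -/
import Mathlib

section
/- Let p be a prime with p > 3 and p ≡ 1 or 3 (mod 8), and let x, y be integers with p = x² + 2y². Then (2 − (−1)^{(p−1)/2}) · Σ_{k=0}^{p−1} ( C(2k,k)²/16^k ) · p/(8k + 1) ≡ (2 + (−1)^{(p−1)/2}) · Σ_{k=0}^{p−1} ( C(2k,k)²/16^k ) · p/(8k + 3) ≡ 4x² − 2p (mod p²). -/
/-- A rational number is a `p`-integer if its denominator (in lowest terms)
is not divisible by `p`. -/
def isPInt (p : ℕ) (x : ℚ) : Prop := ¬ p ∣ x.den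

/-- For `p`-integers `u, v`, `u ≡ v (mod p^k)` means `(u - v)/p^k` is a `p`-integer. -/
def pCong (p k : ℕ) (u v : ℚ) : Prop := isPInt p ((u - v) / (p : ℚ) ^ k)

open Finset

/-- `x ≡ y` modulo `m`, relative to the subring `O` of `K`. -/
def CongrMod {K : Type*} [Field K] (O : Subring K) (m x y : K) : Prop :=
  ∃ w ∈ O, x - y = m * w

namespace CongrMod

variable {K : Type*} [Field K] {O : Subring K} {m x y z x' y' c : K}

theorem refl (x : K) : CongrMod O m x x := ⟨0, O.zero_mem, by ring⟩

theorem of_eq (h : x = y) : CongrMod O m x y := h ▸ refl x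

theorem symm (h : CongrMod O m x y) : CongrMod O m y x := by
  obtain ⟨w, hw, e⟩ := h
  exact ⟨-w, O.neg_mem hw, by linear_combination -e⟩

theorem trans (h : CongrMod O m x y) (h' : CongrMod O m y z) : CongrMod O m x z := by
  obtain ⟨w, hw, e⟩ := h
  obtain ⟨w', hw', e'⟩ := h'
  exact ⟨w + w', O.add_mem hw hw', by linear_combination e + e'⟩

theorem add (h : CongrMod O m x y) (h' : CongrMod O m x' y') :
    CongrMod O m (x + x') (y + y') := by
  obtain ⟨w, hw, e⟩ := h
  obtain ⟨w', hw', e'⟩ := h'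
  exact ⟨w + w', O.add_mem hw hw', by linear_combination e + e'⟩

theorem mul_left (hc : c ∈ O) (h : CongrMod O m x y) : CongrMod O m (c * x) (c * y) := by
  obtain ⟨w, hw, e⟩ := h
  exact ⟨c * w, O.mul_mem hc hw, by linear_combination c * e⟩

theorem mul (h : CongrMod O m x y) (h' : CongrMod O m x' y') (hx' : x' ∈ O) (hy : y ∈ O) :
    CongrMod O m (x * x') (y * y') := by
  obtain ⟨w, hw, e⟩ := h
  obtain ⟨w', hw', e'⟩ := h'
  exact ⟨w * x' + y * w', O.add_mem (O.mul_mem hw hx') (O.mul_mem hy hw'),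
    by linear_combination x' * e + y * e'⟩

theorem pow (h : CongrMod O m x y) (hx : x ∈ O) (hy : y ∈ O) (k : ℕ) :
    CongrMod O m (x ^ k) (y ^ k) := by
  induction k with
  | zero => exact of_eq (by simp)
  | succ k ih =>
    rw [pow_succ, pow_succ]
    exact ih.mul h hx (O.pow_mem hy k)

theorem sum {ι : Type*} {s : Finset ι} {f g : ι → K}
    (h : ∀ i ∈ s, CongrMod O m (f i) (g i)) :
    CongrMod O m (∑ i ∈ s, f i) (∑ i ∈ s, g i) := by
  classical
  induction s using Finset.induction_on with
  | empty => exact of_eq (by simp)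
  | insert a s ha ih =>
    rw [sum_insert ha, sum_insert ha]
    exact (h a (mem_insert_self a s)).add (ih fun i hi => h i (mem_insert_of_mem hi))

theorem mul_modulus (h : CongrMod O m x y) (c : K) : CongrMod O (c * m) (c * x) (c * y) := by
  obtain ⟨w, hw, e⟩ := h
  exact ⟨w, hw, by linear_combination c * e⟩

theorem cancel_left (hc : c⁻¹ ∈ O) (hc0 : c ≠ 0) (h : CongrMod O m (c * x) (c * y)) :
    CongrMod O m x y := by
  have := h.mul_left hc
  rwa [inv_mul_cancel_left₀ hc0, inv_mul_cancel_left₀ hc0] at this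

theorem mem (h : CongrMod O m x y) (hm : m ∈ O) (hy : y ∈ O) : x ∈ O := by
  obtain ⟨w, hw, e⟩ := h
  rw [show x = m * w + y by linear_combination e]
  exact O.add_mem (O.mul_mem hm hw) hy

end CongrMod

/-- The `k`-th harmonic number, as an element of a field. -/
def harmonicSum (K : Type*) [Field K] (k : ℕ) : K := ∑ i ∈ range k, ((i : K) + 1)⁻¹

theorem harmonicSum_succ (K : Type*) [Field K] (k : ℕ) :
    harmonicSum K (k + 1) = harmonicSum K k + ((k : K) + 1)⁻¹ := sum_range_succ _ _

section PIntegers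

variable {K : Type*} [Field K] {O : Subring K} {p : ℕ}

theorem inv_intCast_mem (hO : ∀ k : ℕ, ¬ p ∣ k → (k : K)⁻¹ ∈ O) {k : ℤ} (hk : ¬ (p : ℤ) ∣ k) :
    (k : K)⁻¹ ∈ O := by
  obtain ⟨n, rfl | rfl⟩ := k.eq_nat_or_neg
  · exact_mod_cast hO n (by exact_mod_cast hk)
  · have := hO n (by rw [dvd_neg] at hk; exact_mod_cast hk)
    push_cast
    rw [inv_neg]
    exact O.neg_mem this

theorem inv_succ_mem (hO : ∀ k : ℕ, ¬ p ∣ k → (k : K)⁻¹ ∈ O) {k : ℕ} (hk : k + 1 < p) :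
    ((k : K) + 1)⁻¹ ∈ O := by
  have := hO (k + 1) (Nat.not_dvd_of_pos_of_lt k.succ_pos hk)
  exact_mod_cast this

theorem inv_factorial_mem (hp : p.Prime) (hO : ∀ k : ℕ, ¬ p ∣ k → (k : K)⁻¹ ∈ O) {k : ℕ}
    (hk : k < p) : ((k.factorial : ℕ) : K)⁻¹ ∈ O :=
  hO _ (by rw [hp.dvd_factorial]; omega)

theorem harmonicSum_mem (hO : ∀ k : ℕ, ¬ p ∣ k → (k : K)⁻¹ ∈ O) {k : ℕ} (hk : k < p) :
    harmonicSum K k ∈ O :=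
  O.sum_mem fun i hi => inv_succ_mem hO (by rw [mem_range] at hi; omega)

variable [CharZero K]

theorem prod_succ_add_congr (hO : ∀ k : ℕ, ¬ p ∣ k → (k : K)⁻¹ ∈ O) {e : K} (he : e ∈ O)
    {k : ℕ} (hk : k < p) :
    CongrMod O ((p : K) ^ 2) (∏ i ∈ range k, ((i : K) + 1 + p * e))
      (k.factorial * (1 + p * e * harmonicSum K k)) := by
  induction k with
  | zero => exact .of_eq (by simp [harmonicSum])
  | succ k ih =>
    obtain ⟨w, hw, h⟩ := ih (by omega)
    have hk0 : (k : K) + 1 ≠ 0 := by exact_mod_cast k.succ_ne_zero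
    refine ⟨w * (k + 1 + p * e) + k.factorial * e ^ 2 * harmonicSum K k, ?_, ?_⟩
    · exact O.add_mem (O.mul_mem hw (O.add_mem (O.add_mem (natCast_mem O k) O.one_mem)
        (O.mul_mem (natCast_mem O p) he))) (O.mul_mem (O.mul_mem (natCast_mem O _)
        (O.pow_mem he 2)) (harmonicSum_mem hO (by omega)))
    · rw [prod_range_succ, harmonicSum_succ, Nat.factorial_succ]
      push_cast
      have : ((k : K) + 1) * ((k : K) + 1)⁻¹ = 1 := mul_inv_cancel₀ hk0
      linear_combination (k + 1 + p * e) * h - k.factorial * p * e * this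

theorem factorial_mul_factorial_congr (hO : ∀ k : ℕ, ¬ p ∣ k → (k : K)⁻¹ ∈ O)
    {k l : ℕ} (h : k + l + 1 = p) :
    CongrMod O ((p : K) ^ 2) (k.factorial * l.factorial)
      ((-1) ^ k * (p - 1).factorial * (1 + p * harmonicSum K k)) := by
  have key : ((p - 1).factorial : K)
      = l.factorial * ((-1) ^ k * ∏ i ∈ range k, ((i : K) + 1 + p * (-1))) := by
    have hp1 : p - 1 = k + l := by omega
    have hpl : (p : K) = k + l + 1 := by exact_mod_cast h.symm
    have : ∀ j ≤ k, ((l + j).factorial : K)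
        = l.factorial * ∏ i ∈ Ico (k - j) k, (-((i : K) + 1 + p * (-1))) := by
      intro j hj
      induction j with
      | zero => simp
      | succ j ih =>
        have e1 : k - (j + 1) < k := by omega
        rw [prod_eq_prod_Ico_succ_bot e1, show k - (j + 1) + 1 = k - j by omega, ← add_assoc,
          Nat.factorial_succ,
          Nat.cast_mul, ih (by omega), hpl, Nat.cast_sub hj]
        push_cast
        ring
    have h2 := this k le_rfl
    rw [Nat.sub_self, Nat.Ico_zero_eq_range, prod_neg, card_range] at h2
    rw [hp1, add_comm, h2]
  obtain ⟨w, hw, hc⟩ := prod_succ_add_congr hO (O.neg_mem O.one_mem) (show k < p by omega)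
  have hH := harmonicSum_mem (K := K) hO (show k < p by omega)
  have hs : ((-1 : K) ^ k) * (-1) ^ k = 1 := by rw [← mul_pow]; simp
  refine ⟨l.factorial * (k.factorial * harmonicSum K k ^ 2 - w * (1 + p * harmonicSum K k)),
    ?_, ?_⟩
  · exact O.mul_mem (natCast_mem O _) (O.sub_mem (O.mul_mem (natCast_mem O _) (O.pow_mem hH 2))
      (O.mul_mem hw (O.add_mem O.one_mem (O.mul_mem (natCast_mem O p) hH))))
  · rw [key]
    linear_combination (-l.factorial * (1 + p * harmonicSum K k) : K) * hc -
      (l.factorial * (∏ i ∈ range k, ((i : K) + 1 + p * (-1))) * (1 + p * harmonicSum K k)) * hs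

theorem harmonicSum_congr (hp : p.Prime) (hp2 : p ≠ 2) (hO : ∀ k : ℕ, ¬ p ∣ k → (k : K)⁻¹ ∈ O)
    {k l : ℕ} (h : k + l + 1 = p) :
    CongrMod O (p : K) (harmonicSum K k) (harmonicSum K l) := by
  obtain ⟨w, hw, h1⟩ := factorial_mul_factorial_congr hO h
  obtain ⟨w', hw', h2⟩ := factorial_mul_factorial_congr hO (show l + k + 1 = p by omega)
  have hs : (-1 : K) ^ l = (-1) ^ k := by
    have := hp.eq_two_or_odd'
    apply neg_one_pow_congr
    grind
  have hs2 : ((-1 : K) ^ k) * (-1) ^ k = 1 := by rw [← mul_pow]; simp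
  have hp0 : (p : K) ≠ 0 := by exact_mod_cast hp.ne_zero
  have hf : ((p - 1).factorial : K) ≠ 0 := by exact_mod_cast Nat.factorial_ne_zero _
  refine ⟨((p - 1).factorial : K)⁻¹ * ((-1) ^ k * (w' - w)), ?_, ?_⟩
  · exact O.mul_mem (inv_factorial_mem hp hO (by have := hp.pos; omega))
      (O.mul_mem (O.pow_mem (O.neg_mem O.one_mem) k) (O.sub_mem hw' hw))
  · rw [hs] at h2
    apply mul_left_cancel₀ (mul_ne_zero hp0 hf)
    linear_combination ((-1) ^ k) * (h2 - h1) -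
      p * ((p - 1).factorial : K) * (harmonicSum K k - harmonicSum K l) * hs2 -
      p ^ 2 * (-1) ^ k * (w' - w) * mul_inv_cancel₀ hf

end PIntegers

section BinomialSums

variable {K : Type*} [Field K] [CharZero K]

theorem cast_choose_succ_right (n k : ℕ) :
    (n.choose (k + 1) : K) * (k + 1) = n.choose k * (n - k) := by
  rcases le_or_gt k n with h | h
  · rw [← Nat.cast_sub h]
    exact_mod_cast Nat.choose_succ_right_eq n k
  · simp [Nat.choose_eq_zero_of_lt h, Nat.choose_eq_zero_of_lt (Nat.lt_succ_of_lt h)]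

theorem cast_succ_choose (n k : ℕ) :
    ((n + 1).choose k : K) * (n + 1 - k) = n.choose k * (n + 1) := by
  cases k with
  | zero => simp
  | succ k =>
    have h := cast_choose_succ_right (K := K) n k
    rw [Nat.choose_succ_succ]
    push_cast
    linear_combination (-1 : K) * h

theorem cast_add_succ_choose (n k : ℕ) :
    ((n + k + 1).choose k : K) * (n + 1) = (n + k).choose k * (n + k + 1) := by
  have h := cast_succ_choose (K := K) (n + k) k
  push_cast at h
  linear_combination h

theorem sum_range_neg_one_pow_choose_mul_choose (n m : ℕ) :
    ∑ k ∈ range (m + 1), (-1 : K) ^ k * (n + 1).choose k * (n + k).choose k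
      = (-1) ^ m * n.choose m * (n + m + 1).choose m := by
  induction m with
  | zero => simp
  | succ m ih =>
    have hm : (m : K) + 1 ≠ 0 := by exact_mod_cast m.succ_ne_zero
    have h1 := cast_choose_succ_right (K := K) n m
    have h2 := cast_choose_succ_right (K := K) (n + m + 1) m
    rw [sum_range_succ, ih, Nat.choose_succ_succ n m, Nat.succ_eq_add_one,
      show n + (m + 1) + 1 = n + m + 1 + 1 by ring, Nat.choose_succ_succ (n + m + 1) m,
      ← add_assoc n m 1, pow_succ]
    push_cast at h2 ⊢
    apply mul_right_cancel₀ hm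
    linear_combination ((-1) ^ m * (n + m + 1).choose m : K) * h1 - (-1) ^ m * n.choose m * h2

theorem sum_choose_mul_choose_div (n : ℕ) (z : K) (hz : ∀ k : ℕ, (k : K) + z ≠ 0) :
    ∑ k ∈ range (n + 1), (-1 : K) ^ k * n.choose k * (n + k).choose k / (k + z)
      = (∏ j ∈ range n, ((j : K) + 1 - z)) / ∏ j ∈ range (n + 1), ((j : K) + z) := by
  induction n with
  | zero => simp
  | succ n ih =>
    have hn : (n : K) + 1 ≠ 0 := by exact_mod_cast n.succ_ne_zero
    have hstep : ((n + 1 : ℕ) + z) * ∑ k ∈ range (n + 1 + 1),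
          (-1 : K) ^ k * (n + 1).choose k * (n + 1 + k).choose k / (k + z)
        = (n + 1 - z) *
          ∑ k ∈ range (n + 1), (-1 : K) ^ k * n.choose k * (n + k).choose k / (k + z) := by
      have h0 : ∑ k ∈ range (n + 1), (-1 : K) ^ k * n.choose k * (n + k).choose k / (k + z)
          = ∑ k ∈ range (n + 1 + 1), (-1 : K) ^ k * n.choose k * (n + k).choose k / (k + z) := by
        rw [sum_range_succ _ (n + 1), Nat.choose_succ_self]
        simp
      have h1 := sum_range_neg_one_pow_choose_mul_choose (K := K) n (n + 1)
      rw [Nat.choose_succ_self, Nat.cast_zero, mul_zero, zero_mul] at h1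
      rw [h0, ← sub_eq_zero, mul_sum, mul_sum, ← sum_sub_distrib]
      trans ∑ k ∈ range (n + 1 + 1), 2 * ((-1 : K) ^ k * (n + 1).choose k * (n + k).choose k)
      · refine sum_congr rfl fun k _ => ?_
        have hk := hz k
        have e1 := cast_succ_choose (K := K) n k
        have e2 := cast_add_succ_choose (K := K) n k
        rw [show n + 1 + k = n + k + 1 by ring]
        field_simp
        apply mul_right_cancel₀ hn
        push_cast
        linear_combination ((n : K) + 1 + z) * (n + 1).choose k * e2
          + ((n : K) + 1 - z) * (n + k).choose k * e1
      · rw [← mul_sum, h1, mul_zero]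
    have hnz : (((n + 1 : ℕ) : K) + z) ≠ 0 := hz _
    rw [← mul_right_inj' hnz, hstep, ih, prod_range_succ (fun j : ℕ => (j : K) + 1 - z) n,
      prod_range_succ (fun j : ℕ => (j : K) + z) (n + 1)]
    have hP : ∏ j ∈ range (n + 1), ((j : K) + z) ≠ 0 := prod_ne_zero_iff.2 fun j _ => hz j
    field_simp

variable {O : Subring K} {p : ℕ}

theorem centralBinom_sq_div_congr (hO : ∀ k : ℕ, ¬ p ∣ k → (k : K)⁻¹ ∈ O) {n : ℕ}
    (hn : 2 * n + 1 = p) {k : ℕ} (hk : k ≤ n) :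
    CongrMod O ((p : K) ^ 2) (((2 * k).choose k : K) ^ 2 / 16 ^ k)
      ((-1) ^ k * n.choose k * (n + k).choose k) := by
  induction k with
  | zero => exact .of_eq (by simp)
  | succ k ih =>
    obtain ⟨w, hw, h⟩ := ih (by omega)
    have hk0 : (k : K) + 1 ≠ 0 := by exact_mod_cast k.succ_ne_zero
    have hkO : ((2 * (k + 1) : ℕ) : K)⁻¹ ∈ O :=
      hO _ (Nat.not_dvd_of_pos_of_lt (by omega) (by omega))
    have e0 : ((2 * (k + 1)).choose (k + 1) : K) * (k + 1) =
        2 * (2 * k + 1) * (2 * k).choose k := by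
      have := Nat.succ_mul_centralBinom_succ k
      rw [Nat.centralBinom, Nat.centralBinom] at this
      have h2 : ((k : K) + 1) * ((2 * (k + 1)).choose (k + 1))
        = 2 * (2 * k + 1) * (2 * k).choose k := by exact_mod_cast this
      linear_combination h2
    have e1 := cast_choose_succ_right (K := K) n k
    have e2 : ((n + (k + 1)).choose (k + 1) : K) * (k + 1) = (n + k).choose k * (n + k + 1) := by
      have := Nat.add_one_mul_choose_eq (n + k) k
      have h2 : ((n : K) + k + 1) * (n + k).choose k = (n + k + 1).choose (k + 1) * (k + 1) := by
        exact_mod_cast this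
      rw [← add_assoc]
      linear_combination -h2
    have hpn : (p : K) = 2 * n + 1 := by exact_mod_cast hn.symm
    refine ⟨(w * (2 * k + 1) ^ 2 + (-1) ^ k * n.choose k * (n + k).choose k) *
      (((2 * (k + 1) : ℕ) : K)⁻¹) ^ 2, ?_, ?_⟩
    · have h1 : (2 * (k : K) + 1) ∈ O := by exact_mod_cast natCast_mem O (2 * k + 1)
      have h2 : (-1 : K) ^ k ∈ O := O.pow_mem (O.neg_mem O.one_mem) k
      exact O.mul_mem (O.add_mem (O.mul_mem hw (O.pow_mem h1 2)) (O.mul_mem (O.mul_mem h2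
        (natCast_mem O _)) (natCast_mem O _))) (O.pow_mem hkO 2)
    · have a0 := eq_div_of_mul_eq hk0 e0
      have a1 := eq_div_of_mul_eq hk0 e1
      have a2 := eq_div_of_mul_eq hk0 e2
      rw [a0, a1, a2, pow_succ, pow_succ]
      push_cast
      rw [hpn] at h ⊢
      field_simp at h ⊢
      linear_combination 16 * (2 * (k : K) + 1) ^ 2 * h

theorem centralBinom_sq_div_congr_zero (hp : p.Prime) (hp2 : p ≠ 2)
    (hO : ∀ k : ℕ, ¬ p ∣ k → (k : K)⁻¹ ∈ O) {k : ℕ} (hk : k < p) (hk2 : p ≤ 2 * k) :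
    CongrMod O ((p : K) ^ 2) (((2 * k).choose k : K) ^ 2 / 16 ^ k) 0 := by
  have hd : p ∣ (2 * k).choose k := by
    have h := Nat.choose_mul_factorial_mul_factorial (show k ≤ 2 * k by omega)
    have h2 : p ∣ (2 * k).factorial := hp.dvd_factorial.2 hk2
    have h3 : ¬ p ∣ k.factorial := by rw [hp.dvd_factorial]; omega
    rw [← h, show 2 * k - k = k by omega] at h2
    exact ((hp.dvd_mul.1 h2).resolve_right h3 |> hp.dvd_mul.1).resolve_right h3
  obtain ⟨c, hc⟩ := hd
  have h16 : ((16 : ℕ) : K)⁻¹ ∈ O := by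
    refine hO 16 fun h => hp2 ?_
    exact (Nat.prime_dvd_prime_iff_eq hp Nat.prime_two).1 (hp.dvd_of_dvd_pow (n := 4) h)
  refine ⟨(c : K) ^ 2 * (((16 : ℕ) : K)⁻¹) ^ k, O.mul_mem (O.pow_mem (natCast_mem O c) 2)
    (O.pow_mem h16 k), ?_⟩
  rw [hc]
  push_cast
  rw [inv_pow]
  ring

theorem prime_div_mem (hp : p.Prime) (hp7 : 7 < p)
    (hO : ∀ k : ℕ, ¬ p ∣ k → (k : K)⁻¹ ∈ O) {k a : ℕ} (hk : k < p) (ha : 0 < a) (ha8 : a < 8) :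
    (p : K) / (8 * k + a) ∈ O := by
  have hcast : (8 * (k : K) + a) = ((8 * k + a : ℕ) : K) := by push_cast; ring
  rw [hcast]
  by_cases h : p ∣ 8 * k + a
  · obtain ⟨m, hm⟩ := h
    have hm0 : 0 < m := Nat.pos_of_ne_zero (by rintro rfl; omega)
    have hm8 : m < 8 := by
      by_contra! h8
      have : p * 8 ≤ p * m := Nat.mul_le_mul_left p h8
      omega
    have hp0 : (p : K) ≠ 0 := by exact_mod_cast hp.ne_zero
    rw [hm, Nat.cast_mul, div_mul_cancel_left₀ hp0]
    exact hO m (Nat.not_dvd_of_pos_of_lt hm0 (by omega))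
  · rw [div_eq_mul_inv]
    exact O.mul_mem (natCast_mem O p) (hO _ h)

theorem sum_centralBinom_congr (hp : p.Prime) (hp7 : 7 < p)
    (hO : ∀ k : ℕ, ¬ p ∣ k → (k : K)⁻¹ ∈ O) {n : ℕ} (hn : 2 * n + 1 = p) {a : ℕ}
    (ha : 0 < a) (ha8 : a < 8) :
    CongrMod O ((p : K) ^ 2)
      (∑ k ∈ range p, ((2 * k).choose k : K) ^ 2 / 16 ^ k * ((p : K) / (8 * k + a)))
      (p * (∏ j ∈ range n, (8 * ((j : K) + 1) - a)) / ∏ j ∈ range (n + 1), (8 * (j : K) + a)) := by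
  have hsplit : range p = range (n + 1) ∪ Ico (n + 1) p := by
    rw [range_eq_Ico, range_eq_Ico, Ico_union_Ico_eq_Ico] <;> omega
  have hdisj : Disjoint (range (n + 1)) (Ico (n + 1) p) := by
    rw [range_eq_Ico]
    exact Ico_disjoint_Ico_consecutive _ _ _
  rw [hsplit, sum_union hdisj]
  have h1 : CongrMod O ((p : K) ^ 2)
      (∑ k ∈ range (n + 1), ((2 * k).choose k : K) ^ 2 / 16 ^ k * ((p : K) / (8 * k + a)))
      (∑ k ∈ range (n + 1),
        ((-1) ^ k * n.choose k * (n + k).choose k) * ((p : K) / (8 * k + a))) := by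
    refine CongrMod.sum fun k hk => ?_
    rw [mem_range] at hk
    simp_rw [mul_comm _ ((p : K) / _)]
    exact (centralBinom_sq_div_congr hO hn (by omega)).mul_left
      (prime_div_mem hp hp7 hO (by omega) ha ha8)
  have h2 : CongrMod O ((p : K) ^ 2)
      (∑ k ∈ Ico (n + 1) p, ((2 * k).choose k : K) ^ 2 / 16 ^ k * ((p : K) / (8 * k + a))) 0 := by
    rw [← sum_const_zero (s := Ico (n + 1) p)]
    refine CongrMod.sum fun k hk => ?_
    rw [mem_Ico] at hk
    rw [mul_comm _ ((p : K) / _), ← mul_zero ((p : K) / (8 * k + a))]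
    exact (centralBinom_sq_div_congr_zero hp (by omega) hO hk.2 (by omega)).mul_left
      (prime_div_mem hp hp7 hO hk.2 ha ha8)
  refine (h1.add h2).trans (.of_eq ?_)
  have h8 : (8 : K) ≠ 0 := by norm_num
  have hz : ∀ k : ℕ, (k : K) + a / 8 ≠ 0 := by
    intro k
    have : ((8 * k + a : ℕ) : K) ≠ 0 := by exact_mod_cast (show 8 * k + a ≠ 0 by omega)
    push_cast at this
    rw [show (k : K) + a / 8 = (8 * k + a) / 8 by field_simp]
    exact div_ne_zero this h8
  have key := sum_choose_mul_choose_div n ((a : K) / 8) hz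
  have e1 : ∏ j ∈ range n, (8 * ((j : K) + 1) - a)
      = 8 ^ n * ∏ j ∈ range n, ((j : K) + 1 - a / 8) := by
    rw [prod_congr rfl fun (j : ℕ) _ =>
        show 8 * ((j : K) + 1) - a = 8 * (j + 1 - a / 8) by field_simp,
      prod_mul_distrib, prod_const, card_range]
  have e2 : ∏ j ∈ range (n + 1), (8 * (j : K) + a)
      = 8 ^ (n + 1) * ∏ j ∈ range (n + 1), ((j : K) + a / 8) := by
    rw [prod_congr rfl fun (j : ℕ) _ => show 8 * (j : K) + a = 8 * (j + a / 8) by field_simp,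
      prod_mul_distrib, prod_const, card_range]
  have e3 : ∑ k ∈ range (n + 1),
        ((-1) ^ k * n.choose k * (n + k).choose k) * ((p : K) / (8 * k + a))
      = p / 8 * ∑ k ∈ range (n + 1),
        (-1 : K) ^ k * n.choose k * (n + k).choose k / (k + a / 8) := by
    rw [mul_sum]
    refine sum_congr rfl fun k _ => ?_
    have h := hz k
    rw [show (8 * (k : K) + a) = 8 * (k + a / 8) by field_simp]
    field_simp
  rw [add_zero, e1, e2, e3, key]
  have hP : ∏ j ∈ range (n + 1), ((j : K) + a / 8) ≠ 0 := prod_ne_zero_iff.2 fun j _ => hz j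
  rw [pow_succ]
  field_simp

end BinomialSums

section ClosedForm

variable {K : Type*} [Field K]

theorem CongrMod.one_add_mul_one_add {O : Subring K} {m u v : K} (hu : u ∈ O) (hv : v ∈ O) :
    CongrMod O (m ^ 2) ((1 + m * u) * (1 + m * v)) (1 + m * (u + v)) :=
  ⟨u * v, O.mul_mem hu hv, by ring⟩

theorem one_add_mul_mem {O : Subring K} {m u : K} (hm : m ∈ O) (hu : u ∈ O) : 1 + m * u ∈ O :=
  O.add_mem O.one_mem (O.mul_mem hm hu)

variable {O : Subring K} {p : ℕ}

theorem inv_eight_mem (hp : p.Prime) (hp2 : p ≠ 2) (hO : ∀ k : ℕ, ¬ p ∣ k → (k : K)⁻¹ ∈ O) :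
    (8 : K)⁻¹ ∈ O := by
  have := hO 8 fun h =>
    hp2 ((Nat.prime_dvd_prime_iff_eq hp Nat.prime_two).1 (hp.dvd_of_dvd_pow (n := 3) h))
  exact_mod_cast this

variable [CharZero K]

theorem succ_add_mul_ne_zero_and_inv_mem (hp : p.Prime) (hp2 : p ≠ 2)
    (hO : ∀ k : ℕ, ¬ p ∣ k → (k : K)⁻¹ ∈ O) (c : ℤ) {i : ℕ} (hi : i + 1 < p) :
    (i : K) + 1 + p * (c / 8) ≠ 0 ∧ ((i : K) + 1 + p * (c / 8))⁻¹ ∈ O := by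
  have h : ¬ (p : ℤ) ∣ 8 * (i + 1) + p * c := by
    rw [dvd_add_left (dvd_mul_right _ _)]
    intro h
    have h' : p ∣ 2 ^ 3 * (i + 1) := by exact_mod_cast h
    rcases hp.dvd_mul.1 h' with h2 | h2
    · exact hp2 ((Nat.prime_dvd_prime_iff_eq hp Nat.prime_two).1 (hp.dvd_of_dvd_pow h2))
    · exact Nat.not_dvd_of_pos_of_lt i.succ_pos hi h2
  have e : (i : K) + 1 + p * (c / 8) = ((8 * (i + 1) + p * c : ℤ) : K) / 8 := by
    push_cast
    field_simp
  have h0 : ((8 * (i + 1) + p * c : ℤ) : K) ≠ 0 := by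
    rw [Int.cast_ne_zero]
    rintro h'
    exact h (h' ▸ dvd_zero _)
  rw [e]
  refine ⟨div_ne_zero h0 (by norm_num), ?_⟩
  rw [inv_div, div_eq_mul_inv]
  exact O.mul_mem (by exact_mod_cast natCast_mem O 8) (inv_intCast_mem hO h)

theorem prod_succ_add_ne_zero_and_inv_mem (hp : p.Prime) (hp2 : p ≠ 2)
    (hO : ∀ k : ℕ, ¬ p ∣ k → (k : K)⁻¹ ∈ O) (c : ℤ) {k : ℕ} (hk : k < p) :
    ∏ i ∈ range k, ((i : K) + 1 + p * (c / 8)) ≠ 0 ∧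
      (∏ i ∈ range k, ((i : K) + 1 + p * (c / 8)))⁻¹ ∈ O := by
  have h : ∀ i ∈ range k, _ := fun i hi =>
    succ_add_mul_ne_zero_and_inv_mem hp hp2 hO c (i := i) (by rw [mem_range] at hi; omega)
  refine ⟨prod_ne_zero_iff.2 fun i hi => (h i hi).1, ?_⟩
  rw [← prod_inv_distrib]
  exact O.prod_mem fun i hi => (h i hi).2

theorem prod_div_prod_eq (hp : p.Prime) (hp2 : p ≠ 2)
    (hO : ∀ k : ℕ, ¬ p ∣ k → (k : K)⁻¹ ∈ O) {n k l a c : ℕ} (hn : 2 * n + 1 = p)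
    (hkl : k + l = n) (hc : 0 < c) (hac : 8 * k + a = c * p) :
    (c * (p * (∏ j ∈ range n, (8 * ((j : K) + 1) - a)) / ∏ j ∈ range (n + 1), (8 * (j : K) + a))) *
      ((∏ i ∈ range k, ((i : K) + 1 + p * ((-c : ℤ) / 8))) ^ 2 *
        ∏ i ∈ range l, ((i : K) + 1 + p * ((c : ℤ) / 8))) =
      (-1) ^ k * ∏ i ∈ range (n + k), ((i : K) + 1 + p * ((-c : ℤ) / 8)) := by
  have ha : (a : K) = c * p - 8 * k := by
    have : (8 * k + a : K) = c * p := by exact_mod_cast hac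
    linear_combination this
  have hG := (prod_succ_add_ne_zero_and_inv_mem hp hp2 hO (-c) (show k < p by omega)).1
  have hG' := (prod_succ_add_ne_zero_and_inv_mem hp hp2 hO c (show l < p by omega)).1
  have hp0 : (p : K) ≠ 0 := by exact_mod_cast hp.ne_zero
  have hc0 : (c : K) ≠ 0 := by exact_mod_cast hc.ne'
  have hN : (∏ i ∈ range (n + k), ((i : K) + 1 + p * ((-c : ℤ) / 8))) * 8 ^ n
      = (∏ i ∈ range k, ((i : K) + 1 + p * ((-c : ℤ) / 8))) *
        ∏ j ∈ range n, (8 * ((j : K) + 1) - a) := by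
    rw [add_comm n k, prod_range_add, mul_assoc,
      prod_congr rfl fun (j : ℕ) _ => show 8 * ((j : K) + 1) - a
        = (((k + j : ℕ) : K) + 1 + p * ((-c : ℤ) / 8)) * 8 by
          rw [ha]
          push_cast
          field_simp
          ring, prod_mul_distrib, prod_const, card_range]
  have hD : ∏ j ∈ range (n + 1), (8 * (j : K) + a)
      = (-1) ^ k * 8 ^ n * (c * p) * ((∏ i ∈ range k, ((i : K) + 1 + p * ((-c : ℤ) / 8))) *
        ∏ i ∈ range l, ((i : K) + 1 + p * ((c : ℤ) / 8))) := by
    have e1 : ∏ j ∈ range k, (8 * (j : K) + a)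
        = (-8) ^ k * ∏ i ∈ range k, ((i : K) + 1 + p * ((-c : ℤ) / 8)) := by
      rw [← prod_range_reflect, prod_congr rfl fun (j : ℕ) hj => show
        8 * ((k - 1 - j : ℕ) : K) + a = (-8) * ((j : K) + 1 + p * ((-c : ℤ) / 8)) by
          rw [mem_range] at hj
          rw [ha, show k - 1 - j = k - (j + 1) by omega, Nat.cast_sub (by omega)]
          push_cast
          field_simp
          ring, prod_mul_distrib, prod_const, card_range]
    have e2 : ∏ j ∈ range l, (8 * ((k + 1 + j : ℕ) : K) + a)
        = 8 ^ l * ∏ i ∈ range l, ((i : K) + 1 + p * ((c : ℤ) / 8)) := by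
      rw [prod_congr rfl fun (j : ℕ) _ => show
        8 * ((k + 1 + j : ℕ) : K) + a = 8 * ((j : K) + 1 + p * ((c : ℤ) / 8)) by
          rw [ha]
          push_cast
          field_simp
          ring, prod_mul_distrib, prod_const, card_range]
    rw [show n + 1 = k + 1 + l by omega, prod_range_add, prod_range_succ, e1, e2, ha, ← hkl,
      pow_add, neg_pow]
    ring
  rw [hD]
  generalize ∏ i ∈ range k, ((i : K) + 1 + p * ((-c : ℤ) / 8)) = G at *
  generalize ∏ i ∈ range l, ((i : K) + 1 + p * ((c : ℤ) / 8)) = G' at *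
  have hs : (-1 : K) ^ k * (-1) ^ k = 1 := by rw [← mul_pow]; simp
  have hs0 : (-1 : K) ^ k ≠ 0 := left_ne_zero_of_mul_eq_one hs
  have h8 : (8 : K) ^ n ≠ 0 := pow_ne_zero _ (by norm_num)
  generalize (-1 : K) ^ k = s at *
  clear hD
  generalize ∏ i ∈ range (n + k), ((i : K) + 1 + p * ((-c : ℤ) / 8)) = G'' at *
  generalize ∏ j ∈ range n, (8 * ((j : K) + 1) - a) = N at *
  field_simp
  linear_combination -hN - G'' * 8 ^ n * hs

theorem mul_sum_centralBinom_congr (hp : p.Prime) (hp7 : 7 < p)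
    (hO : ∀ k : ℕ, ¬ p ∣ k → (k : K)⁻¹ ∈ O) {n k l a c : ℕ} (hn : 2 * n + 1 = p)
    (hkl : k + l = n) (hc : 0 < c) (ha : 0 < a) (ha8 : a < 8) (hac : 8 * k + a = c * p) :
    CongrMod O ((p : K) ^ 2)
      (c * ∑ j ∈ range p, ((2 * j).choose j : K) ^ 2 / 16 ^ j * ((p : K) / (8 * j + a)))
      ((n.choose k : K) ^ 2 * (1 + p * (-harmonicSum K n +
        ((1 - 2 * (c / 8)) * harmonicSum K l + 2 * (c / 8) * harmonicSum K k)))) := by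
  have hp2 : p ≠ 2 := by omega
  have hpO : (p : K) ∈ O := natCast_mem O p
  refine ((sum_centralBinom_congr hp hp7 hO hn ha ha8).mul_left (natCast_mem O c)).trans ?_
  have hkey := prod_div_prod_eq hp hp2 hO hn hkl hc hac
  obtain ⟨hG, hGi⟩ := prod_succ_add_ne_zero_and_inv_mem hp hp2 hO (-c) (show k < p by omega)
  obtain ⟨hG', hGi'⟩ := prod_succ_add_ne_zero_and_inv_mem hp hp2 hO c (show l < p by omega)
  have heO : ((c : ℤ) : K) / 8 ∈ O := by
    rw [div_eq_mul_inv]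
    exact O.mul_mem (intCast_mem O c) (inv_eight_mem hp hp2 hO)
  have heO' : ((-c : ℤ) : K) / 8 ∈ O := by
    rw [div_eq_mul_inv]
    exact O.mul_mem (intCast_mem O _) (inv_eight_mem hp hp2 hO)
  have hkH := harmonicSum_mem (K := K) hO (show k < p by omega)
  have hlH := harmonicSum_mem (K := K) hO (show l < p by omega)
  have hnH := harmonicSum_mem (K := K) hO (show n < p by omega)
  have hmH := harmonicSum_mem (K := K) hO (show n + k < p by omega)
  have c1 := prod_succ_add_congr hO heO' (show k < p by omega)
  have c2 := prod_succ_add_congr hO heO (show l < p by omega)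
  have c3 := prod_succ_add_congr hO heO' (show n + k < p by omega)
  have c4 := factorial_mul_factorial_congr (K := K) hO (show l + (n + k) + 1 = p by omega)
  have c5 := factorial_mul_factorial_congr (K := K) hO (show n + n + 1 = p by omega)
  have c6 := (harmonicSum_congr (K := K) hp hp2 hO
    (show l + (n + k) + 1 = p by omega)).symm
  generalize (c * (p * (∏ j ∈ range n, (8 * ((j : K) + 1) - a)) /
    ∏ j ∈ range (n + 1), (8 * (j : K) + a))) = X at *
  generalize ∏ i ∈ range k, ((i : K) + 1 + p * ((-c : ℤ) / 8)) = G at *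
  generalize ∏ i ∈ range l, ((i : K) + 1 + p * ((c : ℤ) / 8)) = G' at *
  generalize ∏ i ∈ range (n + k), ((i : K) + 1 + p * ((-c : ℤ) / 8)) = G'' at *
  generalize harmonicSum K k = Hk at *
  generalize harmonicSum K l = Hl at *
  generalize harmonicSum K n = Hn at *
  generalize harmonicSum K (n + k) = Hm at *
  have hee : ((-c : ℤ) : K) / 8 = -(c / 8) := by push_cast; ring
  have hee' : ((c : ℤ) : K) / 8 = c / 8 := by push_cast; ring
  rw [hee] at heO' c1 c3
  rw [hee'] at heO c2
  generalize (c : K) / 8 = e at *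
  have hkl' : (k.factorial * l.factorial * n.choose k : K) = n.factorial := by
    have := Nat.choose_mul_factorial_mul_factorial (show k ≤ n by omega)
    rw [show n - k = l by omega] at this
    rw [← this]
    push_cast
    ring
  have hl0 : (l.factorial : K) ≠ 0 := by exact_mod_cast l.factorial_ne_zero
  have hlO := inv_factorial_mem hp hO (show l < p by omega)
  have hsign : (-1 : K) ^ k * (-1) ^ l = (-1) ^ n := by rw [← pow_add, hkl]
  have hfO : ∀ j : ℕ, (j.factorial : K) ∈ O := fun j => natCast_mem O _
  have hs : ∀ j : ℕ, (-1 : K) ^ j ∈ O := fun j => O.pow_mem (O.neg_mem O.one_mem) j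
  have hHe : Hl - e * Hl ∈ O := O.sub_mem hlH (O.mul_mem heO hlH)
  have hme : ∀ {u}, u ∈ O → -e * u ∈ O := fun hu => O.mul_mem heO' hu
  have hone : ∀ {u}, u ∈ O → 1 + (p : K) * u ∈ O := fun hu => one_add_mul_mem hpO hu
  refine CongrMod.cancel_left (c := G ^ 2 * G' * l.factorial) ?_
    (mul_ne_zero (mul_ne_zero (pow_ne_zero 2 hG) hG') hl0) (CongrMod.trans
      (y := (-1) ^ n * (p - 1).factorial * (1 + p * (Hl - e * Hl))) ?_ (CongrMod.symm ?_))
  · rw [mul_inv, mul_inv, ← inv_pow]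
    exact O.mul_mem (O.mul_mem (O.pow_mem hGi 2) hGi') hlO
  · have h1 : CongrMod O ((p : K) ^ 2) G'' ((n + k).factorial * (1 + p * (-e * Hl))) := by
      refine c3.trans ?_
      have := ((c6.mul_left heO').mul_modulus (p : K)).mul_left (hfO (n + k))
      obtain ⟨w, hw, h⟩ := this
      exact ⟨w, hw, by linear_combination h⟩
    have h2 := (c4.mul (CongrMod.refl (1 + p * (-e * Hl))) (hone (hme hlH))
      (O.mul_mem (O.mul_mem (hs l) (hfO _)) (hone hlH))).mul_left (hs k)
    have h3 := (h1.mul_left (hfO l)).mul_left (hs k)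
    have h4 := (CongrMod.one_add_mul_one_add (m := (p : K)) hlH (hme hlH)).mul_left
      (O.mul_mem (hs n) (hfO (p - 1)))
    refine (CongrMod.of_eq ?_).trans (h3.trans ((CongrMod.of_eq ?_).trans (h2.trans
      ((CongrMod.of_eq ?_).trans (h4.trans (CongrMod.of_eq ?_))))))
    · linear_combination (l.factorial : K) * hkey
    · ring
    · rw [← hsign]
      ring
    · ring
  · have hC : (n.choose k : K) ^ 2 ∈ O := O.pow_mem (natCast_mem O _) 2
    have hV : -Hn + ((1 - 2 * e) * Hl + 2 * e * Hk) ∈ O := by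
      have h2 : 2 * e ∈ O := by
        rw [two_mul]
        exact O.add_mem heO heO
      exact O.add_mem (O.neg_mem hnH) (O.add_mem (O.mul_mem (O.sub_mem O.one_mem h2) hlH)
        (O.mul_mem h2 hkH))
    have hV' : -Hn + (Hl - e * Hl) ∈ O := O.add_mem (O.neg_mem hnH) hHe
    have hGO : G ∈ O := c1.mem (O.pow_mem hpO 2) (by
      rw [mul_assoc (p : K)]
      exact O.mul_mem (hfO k) (hone (hme hkH)))
    have hGO' : G' ∈ O := c2.mem (O.pow_mem hpO 2) (by
      rw [mul_assoc (p : K)]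
      exact O.mul_mem (hfO l) (hone (O.mul_mem heO hlH)))
    rw [mul_assoc (p : K)] at c1 c2
    have hEO := hone (O.mul_mem heO hlH)
    have hEk := hone (hme hkH)
    have h1 := ((c1.pow hGO (O.mul_mem (hfO k) hEk) 2).mul c2 hGO'
      (O.pow_mem (O.mul_mem (hfO k) hEk) 2)).mul
        (CongrMod.refl ((l.factorial : K) * ((n.choose k : K) ^ 2 *
          (1 + p * (-Hn + ((1 - 2 * e) * Hl + 2 * e * Hk))))))
        (O.mul_mem (hfO l) (O.mul_mem hC (hone hV)))
        (O.mul_mem (O.pow_mem (O.mul_mem (hfO k) hEk) 2) (O.mul_mem (hfO l) hEO))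
    have h2 := (CongrMod.one_add_mul_one_add (m := (p : K)) (hme hkH) (hme hkH)).mul
      (CongrMod.one_add_mul_one_add (m := (p : K)) (O.mul_mem heO hlH) hV)
      (O.mul_mem hEO (hone hV)) (hone (O.add_mem (hme hkH) (hme hkH)))
    have h3 := (h2.trans (CongrMod.one_add_mul_one_add (m := (p : K))
      (O.add_mem (hme hkH) (hme hkH)) (O.add_mem (O.mul_mem heO hlH) hV))).mul_left
        (O.mul_mem (hfO n) (hfO n))
    have h4 := c5.mul (CongrMod.refl (1 + p * (-Hn + (Hl - e * Hl)))) (hone hV')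
      (O.mul_mem (O.mul_mem (hs n) (hfO _)) (hone hnH))
    have h5 := (CongrMod.one_add_mul_one_add (m := (p : K)) hnH hV').mul_left
      (O.mul_mem (hs n) (hfO (p - 1)))
    refine (CongrMod.of_eq ?_).trans (h1.trans ((CongrMod.of_eq ?_).trans
      (h3.trans ((CongrMod.of_eq ?_).trans (h4.trans ((CongrMod.of_eq ?_).trans
        (h5.trans (CongrMod.of_eq ?_))))))))
    · ring
    · rw [← hkl']
      ring
    · ring
    · ring
    · ring

end ClosedForm

section Coefficients

variable {K : Type*} [Field K]

theorem Polynomial.coeff_one_sub_X_pow (N i : ℕ) :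
    ((1 - X : Polynomial K) ^ N).coeff i = (-1) ^ i * (N.choose i : K) := by
  have h : (1 - X : Polynomial K) = (1 + X).comp (-X) := by simp [sub_eq_add_neg]
  have hc : (-X : Polynomial K) = Polynomial.C (-1) * X := by simp
  rw [h, ← Polynomial.pow_comp, hc, Polynomial.comp_C_mul_X_coeff, Polynomial.coeff_one_add_X_pow]
  ring

/-- The polynomial `∑ X ^ s / s` over `0 < s < p`, a truncation of `-log (1 - X)`. -/
noncomputable def truncatedLog (K : Type*) [Field K] (p : ℕ) : Polynomial K :=
  ∑ j ∈ range p, Polynomial.C ((j : K)⁻¹) * Polynomial.X ^ j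

theorem coeff_truncatedLog (p j : ℕ) :
    (truncatedLog K p).coeff j = if j < p then (j : K)⁻¹ else 0 := by
  simp [truncatedLog, Polynomial.coeff_C_mul, Polynomial.coeff_X_pow]

theorem natDegree_one_sub_X_pow_le (N : ℕ) :
    ((1 - Polynomial.X : Polynomial K) ^ N).natDegree ≤ N := by
  refine (Polynomial.natDegree_pow_le).trans ?_
  have : (1 - Polynomial.X : Polynomial K).natDegree ≤ 1 :=
    (Polynomial.natDegree_sub_le _ _).trans (by simp)
  nlinarith

theorem natDegree_truncatedLog_le (p : ℕ) : (truncatedLog K p).natDegree ≤ p - 1 := by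
  rw [Polynomial.natDegree_le_iff_coeff_eq_zero]
  intro j hj
  rw [coeff_truncatedLog, if_neg (by omega)]

/-- The alternating binomial sum `∑ (-1) ^ i * C(N, i) / (a - i)` over `i < a`. -/
def altChooseSum (K : Type*) [Field K] (N a : ℕ) : K :=
  ∑ i ∈ range a, (-1) ^ i * (N.choose i : K) * ((a - i : ℕ) : K)⁻¹

theorem altChooseSum_succ_succ (N a : ℕ) :
    altChooseSum K (N + 1) (a + 1) = altChooseSum K N (a + 1) - altChooseSum K N a := by
  unfold altChooseSum
  rw [sum_range_succ', sum_range_succ', ← sub_eq_zero]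
  have : ∀ i ∈ range a,
      (-1) ^ (i + 1) * ((N + 1).choose (i + 1) : K) * ((a + 1 - (i + 1) : ℕ) : K)⁻¹
      = (-1) ^ (i + 1) * (N.choose (i + 1) : K) * ((a + 1 - (i + 1) : ℕ) : K)⁻¹
        - (-1) ^ i * (N.choose i : K) * ((a - i : ℕ) : K)⁻¹ := by
    intro i _
    rw [Nat.choose_succ_succ, Nat.add_sub_add_right]
    push_cast
    ring
  rw [sum_congr rfl this, sum_sub_distrib]
  simp
  ring

variable [CharZero K]

theorem altChooseSum_self_succ (N : ℕ) :
    altChooseSum K N (N + 1) = (-1) ^ N * ((N : K) + 1)⁻¹ := by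
  have hN : ((N : K) + 1) ≠ 0 := by exact_mod_cast N.succ_ne_zero
  have h : ∑ i ∈ range (N + 2), (-1 : K) ^ i * ((N + 1).choose i : K) = 0 := by
    have := Int.alternating_sum_range_choose (n := N + 1)
    rw [if_neg N.succ_ne_zero] at this
    exact_mod_cast congrArg (Int.cast : ℤ → K) this
  rw [sum_range_succ, Nat.choose_self] at h
  have key : altChooseSum K N (N + 1)
      = (∑ i ∈ range (N + 1), (-1 : K) ^ i * ((N + 1).choose i : K)) * ((N : K) + 1)⁻¹ := by
    rw [altChooseSum, sum_mul]
    refine sum_congr rfl fun i hi => ?_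
    rw [mem_range] at hi
    have h1 : ((N + 1 - i : ℕ) : K) ≠ 0 := by
      rw [Nat.cast_ne_zero]
      omega
    have h2 : ((N.succ.choose i : ℕ) : K) * ((N.succ - i : ℕ) : K) =
        ((N.choose i : ℕ) : K) * (N + 1) := by
      have := Nat.choose_mul_succ_eq N i
      exact_mod_cast this.symm
    field_simp
    simp only [Nat.succ_eq_add_one] at h2
    linear_combination -h2
  rw [key]
  field_simp
  linear_combination h

theorem altChooseSum_eq {N a : ℕ} (h : a ≤ N) :
    altChooseSum K N a
      = (-1) ^ a * (N.choose a : K) * (harmonicSum K (N - a) - harmonicSum K N) := by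
  induction N generalizing a with
  | zero =>
    obtain rfl : a = 0 := by omega
    simp [altChooseSum]
  | succ N ih =>
    cases a with
    | zero => simp [altChooseSum]
    | succ a =>
      have ha : ((a : K) + 1) ≠ 0 := by exact_mod_cast a.succ_ne_zero
      have hN : ((N : K) + 1) ≠ 0 := by exact_mod_cast N.succ_ne_zero
      rw [altChooseSum_succ_succ, ih (a := a) (by omega), Nat.add_sub_add_right]
      have e1 : ((N + 1).choose (a + 1) : K) * (a + 1) = (N + 1) * N.choose a := by
        exact_mod_cast (Nat.add_one_mul_choose_eq N a).symm
      rcases (show a ≤ N by omega).lt_or_eq with h' | rfl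
      · obtain ⟨d, rfl⟩ : ∃ d, N = a + 1 + d := ⟨N - (a + 1), by omega⟩
        rw [ih (a := a + 1) (by omega), show a + 1 + d - (a + 1) = d by omega,
          show a + 1 + d - a = d + 1 by omega, harmonicSum_succ K d, harmonicSum_succ K (a + 1 + d),
          Nat.choose_succ_succ (a + 1 + d) a]
        have e2 : ((a + 1 + d).choose (a + 1) : K) * (a + 1) = (a + 1 + d).choose a * (d + 1) := by
          have := Nat.choose_succ_right_eq (a + 1 + d) a
          rw [show a + 1 + d - a = d + 1 by omega] at this
          exact_mod_cast this
        have hd : ((d : K) + 1) ≠ 0 := by exact_mod_cast d.succ_ne_zero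
        rw [Nat.choose_succ_succ (a + 1 + d) a] at e1
        push_cast at e1 hN ⊢
        generalize ((a + 1 + d).choose (a + 1) : K) = U at *
        generalize ((a + 1 + d).choose a : K) = V at *
        have hV : V = U * ((a : K) + 1) * ((d : K) + 1)⁻¹ := by
          field_simp
          linear_combination -e2
        rw [hV]
        field_simp
        ring
      · rw [altChooseSum_self_succ, harmonicSum_succ]
        simp [harmonicSum]
        ring

theorem coeff_one_sub_X_pow_mul_truncatedLog {p N b : ℕ} (hb : b < p) (hbN : b ≤ N) :
    ((1 - Polynomial.X) ^ N * truncatedLog K p).coeff b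
      = (-1) ^ b * (N.choose b : K) * (harmonicSum K (N - b) - harmonicSum K N) := by
  rw [← altChooseSum_eq hbN, Polynomial.coeff_mul,
    Nat.sum_antidiagonal_eq_sum_range_succ
      (fun i j => ((1 - Polynomial.X : Polynomial K) ^ N).coeff i * (truncatedLog K p).coeff j),
    sum_range_succ, altChooseSum]
  simp only [Polynomial.coeff_one_sub_X_pow, coeff_truncatedLog]
  simp only [Nat.sub_self, Nat.cast_zero, inv_zero, ite_self, mul_zero, add_zero]
  exact sum_congr rfl fun i _ => by rw [if_pos (by omega)]

theorem coeff_add_one_sub_X_pow_mul_truncatedLog {O : Subring K} {p N b : ℕ}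
    (hO : ∀ k : ℕ, ¬ p ∣ k → (k : K)⁻¹ ∈ O) (hN : N < p) (hbN : b ≤ N) :
    CongrMod O (p : K) (((1 - Polynomial.X) ^ N * truncatedLog K p).coeff (b + p))
      ((-1) ^ (b + 1) * (N.choose b : K) * (harmonicSum K b - harmonicSum K N)) := by
  have hs : (-1 : K) ^ (N - b) * (-1) ^ N = (-1) ^ b := by
    obtain ⟨d, rfl⟩ : ∃ d, N = b + d := ⟨N - b, by omega⟩
    rw [Nat.add_sub_cancel_left, pow_add]
    have : (-1 : K) ^ d * (-1) ^ d = 1 := by rw [← mul_pow]; simp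
    linear_combination (-1 : K) ^ b * this
  have h1 : ((1 - Polynomial.X) ^ N * truncatedLog K p).coeff (b + p)
      = ∑ m ∈ range (N - b), (-1) ^ (b + 1 + m) * (N.choose (b + 1 + m) : K) *
          ((p - 1 - m : ℕ) : K)⁻¹ := by
    rw [Polynomial.coeff_mul, Nat.sum_antidiagonal_eq_sum_range_succ
      (fun i j => ((1 - Polynomial.X : Polynomial K) ^ N).coeff i * (truncatedLog K p).coeff j)]
    simp only [Polynomial.coeff_one_sub_X_pow, coeff_truncatedLog]
    rw [show (b + p).succ = b + 1 + (N - b) + (p - N + b) by omega, sum_range_add, sum_range_add,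
      sum_eq_zero, sum_eq_zero (s := range (p - N + b)), zero_add, add_zero]
    · refine sum_congr rfl fun m hm => ?_
      rw [mem_range] at hm
      rw [if_pos (by omega), show b + p - (b + 1 + m) = p - 1 - m by omega]
    · intro i _
      rw [Nat.choose_eq_zero_of_lt (by omega)]
      simp
    · intro i hi
      rw [mem_range] at hi
      rw [if_neg (by omega), mul_zero]
  have h2 : (-1) ^ (b + 1) * (N.choose b : K) * (harmonicSum K b - harmonicSum K N)
      = ∑ m ∈ range (N - b), (-1) ^ (b + 1 + m) * (N.choose (b + 1 + m) : K) *
          (-((m : K) + 1)⁻¹) := by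
    have h3 := altChooseSum_eq (K := K) (show N - b ≤ N by omega)
    rw [Nat.choose_symm hbN, show N - (N - b) = b by omega] at h3
    rw [pow_succ, ← hs]
    have h4 : (-1) ^ (N - b) * (-1) ^ N * -1 * (N.choose b : K) *
        (harmonicSum K b - harmonicSum K N) = - (-1) ^ N * altChooseSum K N (N - b) := by
      rw [h3]
      ring
    rw [h4, altChooseSum, ← sum_range_reflect, mul_sum]
    refine sum_congr rfl fun m hm => ?_
    rw [mem_range] at hm
    rw [show N - b - (N - b - 1 - m) = m + 1 by omega,
      ← Nat.choose_symm (show b + 1 + m ≤ N by omega),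
      show N - (b + 1 + m) = N - b - 1 - m by omega]
    have h5 : (-1 : K) ^ N * (-1) ^ (N - b - 1 - m) = (-1) ^ (b + 1 + m) := by
      obtain ⟨d, rfl⟩ : ∃ d, N = b + 1 + m + d := ⟨N - (b + 1 + m), by omega⟩
      rw [show b + 1 + m + d - b - 1 - m = d by omega, pow_add _ (b + 1 + m)]
      have : (-1 : K) ^ d * (-1) ^ d = 1 := by rw [← mul_pow]; simp
      linear_combination (-1 : K) ^ (b + 1 + m) * this
    rw [← h5]
    push_cast
    ring
  rw [h1, h2]
  refine CongrMod.sum fun m hm => ?_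
  rw [mem_range] at hm
  refine CongrMod.mul_left (O.mul_mem (O.pow_mem (O.neg_mem O.one_mem) _) (natCast_mem O _)) ?_
  have hm1 : ((m : K) + 1)⁻¹ ∈ O := inv_succ_mem hO (by omega)
  have hm2 : ((p - 1 - m : ℕ) : K)⁻¹ ∈ O := hO _ (Nat.not_dvd_of_pos_of_lt (by omega) (by omega))
  have hm3 : ((p - 1 - m : ℕ) : K) ≠ 0 := by
    rw [Nat.cast_ne_zero]
    omega
  have hm4 : ((m : K) + 1) ≠ 0 := by exact_mod_cast m.succ_ne_zero
  refine ⟨_, O.mul_mem hm1 hm2, ?_⟩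
  have : ((p - 1 - m : ℕ) : K) = p - (m + 1) := by
    rw [show p - 1 - m = p - (m + 1) by omega, Nat.cast_sub (by omega)]
    push_cast
    ring
  field_simp
  rw [this]
  ring

end Coefficients

/-- A multiplicative section `τ` of the reduction map from a subring `O` of a field `K`, in which
`p` is a prime element, onto a residue field `F`. -/
structure TeichmullerLift (p : ℕ) (F K : Type*) [Field F] [Field K] where
  O : Subring K
  τ : F →* K
  map_mem : ∀ t, τ t ∈ O
  map_zero : τ 0 = 0
  injective : Function.Injective τ
  map_one_sub : ∀ t, CongrMod O (p : K) (τ (1 - t)) (1 - τ t)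
  inv_natCast_mem : ∀ k : ℕ, ¬ p ∣ k → (k : K)⁻¹ ∈ O
  inv_natCast_self_notMem : (p : K)⁻¹ ∉ O
  prime : ∀ x ∈ O, ∀ y ∈ O, CongrMod O (p : K) (x * y) 0 →
    CongrMod O (p : K) x 0 ∨ CongrMod O (p : K) y 0

theorem CongrMod.pow_prime {K : Type*} [Field K] {O : Subring K} {p : ℕ} {x y : K}
    (h : CongrMod O (p : K) x y) (hx : x ∈ O) (hy : y ∈ O) :
    CongrMod O ((p : K) ^ 2) (x ^ p) (y ^ p) := by
  obtain ⟨w, hw, e⟩ := h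
  have h1 : ((p : ℕ) : O) ∣ (⟨x, hx⟩ : O) - ⟨y, hy⟩ := ⟨⟨w, hw⟩, Subtype.ext (by simpa using e)⟩
  obtain ⟨v, hv⟩ := dvd_sub_pow_of_dvd_sub h1 1
  exact ⟨v, v.2, by simpa using congrArg Subtype.val hv⟩

section TruncatedLog

variable {K : Type*} [Field K] {O : Subring K} {p : ℕ}

theorem choose_sub_one_congr (hp : p.Prime) {j : ℕ} (hj : j < p) :
    CongrMod O (p : K) ((p - 1).choose j : K) ((-1) ^ j) := by
  induction j with
  | zero => exact .of_eq (by simp)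
  | succ j ih =>
    have h1 : ((p - 1).choose j : K) + (p - 1).choose (j + 1) = p.choose (j + 1) := by
      have := Nat.choose_succ_succ (p - 1) j
      rw [show (p - 1).succ = p by omega, Nat.succ_eq_add_one] at this
      exact_mod_cast congrArg (Nat.cast : ℕ → K) this.symm
    obtain ⟨d, hd⟩ := hp.dvd_choose_self j.succ_ne_zero hj
    rw [Nat.succ_eq_add_one] at hd
    obtain ⟨w, hw, e⟩ := ih (by omega)
    refine ⟨d - w, O.sub_mem (natCast_mem O d) hw, ?_⟩
    have hd' : (p.choose (j + 1) : K) = p * d := by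
      exact_mod_cast congrArg (Nat.cast : ℕ → K) hd
    rw [pow_succ]
    linear_combination h1 + hd' - e

variable [CharZero K]

theorem one_sub_pow_prime_congr (hp : p.Prime) (hp2 : p ≠ 2)
    (hO : ∀ k : ℕ, ¬ p ∣ k → (k : K)⁻¹ ∈ O) {x : K} (hx : x ∈ O) :
    CongrMod O ((p : K) ^ 2) ((1 - x) ^ p) (1 - x ^ p - p * (truncatedLog K p).eval x) := by
  have hodd : Odd p := hp.odd_of_ne_two hp2
  have h1 : (1 - x) ^ p =
      1 + ∑ i ∈ range (p - 1), (-1) ^ (i + 1) * (p.choose (i + 1) : K) * x ^ (i + 1)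
      - x ^ p := by
    rw [sub_eq_neg_add, add_pow, sum_range_succ]
    nth_rewrite 1 [show p = p - 1 + 1 from by have := hp.pos; omega]
    rw [sum_range_succ', hodd.neg_pow]
    simp only [Nat.choose_self, one_pow, mul_one, pow_zero, Nat.choose_zero_right]
    have : ∀ i ∈ range (p - 1), (-x) ^ (i + 1) * (p.choose (i + 1) : K)
        = (-1) ^ (i + 1) * (p.choose (i + 1) : K) * x ^ (i + 1) := by
      intro i _
      rw [neg_pow]
      ring
    rw [sum_congr rfl this]
    push_cast
    ring
  have h2 : (truncatedLog K p).eval x = ∑ i ∈ range (p - 1), ((i : K) + 1)⁻¹ * x ^ (i + 1) := by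
    rw [truncatedLog, Polynomial.eval_finsetSum]
    nth_rewrite 1 [show p = p - 1 + 1 from by have := hp.pos; omega]
    rw [sum_range_succ']
    simp
  have h3 : CongrMod O ((p : K) ^ 2)
      (∑ i ∈ range (p - 1), (-1) ^ (i + 1) * (p.choose (i + 1) : K) * x ^ (i + 1))
      (∑ i ∈ range (p - 1), (-(p * (((i : K) + 1)⁻¹ * x ^ (i + 1))))) := by
    refine .sum fun i hi => ?_
    rw [mem_range] at hi
    have hi0 : ((i : K) + 1) ≠ 0 := by exact_mod_cast i.succ_ne_zero
    have hc : (p.choose (i + 1) : K) = p * ((i : K) + 1)⁻¹ * (p - 1).choose i := by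
      have := Nat.add_one_mul_choose_eq (p - 1) i
      rw [show p - 1 + 1 = p by omega] at this
      have h' : (p : K) * (p - 1).choose i = p.choose (i + 1) * (i + 1) := by exact_mod_cast this
      field_simp
      linear_combination -h'
    obtain ⟨w, hw, e⟩ := choose_sub_one_congr (K := K) (O := O) hp (show i < p by omega)
    refine ⟨(-1) ^ (i + 1) * ((i : K) + 1)⁻¹ * w * x ^ (i + 1),
      O.mul_mem (O.mul_mem (O.mul_mem (O.pow_mem (O.neg_mem O.one_mem) _)
        (inv_succ_mem hO (by omega))) hw) (O.pow_mem hx _), ?_⟩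
    have hs : (-1 : K) ^ i * (-1) ^ i = 1 := by rw [← mul_pow]; simp
    rw [hc, pow_succ (-1 : K)]
    linear_combination -(-1 : K) ^ i * p * ((i : K) + 1)⁻¹ * x ^ (i + 1) * e -
      p * ((i : K) + 1)⁻¹ * x ^ (i + 1) * hs
  obtain ⟨w, hw, e⟩ := h3
  refine ⟨w, hw, ?_⟩
  rw [h1, h2, mul_sum]
  rw [sum_neg_distrib] at e
  linear_combination e

theorem eval_truncatedLog_mem (hO : ∀ k : ℕ, ¬ p ∣ k → (k : K)⁻¹ ∈ O) {x : K} (hx : x ∈ O) :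
    (truncatedLog K p).eval x ∈ O := by
  rw [truncatedLog, Polynomial.eval_finsetSum]
  refine O.sum_mem fun j hj => ?_
  rw [mem_range] at hj
  simp only [Polynomial.eval_mul, Polynomial.eval_C, Polynomial.eval_pow, Polynomial.eval_X]
  refine O.mul_mem ?_ (O.pow_mem hx _)
  rcases Nat.eq_zero_or_pos j with rfl | h
  · simp [O.zero_mem]
  · exact hO j (Nat.not_dvd_of_pos_of_lt h hj)

end TruncatedLog

/-- A first order expansion: `(u - p v) ^ n ≡ u ^ n - p n u ^ (n - 1) v` modulo `p ^ 2`. -/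
theorem sub_mul_pow_congr {K : Type*} [Field K] {O : Subring K} {m u v : K} (hm : m ∈ O)
    (hu : u ∈ O) (hv : v ∈ O) (n : ℕ) :
    CongrMod O (m ^ 2) ((u - m * v) ^ (n + 1))
      (u ^ (n + 1) - m * ((n + 1 : ℕ) * (u ^ n * v))) := by
  induction n with
  | zero => exact .of_eq (by simp)
  | succ n ih =>
    have hmv := O.mul_mem hm hv
    have h := ih.mul (.refl (u - m * v)) (O.sub_mem hu hmv)
      (O.sub_mem (O.pow_mem hu _) (O.mul_mem hm (O.mul_mem (natCast_mem O _)
        (O.mul_mem (O.pow_mem hu _) hv))))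
    rw [pow_succ (u - m * v)]
    refine h.trans ⟨(n + 1 : ℕ) * (u ^ n * v ^ 2), O.mul_mem (natCast_mem O _)
      (O.mul_mem (O.pow_mem hu _) (O.pow_mem hv _)), ?_⟩
    push_cast
    ring

namespace TeichmullerLift

variable {p : ℕ} {F K : Type*} [Field F] [Field K] (T : TeichmullerLift p F K)

theorem natCast_mem (k : ℕ) : (k : K) ∈ T.O := _root_.natCast_mem T.O k

theorem map_one_sub_pow_congr [CharZero K] (hp : p.Prime) (hp2 : p ≠ 2) (t : F) :
    CongrMod T.O ((p : K) ^ 2) (T.τ (1 - t) ^ p)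
      (1 - T.τ t ^ p - p * (truncatedLog K p).eval (T.τ t)) :=
  ((T.map_one_sub t).pow_prime (T.map_mem _) (T.O.sub_mem T.O.one_mem (T.map_mem t))).trans
    (one_sub_pow_prime_congr hp hp2 T.inv_natCast_mem (T.map_mem t))

variable [Fintype F]

theorem sum_pow {j : ℕ} (hj : j ≠ 0) :
    ∑ t, T.τ t ^ j
      = if Fintype.card F - 1 ∣ j then ((Fintype.card F - 1 : ℕ) : K) else 0 := by
  classical
  split_ifs with h
  · have h1 : ∀ t : F, T.τ t ^ j = if t = 0 then 0 else 1 := by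
      intro t
      split_ifs with ht
      · rw [ht, T.map_zero, zero_pow hj]
      · obtain ⟨d, rfl⟩ := h
        rw [← map_pow, pow_mul, FiniteField.pow_card_sub_one_eq_one t ht, one_pow, map_one]
    rw [Fintype.sum_congr _ _ h1, sum_ite, sum_const_zero, zero_add, sum_const, nsmul_eq_mul,
      mul_one, filter_ne', card_erase_of_mem (mem_univ _), card_univ]
  · obtain ⟨g, hg⟩ := IsCyclic.exists_generator (α := Fˣ)
    have hord : orderOf g = Fintype.card F - 1 := by
      rw [orderOf_eq_card_of_forall_mem_zpowers hg, Nat.card_eq_fintype_card, Fintype.card_units]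
    have hne : T.τ (g : F) ^ j ≠ 1 := by
      intro h'
      rw [← map_pow, ← map_one T.τ] at h'
      have := T.injective h'
      rw [← Units.val_pow_eq_pow_val, Units.val_eq_one] at this
      exact h (hord ▸ orderOf_dvd_of_pow_eq_one this)
    have h1 : T.τ (g : F) ^ j * ∑ t, T.τ t ^ j = ∑ t, T.τ t ^ j := by
      rw [mul_sum, ← Equiv.sum_comp (Equiv.mulLeft₀ (g : F) g.ne_zero) (fun t => T.τ t ^ j)]
      refine Fintype.sum_congr _ _ fun t => ?_
      simp [mul_pow]
    have h2 : (T.τ (g : F) ^ j - 1) * ∑ t, T.τ t ^ j = 0 := by linear_combination h1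
    exact (mul_eq_zero.1 h2).resolve_left (sub_ne_zero.2 hne)

theorem sum_pow_mul_eval {A a Q : ℕ} (hQ : Q + 1 = Fintype.card F) (hA : A + a = Q) (hA0 : 0 < A)
    {P : Polynomial K} (hP : P.natDegree < a + 2 * Q) :
    ∑ t, T.τ t ^ A * P.eval (T.τ t) = Q * (P.coeff a + P.coeff (a + Q)) := by
  have hQ' : Fintype.card F - 1 = Q := by omega
  simp only [Polynomial.eval_eq_sum_range' hP, mul_sum]
  rw [sum_comm]
  have h1 : ∀ k ∈ range (a + 2 * Q), ∑ t, T.τ t ^ A * (P.coeff k * T.τ t ^ k)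
      = (if k = a then Q * P.coeff a else 0) + if k = a + Q then Q * P.coeff (a + Q) else 0 := by
    intro k hk
    rw [mem_range] at hk
    have h2 : ∑ t, T.τ t ^ A * (P.coeff k * T.τ t ^ k) = P.coeff k * ∑ t, T.τ t ^ (A + k) := by
      rw [mul_sum]
      refine Fintype.sum_congr _ _ fun t => ?_
      rw [pow_add]
      ring
    rw [h2, T.sum_pow (by omega), hQ']
    by_cases hka : k = a
    · subst hka
      rw [if_pos (by rw [hA]), if_pos rfl, if_neg (by omega)]
      ring
    · by_cases hka' : k = a + Q
      · subst hka'
        rw [if_pos (by rw [← add_assoc, hA, ← two_mul]; exact dvd_mul_left _ _), if_neg hka,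
          if_pos rfl]
        ring
      · rw [if_neg, if_neg hka, if_neg hka']
        · ring
        · rintro ⟨d, hd⟩
          have hd3 : d < 3 := by
            by_contra h
            have : Q * 3 ≤ Q * d := Nat.mul_le_mul_left Q (by omega)
            omega
          interval_cases d <;> omega
  rw [sum_congr rfl h1, sum_add_distrib, sum_ite_eq', sum_ite_eq', if_pos, if_pos]
  · ring
  · rw [mem_range]; omega
  · rw [mem_range]; omega

end TeichmullerLift

theorem Polynomial.coeff_mul_expand {K : Type*} [Field K] {p r s : ℕ} {P R : Polynomial K}
    (hP : P.natDegree < 2 * p) (hr : r < p) :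
    (P * Polynomial.expand K p R).coeff (r + p * (s + 1))
      = P.coeff r * R.coeff (s + 1) + P.coeff (r + p) * R.coeff s := by
  induction R using Polynomial.induction_on' with
  | add R₁ R₂ h₁ h₂ =>
    rw [map_add, mul_add, Polynomial.coeff_add, h₁, h₂, Polynomial.coeff_add,
      Polynomial.coeff_add]
    ring
  | monomial j c =>
    rw [Polynomial.expand_monomial, mul_comm, ← Polynomial.C_mul_X_pow_eq_monomial, mul_assoc,
      Polynomial.coeff_C_mul, Polynomial.coeff_X_pow_mul', Polynomial.coeff_monomial,
      Polynomial.coeff_monomial]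
    rcases lt_trichotomy j s with h | rfl | h
    · obtain ⟨d, rfl⟩ : ∃ d, s = j + 1 + d := ⟨s - (j + 1), by omega⟩
      have h' : r + p * (j + 1 + d + 1) = r + 2 * p + p * d + j * p := by ring
      rw [if_neg (show ¬ j = j + 1 + d + 1 by omega), if_neg (show ¬ j = j + 1 + d by omega), h',
        if_pos (Nat.le_add_left _ _), Nat.add_sub_cancel, Polynomial.coeff_eq_zero_of_natDegree_lt]
      · ring
      · have := Nat.zero_le (p * d)
        omega
    · have h' : r + p * (j + 1) = r + p + j * p := by ring
      rw [if_neg (show ¬ j = j + 1 by omega), h', if_pos (Nat.le_add_left _ _),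
        Nat.add_sub_cancel, if_pos rfl]
      ring
    · rcases (show s + 1 ≤ j by omega).lt_or_eq with h' | rfl
      · rw [if_neg, if_neg (show ¬ j = s + 1 by omega), if_neg (show ¬ j = s by omega)]
        · ring
        · have : (s + 2) * p ≤ j * p := Nat.mul_le_mul_right p h'
          nlinarith
      · have h' : r + p * (s + 1) = r + (s + 1) * p := by ring
        rw [h', if_pos (Nat.le_add_left _ _), Nat.add_sub_cancel, if_pos rfl,
          if_neg (show ¬ s + 1 = s by omega)]
        ring

namespace TeichmullerLift

variable {p : ℕ} {F K : Type*} [Field F] [Fintype F] [Field K] [CharZero K]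
  (T : TeichmullerLift p F K)

theorem sum_pow_mul_one_sub_pow_congr (hp : p.Prime) (hp2 : p ≠ 2) (hcard : Fintype.card F = p)
    {A a b : ℕ} (hab : 2 * (a + 1 + b + 1) + 1 = p) (hA : A + (a + 1) + 1 = p) :
    CongrMod T.O ((p : K) ^ 2) (∑ t, T.τ t ^ A * T.τ (1 - t) ^ (a + 1 + b + 1))
      (-((-1) ^ (a + 1) * ((a + 1 + b + 1).choose (a + 1) : K) *
        (1 + p * (((a + 1 + b + 1 : ℕ) : K) * harmonicSum K (a + 1 + b + 1)
          - (b + 1 : ℕ) * harmonicSum K (b + 1) - (a + 1 : ℕ) * harmonicSum K (a + 1))))) := by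
  have hO := T.inv_natCast_mem
  have hpO := T.natCast_mem p
  set N := a + 1 + b with hN
  have h1 : ∀ t : F, CongrMod T.O ((p : K) ^ 2) (T.τ t ^ A * T.τ (1 - t) ^ (N + 1))
      (T.τ t ^ A * ((1 - Polynomial.X : Polynomial K) ^ (N + 1)).eval (T.τ t) -
        p * ((N + 1 : ℕ) *
          (T.τ t ^ A * ((1 - Polynomial.X) ^ N * truncatedLog K p).eval (T.τ t)))) := by
    intro t
    have hX := T.map_mem t
    have hL := eval_truncatedLog_mem hO hX
    have h2 := T.map_one_sub_pow_congr hp hp2 t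
    have hF : ∀ u : F, u ^ p = u := fun u => hcard ▸ FiniteField.pow_card u
    rw [← map_pow, ← map_pow, hF, hF] at h2
    have h3 := (h2.pow (T.map_mem _) (T.O.sub_mem (T.O.sub_mem T.O.one_mem hX)
      (T.O.mul_mem hpO hL)) (N + 1)).trans (sub_mul_pow_congr hpO
        (T.O.sub_mem T.O.one_mem hX) hL N)
    refine (h3.mul_left (T.O.pow_mem hX A)).trans (.of_eq ?_)
    simp only [Polynomial.eval_mul, Polynomial.eval_pow, Polynomial.eval_sub, Polynomial.eval_one,
      Polynomial.eval_X]
    ring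
  refine (CongrMod.sum fun t _ => h1 t).trans ?_
  have hd1 : ((1 - Polynomial.X : Polynomial K) ^ (N + 1)).natDegree < a + 1 + 2 * (p - 1) :=
    (natDegree_one_sub_X_pow_le _).trans_lt (by omega)
  have hd2 : ((1 - Polynomial.X : Polynomial K) ^ N * truncatedLog K p).natDegree
      < a + 1 + 2 * (p - 1) :=
    (Polynomial.natDegree_mul_le.trans (add_le_add (natDegree_one_sub_X_pow_le _)
      (natDegree_truncatedLog_le _))).trans_lt (by omega)
  rw [sum_sub_distrib, ← mul_sum, ← mul_sum,
    T.sum_pow_mul_eval (show p - 1 + 1 = Fintype.card F by omega) (by omega) (by omega) hd1,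
    T.sum_pow_mul_eval (show p - 1 + 1 = Fintype.card F by omega) (by omega) (by omega) hd2,
    show a + 1 + (p - 1) = a + p by omega,
    coeff_one_sub_X_pow_mul_truncatedLog (by omega) (by omega),
    Polynomial.coeff_one_sub_X_pow, Polynomial.coeff_one_sub_X_pow,
    Nat.choose_eq_zero_of_lt (show N + 1 < a + p by omega), show N - (a + 1) = b by omega]
  have hc := coeff_add_one_sub_X_pow_mul_truncatedLog (K := K) hO (show N < p by omega)
    (show a ≤ N by omega)
  have e1 : (N.choose (a + 1) : K) * (N + 1 : ℕ) = (N + 1).choose (a + 1) * (b + 1 : ℕ) := by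
    have := Nat.choose_mul_succ_eq N (a + 1)
    rw [show N + 1 - (a + 1) = b + 1 by omega] at this
    exact_mod_cast this
  have e2 : (N.choose a : K) * (N + 1 : ℕ) = (N + 1).choose (a + 1) * (a + 1 : ℕ) := by
    have := Nat.add_one_mul_choose_eq N a
    rw [mul_comm] at this
    exact_mod_cast this
  have hH1 : harmonicSum K a ∈ T.O := harmonicSum_mem hO (by omega)
  have hH2 : harmonicSum K b ∈ T.O := harmonicSum_mem hO (by omega)
  have hH3 : harmonicSum K N ∈ T.O := harmonicSum_mem hO (by omega)
  have i1 : ((a + 1 : ℕ) : K) * ((a : K) + 1)⁻¹ = 1 := by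
    push_cast
    exact mul_inv_cancel₀ (by exact_mod_cast a.succ_ne_zero)
  have i2 : ((b + 1 : ℕ) : K) * ((b : K) + 1)⁻¹ = 1 := by
    push_cast
    exact mul_inv_cancel₀ (by exact_mod_cast b.succ_ne_zero)
  have i3 : ((N + 1 : ℕ) : K) * ((N : K) + 1)⁻¹ = 1 := by
    push_cast
    exact mul_inv_cancel₀ (by exact_mod_cast N.succ_ne_zero)
  have i4 : ((N + 1 : ℕ) : K) = (a + 1 : ℕ) + (b + 1 : ℕ) := by
    rw [hN]
    push_cast
    ring
  have hp1 : ((p - 1 : ℕ) : K) = p - 1 := by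
    rw [Nat.cast_sub hp.one_le, Nat.cast_one]
  obtain ⟨w, hw, hc⟩ := hc
  rw [harmonicSum_succ, harmonicSum_succ, harmonicSum_succ, hp1]
  have hs : (-1 : K) ^ (a + 1) ∈ T.O := T.O.pow_mem (T.O.neg_mem T.O.one_mem) _
  have hCO := T.natCast_mem ((N + 1).choose (a + 1))
  have hNO := T.natCast_mem (N + 1)
  have haO := T.natCast_mem (a + 1)
  have hbO := T.natCast_mem (b + 1)
  generalize (-1 : K) ^ (a + 1) = s at *
  generalize (((N + 1).choose (a + 1) : ℕ) : K) = C at *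
  generalize ((N.choose (a + 1) : ℕ) : K) = C₁ at *
  generalize ((N.choose a : ℕ) : K) = C₂ at *
  generalize ((N + 1 : ℕ) : K) = nK at *
  generalize ((a + 1 : ℕ) : K) = aK at *
  generalize ((b + 1 : ℕ) : K) = bK at *
  generalize ((N : K) + 1)⁻¹ = iN at *
  generalize ((a : K) + 1)⁻¹ = ia at *
  generalize ((b : K) + 1)⁻¹ = ib at *
  refine ⟨-(nK * (p - 1) * w) - s * C * (bK * harmonicSum K b + aK * harmonicSum K a
    - nK * harmonicSum K N), T.O.sub_mem (T.O.neg_mem (T.O.mul_mem (T.O.mul_mem hNO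
      (T.O.sub_mem hpO T.O.one_mem)) hw)) (T.O.mul_mem (T.O.mul_mem hs hCO)
      (T.O.sub_mem (T.O.add_mem (T.O.mul_mem hbO hH2) (T.O.mul_mem haO hH1))
        (T.O.mul_mem hNO hH3))), ?_⟩
  push_cast
  linear_combination (-p * nK * (p - 1)) * hc
    - p * (p - 1) * s * (harmonicSum K b - harmonicSum K N) * e1
    - p * (p - 1) * s * (harmonicSum K a - harmonicSum K N) * e2
    + p * s * C * (i3 - i1 - i2)
    - p * (p - 1) * s * C * harmonicSum K N * i4

end TeichmullerLift

namespace TeichmullerLift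

variable {p : ℕ} {F K : Type*} [Field F] [Fintype F] [Field K]
  (T : TeichmullerLift p F K)

theorem sum_pow_mul_eval_mul_expand {A r s c : ℕ} (hc : 2 * c < p)
    (hcard : Fintype.card F = p ^ 2) (hA : A + (r + 1 + p * (s + 1)) + 1 = p ^ 2) (hA0 : 0 < A)
    (hr : r + 1 < p) {P R : Polynomial K} (hP : P.natDegree ≤ c + (p - 1))
    (hR : R.natDegree ≤ c + (p - 1)) :
    ∑ t, T.τ t ^ A * (P * Polynomial.expand K p R).eval (T.τ t)
      = ((p : K) ^ 2 - 1) * (P.coeff (r + 1) * R.coeff (s + 1) + P.coeff (r + 1 + p) * R.coeff s +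
        (P.coeff r * R.coeff (s + 1 + p) + P.coeff (r + p) * R.coeff (s + p))) := by
  have hp1 : 1 ≤ p ^ 2 := by omega
  have hd : (P * Polynomial.expand K p R).natDegree < r + 1 + p * (s + 1) + 2 * (p ^ 2 - 1) := by
    refine (Polynomial.natDegree_mul_le.trans (add_le_add hP (Polynomial.natDegree_expand p R ▸
      Nat.mul_le_mul_right p hR))).trans_lt ?_
    obtain ⟨d, rfl⟩ : ∃ d, p = 2 * c + 1 + d := ⟨p - (2 * c + 1), by omega⟩
    have : (2 * c + 1 + d) ^ 2 - 1 = (2 * c + d) * (2 * c + 2 + d) := by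
      rw [Nat.sub_eq_iff_eq_add hp1]
      ring
    rw [this, show 2 * c + 1 + d - 1 = 2 * c + d by omega]
    nlinarith
  rw [T.sum_pow_mul_eval (show p ^ 2 - 1 + 1 = Fintype.card F by omega) (by omega) hA0 hd,
    Polynomial.coeff_mul_expand (by omega) hr,
    show r + 1 + p * (s + 1) + (p ^ 2 - 1) = r + p * (s + p + 1) by
      zify [hp1]
      ring,
    Polynomial.coeff_mul_expand (by omega) (by omega), Nat.cast_sub hp1,
    show s + p + 1 = s + 1 + p by omega]
  push_cast
  ring

variable [CharZero K]

theorem sq_sum_pow_mul_one_sub_pow_congr (hp : p.Prime) (hp2 : p ≠ 2)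
    (hcard : Fintype.card F = p) {A m n : ℕ} (hm : 0 < m) (hpm : 8 * m + 1 = p)
    (hn : n = 4 * m) (hA : A = 7 * m) :
    CongrMod T.O ((p : K) ^ 2) ((∑ t, T.τ t ^ A * T.τ (1 - t) ^ n) ^ 2)
      ((n.choose m : K) ^ 2 * (1 + p * (-harmonicSum K n +
        (3 / 4 * harmonicSum K (3 * m) + 1 / 4 * harmonicSum K m)))) := by
  obtain ⟨a, rfl⟩ : ∃ a, m = a + 1 := ⟨m - 1, by omega⟩
  have hO := T.inv_natCast_mem
  have h := T.sum_pow_mul_one_sub_pow_congr hp hp2 hcard (A := A) (a := a) (b := 3 * a + 2)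
    (by omega) (by omega)
  rw [show a + 1 + (3 * a + 2) + 1 = n by omega,
    show 3 * a + 2 + 1 = 3 * (a + 1) by omega] at h
  have hH1 : harmonicSum K (a + 1) ∈ T.O := harmonicSum_mem hO (by omega)
  have hH2 : harmonicSum K (3 * (a + 1)) ∈ T.O := harmonicSum_mem hO (by omega)
  have hH3 : harmonicSum K n ∈ T.O := harmonicSum_mem hO (by omega)
  have hM := T.O.sub_mem (T.O.sub_mem (T.O.mul_mem (T.natCast_mem n) hH3)
    (T.O.mul_mem (T.natCast_mem (3 * (a + 1))) hH2)) (T.O.mul_mem (T.natCast_mem (a + 1)) hH1)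
  have hC := T.natCast_mem (n.choose (a + 1))
  have hy := T.O.neg_mem (T.O.mul_mem (T.O.mul_mem (T.O.pow_mem (T.O.neg_mem T.O.one_mem) (a + 1))
    hC) (one_add_mul_mem (T.natCast_mem p) hM))
  have hx := h.mem (T.O.pow_mem (T.natCast_mem p) 2) hy
  refine (h.pow hx hy 2).trans ?_
  have hs : ((-1 : K) ^ (a + 1)) ^ 2 = 1 := by rw [← pow_mul, mul_comm, pow_mul]; simp
  have h4 : (4 : K)⁻¹ ∈ T.O := by
    have h8 := T.O.mul_mem (T.natCast_mem 2) (inv_eight_mem hp hp2 hO)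
    rwa [show ((2 : ℕ) : K) * 8⁻¹ = 4⁻¹ by norm_num] at h8
  have hpK : (p : K) = 8 * (a + 1 : ℕ) + 1 := by
    rw [← hpm]
    push_cast
    ring
  have hnK : (n : K) = 4 * (a + 1 : ℕ) := by
    rw [hn]
    push_cast
    ring
  have hbK : ((3 * (a + 1) : ℕ) : K) = 3 * (a + 1 : ℕ) := by push_cast; ring
  have h3 := T.natCast_mem 3
  refine ⟨(n.choose (a + 1) : K) ^ 2 * ((n * harmonicSum K n - (3 * (a + 1) : ℕ) *
    harmonicSum K (3 * (a + 1)) - (a + 1 : ℕ) * harmonicSum K (a + 1)) ^ 2 + (harmonicSum K n -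
      (((3 : ℕ) : K) * 4⁻¹ * harmonicSum K (3 * (a + 1)) + 4⁻¹ * harmonicSum K (a + 1)))),
    T.O.mul_mem (T.O.pow_mem hC 2) (T.O.add_mem (T.O.pow_mem hM 2) (T.O.sub_mem hH3
      (T.O.add_mem (T.O.mul_mem (T.O.mul_mem h3 h4) hH2) (T.O.mul_mem h4 hH1)))), ?_⟩
  rw [hbK, hnK]
  have hmK : ((a + 1 : ℕ) : K) = (p - 1) / 8 := by
    rw [hpK]
    ring
  rw [hmK]
  generalize (-1 : K) ^ (a + 1) = s at *
  generalize ((n.choose (a + 1) : ℕ) : K) = C at *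
  generalize harmonicSum K (a + 1) = H₁
  generalize harmonicSum K (3 * (a + 1)) = H₂
  generalize harmonicSum K n = H₃
  push_cast
  linear_combination C ^ 2 * (1 + p * (4 * ((p - 1) / 8) * H₃ - 3 * ((p - 1) / 8) * H₂
    - (p - 1) / 8 * H₁)) ^ 2 * hs

theorem sum_pow_mul_one_sub_pow_congr_of_card_eq_sq [CharP F p] (hp : p.Prime) (hp2 : p ≠ 2)
    (hcard : Fintype.card F = p ^ 2) {A a b : ℕ} (hab : 2 * (a + 1 + b + 1) + 1 = p)
    (hodd : Odd (a + 1 + b + 1)) (hA : A + (b + 1 + p * (a + 1)) + 1 = p ^ 2) (hA0 : 0 < A) :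
    CongrMod T.O ((p : K) ^ 2) (∑ t, T.τ t ^ A * T.τ (1 - t) ^ ((p + 1) * (a + 1 + b + 1)))
      (((a + 1 + b + 1).choose (a + 1) : K) ^ 2 *
        (1 + p * (2 * (((a + 1 + b + 1 : ℕ) : K) * harmonicSum K (a + 1 + b + 1)
          - (a + 1 : ℕ) * harmonicSum K (b + 1) - (b + 1 : ℕ) * harmonicSum K (a + 1))))) := by
  have hO := T.inv_natCast_mem
  have hpO := T.natCast_mem p
  have : Fact p.Prime := ⟨hp⟩
  set N := a + 1 + b with hN
  set L := truncatedLog K p with hL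
  set P : ℕ → Polynomial K := fun k => (1 - Polynomial.X) ^ k with hP
  have hPd : ∀ k ≤ N + 1, (P k).natDegree ≤ N + 1 + (p - 1) := fun k hk =>
    (natDegree_one_sub_X_pow_le k).trans (by omega)
  have hPLd : (P (N + 1) * L).natDegree ≤ N + 1 + (p - 1) :=
    Polynomial.natDegree_mul_le.trans (add_le_add (natDegree_one_sub_X_pow_le _)
      (natDegree_truncatedLog_le _))
  have h1 : ∀ t : F, CongrMod T.O ((p : K) ^ 2)
      (T.τ t ^ A * T.τ (1 - t) ^ ((p + 1) * (N + 1)))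
      (T.τ t ^ A * (P (N + 1) * Polynomial.expand K p (P (N + 1))).eval (T.τ t) -
        p * ((N + 1 : ℕ) *
          (T.τ t ^ A * (P N * Polynomial.expand K p (P (N + 1) * L)).eval (T.τ t) +
            T.τ t ^ A * (P (N + 1) * L * Polynomial.expand K p (P N)).eval (T.τ t)))) := by
    intro t
    have hX := T.map_mem t
    have hY := T.O.pow_mem hX p
    have hLX := eval_truncatedLog_mem hO hX
    have hLY := eval_truncatedLog_mem hO hY
    have hX1 := T.O.sub_mem T.O.one_mem hX
    have hY1 := T.O.sub_mem T.O.one_mem hY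
    have h2 := T.map_one_sub_pow_congr hp hp2 t
    have h3 := T.map_one_sub_pow_congr hp hp2 (t ^ p)
    have hF : ∀ u : F, (u ^ p) ^ p = u := fun u => by
      rw [← pow_mul, ← sq, ← hcard, FiniteField.pow_card]
    have hF' : 1 - t ^ p = (1 - t) ^ p := by rw [sub_pow_char, one_pow]
    rw [hF', ← map_pow, ← map_pow, hF, hF, map_pow] at h3
    have h4 := (h3.pow (T.map_mem _) (T.O.sub_mem hX1 (T.O.mul_mem hpO hLY)) (N + 1)).trans
      (sub_mul_pow_congr hpO hX1 hLY N)
    have h5 := (h2.pow (T.O.pow_mem (T.map_mem _) p) (T.O.sub_mem hY1 (T.O.mul_mem hpO hLX))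
      (N + 1)).trans (sub_mul_pow_congr hpO hY1 hLX N)
    have hNO := T.natCast_mem (N + 1)
    have h6 := (h4.mul h5 (T.O.pow_mem (T.O.pow_mem (T.map_mem _) p) _) (T.O.sub_mem
      (T.O.pow_mem hX1 _) (T.O.mul_mem hpO (T.O.mul_mem hNO
        (T.O.mul_mem (T.O.pow_mem hX1 _) hLY))))).mul_left (T.O.pow_mem hX A)
    refine (CongrMod.of_eq ?_).trans (h6.trans ⟨T.τ t ^ A * (N + 1 : ℕ) ^ 2 * ((1 - T.τ t) ^ N *
      L.eval (T.τ t ^ p)) * ((1 - T.τ t ^ p) ^ N * L.eval (T.τ t)),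
      T.O.mul_mem (T.O.mul_mem (T.O.mul_mem (T.O.pow_mem hX A) (T.O.pow_mem hNO 2))
        (T.O.mul_mem (T.O.pow_mem hX1 _) hLY)) (T.O.mul_mem (T.O.pow_mem hY1 _) hLX), ?_⟩)
    · ring
    · simp only [hP, Polynomial.eval_mul, Polynomial.eval_pow, Polynomial.eval_sub,
        Polynomial.eval_one, Polynomial.eval_X, Polynomial.expand_eval]
      ring
  refine (CongrMod.sum fun t _ => h1 t).trans ?_
  rw [sum_sub_distrib, ← mul_sum, ← mul_sum, sum_add_distrib,
    T.sum_pow_mul_eval_mul_expand (by omega) hcard hA hA0 (by omega) (hPd _ le_rfl)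
      (hPd _ le_rfl),
    T.sum_pow_mul_eval_mul_expand (by omega) hcard hA hA0 (by omega) (hPd N (by omega)) hPLd,
    T.sum_pow_mul_eval_mul_expand (by omega) hcard hA hA0 (by omega) hPLd (hPd N (by omega))]
  simp only [hP, Polynomial.coeff_one_sub_X_pow]
  rw [Nat.choose_eq_zero_of_lt (show N + 1 < b + 1 + p by omega),
    Nat.choose_eq_zero_of_lt (show N + 1 < b + p by omega),
    Nat.choose_eq_zero_of_lt (show N + 1 < a + 1 + p by omega),
    Nat.choose_eq_zero_of_lt (show N < b + 1 + p by omega),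
    Nat.choose_eq_zero_of_lt (show N < b + p by omega),
    Nat.choose_eq_zero_of_lt (show N < a + 1 + p by omega),
    Nat.choose_eq_zero_of_lt (show N < a + p by omega),
    coeff_one_sub_X_pow_mul_truncatedLog (b := a + 1) (by omega) (by omega),
    coeff_one_sub_X_pow_mul_truncatedLog (b := b + 1) (by omega) (by omega),
    show N + 1 - (a + 1) = b + 1 by omega, show N + 1 - (b + 1) = a + 1 by omega]
  have hc₁ := coeff_add_one_sub_X_pow_mul_truncatedLog (K := K) hO (show N + 1 < p by omega)
    (show a + 1 ≤ N + 1 by omega)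
  have hc₂ := coeff_add_one_sub_X_pow_mul_truncatedLog (K := K) hO (show N + 1 < p by omega)
    (show b + 1 ≤ N + 1 by omega)
  have hsym : (N + 1).choose (b + 1) = (N + 1).choose (a + 1) := by
    rw [← Nat.choose_symm (show a + 1 ≤ N + 1 by omega), show N + 1 - (a + 1) = b + 1 by omega]
  have e1 : (N.choose (a + 1) : K) * (N + 1 : ℕ) = (N + 1).choose (a + 1) * (b + 1 : ℕ) := by
    have := Nat.choose_mul_succ_eq N (a + 1)
    rw [show N + 1 - (a + 1) = b + 1 by omega] at this
    exact_mod_cast this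
  have e2 : (N.choose a : K) * (N + 1 : ℕ) = (N + 1).choose (a + 1) * (a + 1 : ℕ) := by
    have := Nat.add_one_mul_choose_eq N a
    rw [mul_comm] at this
    exact_mod_cast this
  have hN1 : N.choose (b + 1) = N.choose a := by
    rw [← Nat.choose_symm (show a ≤ N by omega), show N - a = b + 1 by omega]
  have hN2 : N.choose b = N.choose (a + 1) := by
    rw [← Nat.choose_symm (show a + 1 ≤ N by omega), show N - (a + 1) = b by omega]
  rw [hsym] at hc₂ ⊢
  rw [hN1, hN2]
  have hH1 : harmonicSum K (a + 1) ∈ T.O := harmonicSum_mem hO (by omega)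
  have hH2 : harmonicSum K (b + 1) ∈ T.O := harmonicSum_mem hO (by omega)
  have hH3 : harmonicSum K (N + 1) ∈ T.O := harmonicSum_mem hO (by omega)
  have hs : (-1 : K) ^ a * (-1) ^ b = -1 := by
    have := hodd.neg_one_pow (α := K)
    rw [hN, show a + 1 + b + 1 = a + b + 2 by omega, pow_add, pow_add] at this
    linear_combination this
  have i4 : ((N + 1 : ℕ) : K) = (a + 1 : ℕ) + (b + 1 : ℕ) := by
    rw [hN]
    push_cast
    ring
  have hCO := T.natCast_mem ((N + 1).choose (a + 1))
  have hC₁O := T.natCast_mem (N.choose (a + 1))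
  have hC₂O := T.natCast_mem (N.choose a)
  have hsa : (-1 : K) ^ a ∈ T.O := T.O.pow_mem (T.O.neg_mem T.O.one_mem) _
  have hsb : (-1 : K) ^ b ∈ T.O := T.O.pow_mem (T.O.neg_mem T.O.one_mem) _
  have hNO := T.natCast_mem (N + 1)
  have haO := T.natCast_mem (a + 1)
  have hbO := T.natCast_mem (b + 1)
  obtain ⟨w₁, hw₁, hc₁⟩ := hc₁
  obtain ⟨w₂, hw₂, hc₂⟩ := hc₂
  simp only [pow_succ, Nat.cast_zero, mul_zero, zero_mul, add_zero, mul_neg, mul_one] at hc₁ hc₂ ⊢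
  generalize ((1 - Polynomial.X) ^ (N + 1) * L).coeff (a + 1 + p) = U₁ at *
  generalize ((1 - Polynomial.X) ^ (N + 1) * L).coeff (b + 1 + p) = U₂ at *
  generalize (-1 : K) ^ a = sa at *
  generalize (-1 : K) ^ b = sb at *
  generalize (((N + 1).choose (a + 1) : ℕ) : K) = C at *
  generalize ((N.choose (a + 1) : ℕ) : K) = C₁ at *
  generalize ((N.choose a : ℕ) : K) = C₂ at *
  generalize ((N + 1 : ℕ) : K) = nK at *
  generalize ((a + 1 : ℕ) : K) = aK at *
  generalize ((b + 1 : ℕ) : K) = bK at *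
  generalize harmonicSum K (a + 1) = Ha at *
  generalize harmonicSum K (b + 1) = Hb at *
  generalize harmonicSum K (N + 1) = Hn at *
  have hM := T.O.sub_mem (T.O.add_mem (T.O.mul_mem haO hH2) (T.O.mul_mem hbO hH1))
    (T.O.mul_mem hNO hH3)
  refine ⟨((2 : ℕ) * p * (aK * Hb + bK * Ha - nK * Hn) - 1) * C ^ 2
    - nK * (p ^ 2 - 1) * (sb * C₁ * w₁ + sa * C₂ * w₂), T.O.sub_mem (T.O.mul_mem (T.O.sub_mem
      (T.O.mul_mem (T.O.mul_mem (T.natCast_mem 2) hpO) hM) T.O.one_mem) (T.O.pow_mem hCO 2))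
      (T.O.mul_mem (T.O.mul_mem hNO (T.O.sub_mem (T.O.pow_mem hpO 2) T.O.one_mem))
        (T.O.add_mem (T.O.mul_mem (T.O.mul_mem hsb hC₁O) hw₁)
          (T.O.mul_mem (T.O.mul_mem hsa hC₂O) hw₂))), ?_⟩
  push_cast
  linear_combination (-p * nK * (p ^ 2 - 1) * sb * C₁) * hc₁
    - p * nK * (p ^ 2 - 1) * sa * C₂ * hc₂
    + ((p ^ 2 - 1) * C ^ 2 - 2 * p * nK * (p ^ 2 - 1) * C * (C₂ * (Hb - Hn) + C₁ * (Ha - Hn))) * hs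
    + 2 * p * (p ^ 2 - 1) * C * ((Hb - Hn) * e2 + (Ha - Hn) * e1)
    + 2 * p * (p ^ 2 - 1) * C ^ 2 * Hn * i4

end TeichmullerLift

namespace TeichmullerLift

variable {p : ℕ} {F K : Type*} [Field F] [Fintype F] [Field K]
  (T : TeichmullerLift p F K)
variable [CharZero K]

theorem sum_pow_mul_one_sub_pow_congr_of_mod_eight [CharP F p] (hp : p.Prime)
    (hcard : Fintype.card F = p ^ 2) {A m n : ℕ} (hm : 0 < m) (hpm : 8 * m + 3 = p)
    (hn : n = 4 * m + 1) (hA : 8 * A = 7 * (p ^ 2 - 1)) :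
    CongrMod T.O ((p : K) ^ 2) (∑ t, T.τ t ^ A * T.τ (1 - t) ^ ((p + 1) * n))
      ((n.choose m : K) ^ 2 * (1 + p * (-harmonicSum K n +
        (3 / 4 * harmonicSum K (3 * m + 1) + 1 / 4 * harmonicSum K m)))) := by
  obtain ⟨a, rfl⟩ : ∃ a, m = a + 1 := ⟨m - 1, by omega⟩
  have hO := T.inv_natCast_mem
  have hp2 : p ≠ 2 := by omega
  have hA' : A + (3 * a + 3 + 1 + p * (a + 1)) + 1 = p ^ 2 := by
    have h1 : 1 ≤ p ^ 2 := Nat.one_le_pow _ _ hp.pos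
    have h8 : 8 * (p * (a + 1)) + 3 * p = p ^ 2 := by
      rw [← hpm]
      ring
    omega
  have hA0 : 0 < A := by
    have : 1 < p ^ 2 := Nat.one_lt_pow two_ne_zero hp.one_lt
    omega
  have hodd : Odd (a + 1 + (3 * a + 3) + 1) := ⟨2 * a + 2, by ring⟩
  have h := T.sum_pow_mul_one_sub_pow_congr_of_card_eq_sq hp hp2 hcard (A := A) (a := a)
    (b := 3 * a + 3) (by omega) hodd hA' hA0
  rw [show a + 1 + (3 * a + 3) + 1 = n by omega,
    show 3 * a + 3 + 1 = 3 * (a + 1) + 1 by omega] at h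
  refine h.trans ?_
  have hH1 : harmonicSum K (a + 1) ∈ T.O := harmonicSum_mem hO (by omega)
  have hH2 : harmonicSum K (3 * (a + 1) + 1) ∈ T.O := harmonicSum_mem hO (by omega)
  have hH3 : harmonicSum K n ∈ T.O := harmonicSum_mem hO (by omega)
  have h4 : (4 : K)⁻¹ ∈ T.O := by
    have h8 := T.O.mul_mem (T.natCast_mem 2) (inv_eight_mem hp hp2 hO)
    rwa [show ((2 : ℕ) : K) * 8⁻¹ = 4⁻¹ by norm_num] at h8
  have hmK : ((a + 1 : ℕ) : K) = (p - 3) / 8 := by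
    rw [← hpm]
    push_cast
    ring
  have hnK : (n : K) = (p - 1) / 2 := by
    rw [← hpm, hn]
    push_cast
    ring
  have hbK : ((3 * (a + 1) + 1 : ℕ) : K) = (3 * p - 1) / 8 := by
    rw [← hpm]
    push_cast
    ring
  refine ⟨(n.choose (a + 1) : K) ^ 2 * (harmonicSum K n -
      (4⁻¹ * harmonicSum K (3 * (a + 1) + 1) + ((3 : ℕ) : K) * 4⁻¹ * harmonicSum K (a + 1))),
    T.O.mul_mem (T.O.pow_mem (T.natCast_mem _) 2) (T.O.sub_mem hH3
      (T.O.add_mem (T.O.mul_mem h4 hH2) (T.O.mul_mem (T.O.mul_mem (T.natCast_mem 3) h4) hH1))), ?_⟩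
  rw [hmK, hnK, hbK]
  push_cast
  ring

end TeichmullerLift

namespace WittVector

variable (p : ℕ) [Fact p.Prime] (F : Type*) [Field F] [CharP F p]

theorem isUnit_natCast {k : ℕ} (hk : ¬ p ∣ k) : IsUnit (k : WittVector p F) := by
  refine isUnit_of_coeff_zero_ne_zero _ ?_
  rw [← constantCoeff_apply, map_natCast]
  exact fun h => hk ((CharP.cast_eq_zero_iff F p k).1 h)

instance charZero_fractionRing : CharZero (FractionRing (WittVector p F)) := by
  refine charZero_of_inj_zero fun n hn => ?_
  by_contra hn0
  obtain ⟨e, m, hm, rfl⟩ := Nat.exists_eq_pow_mul_and_not_dvd hn0 p (Fact.out : p.Prime).ne_one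
  have hm' := (isUnit_natCast p F hm).map
    (algebraMap (WittVector p F) (FractionRing (WittVector p F)))
  rw [map_natCast] at hm'
  rw [Nat.cast_mul, Nat.cast_pow] at hn
  exact mul_ne_zero (pow_ne_zero _ (FractionRing.p_nonzero p F)) hm'.ne_zero hn

theorem dvd_iff_coeff_zero [PerfectRing F p] {x : WittVector p F} :
    (p : WittVector p F) ∣ x ↔ x.coeff 0 = 0 := by
  constructor
  · rintro ⟨y, rfl⟩
    rw [mul_coeff_zero, coeff_p_zero, zero_mul]
  · intro hx
    rcases eq_or_ne x 0 with rfl | hx0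
    · exact dvd_zero _
    obtain ⟨m, b, hb, rfl⟩ := exists_eq_pow_p_mul x hx0
    rcases m with - | m
    · rw [pow_zero, one_mul] at hx
      exact absurd hx hb
    · exact ⟨(p : WittVector p F) ^ m * b, by rw [pow_succ']; ring⟩

theorem congrMod_range_iff {x y : WittVector p F} :
    CongrMod (algebraMap (WittVector p F) (FractionRing (WittVector p F))).range
      (p : FractionRing (WittVector p F)) (algebraMap _ _ x) (algebraMap _ _ y) ↔
      (p : WittVector p F) ∣ x - y := by
  constructor
  · rintro ⟨_, ⟨w, rfl⟩, h⟩
    refine ⟨w, IsFractionRing.injective (WittVector p F) (FractionRing (WittVector p F)) ?_⟩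
    rw [map_sub, map_mul, map_natCast, h]
  · rintro ⟨w, h⟩
    exact ⟨_, ⟨w, rfl⟩, by rw [← map_sub, h, map_mul, map_natCast]⟩

variable [PerfectRing F p]

/-- The Teichmüller section with values in the fraction field of the Witt vectors. -/
noncomputable def teichmullerLift : TeichmullerLift p F (FractionRing (WittVector p F)) where
  O := (algebraMap (WittVector p F) (FractionRing (WittVector p F))).range
  τ := (algebraMap (WittVector p F) (FractionRing (WittVector p F)) : _ →* _).comp (teichmuller p)
  map_mem t := ⟨_, rfl⟩
  map_zero := by simp
  injective a b h := by
    have h1 : teichmuller p a = teichmuller p b :=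
      IsFractionRing.injective (WittVector p F) (FractionRing (WittVector p F)) h
    rw [← teichmuller_coeff_zero p a, ← teichmuller_coeff_zero p b, h1]
  map_one_sub t := by
    have h : (p : WittVector p F) ∣ teichmuller p (1 - t) - (1 - teichmuller p t) := by
      rw [dvd_iff_coeff_zero, ← constantCoeff_apply, RingHom.map_sub, RingHom.map_sub, map_one,
        constantCoeff_apply, constantCoeff_apply, teichmuller_coeff_zero, teichmuller_coeff_zero,
        sub_self]
    simpa using (congrMod_range_iff p F).2 h
  inv_natCast_mem k hk := by
    obtain ⟨u, hu⟩ := isUnit_natCast p F hk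
    refine ⟨(↑u⁻¹ : WittVector p F), eq_inv_of_mul_eq_one_left ?_⟩
    rw [← map_natCast (algebraMap (WittVector p F) (FractionRing (WittVector p F))), ← map_mul,
      ← hu, u.inv_mul, map_one]
  inv_natCast_self_notMem := by
    rintro ⟨w, hw⟩
    have h : (algebraMap (WittVector p F) (FractionRing (WittVector p F))) (p * w)
        = algebraMap _ _ 1 := by
      rw [map_mul, map_natCast, hw, map_one, mul_inv_cancel₀ (FractionRing.p_nonzero p F)]
    have h1 := congrArg (fun x => coeff x 0) (IsFractionRing.injective _ _ h)
    simp [mul_coeff_zero, coeff_p_zero] at h1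
  prime := by
    rintro _ ⟨x, rfl⟩ _ ⟨y, rfl⟩ h
    rw [← map_mul, ← map_zero (algebraMap (WittVector p F) (FractionRing (WittVector p F))),
      congrMod_range_iff, sub_zero, dvd_iff_coeff_zero, mul_coeff_zero, mul_eq_zero] at h
    rw [← map_zero (algebraMap (WittVector p F) (FractionRing (WittVector p F))),
      congrMod_range_iff, congrMod_range_iff, sub_zero, sub_zero, dvd_iff_coeff_zero,
      dvd_iff_coeff_zero]
    exact h

end WittVector

section JacobiSum

variable {F K : Type*} [Field F] [Fintype F] [Field K]

theorem jacobiSum_eq_neg_one_mul (χ ψ : MulChar F K) :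
    jacobiSum χ ψ = χ (-1) * jacobiSum χ (χ * ψ)⁻¹ := by
  rw [jacobiSum_comm, jacobiSum, jacobiSum_comm, jacobiSum, mul_sum,
    ← inv_involutive.bijective.sum_comp]
  refine sum_congr rfl fun s _ => ?_
  rcases eq_or_ne s 0 with rfl | hs
  · simp [MulChar.map_zero]
  have h : (1 : F) - s⁻¹ = -1 * (1 - s) * s⁻¹ := by
    field_simp
    ring
  rw [h, MulChar.inv_apply', MulChar.mul_apply, map_mul, map_mul]
  ring

theorem exists_pow_eq_sum_of_pow_eight_eq_one {ζ v : K} (hζ : IsPrimitiveRoot ζ 8)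
    (hv : v = 0 ∨ v ^ 8 = 1) :
    ∃ d₀ d₁ d₂ d₃ : ℤ, ∀ j, Odd j →
      v ^ j = d₀ + d₁ * ζ ^ j + d₂ * ζ ^ (2 * j) + d₃ * ζ ^ (3 * j) := by
  have h4 : ∀ j, Odd j → ζ ^ (4 * j) = -1 := by
    intro j hj
    have h : ζ ^ 4 * ζ ^ 4 = 1 := by rw [← pow_add, hζ.pow_eq_one]
    rcases mul_self_eq_one_iff.1 h with h | h
    · exact absurd h (hζ.pow_ne_one_of_pos_of_lt (by norm_num) (by norm_num))
    · rw [pow_mul, h, hj.neg_one_pow]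
  rcases hv with rfl | hv
  · exact ⟨0, 0, 0, 0, fun j hj => by simp [hj.pos.ne']⟩
  obtain ⟨i, hi, rfl⟩ := hζ.eq_pow_of_pow_eq_one hv
  have h : ∀ i j, Odd j → (ζ ^ (4 + i)) ^ j = -(ζ ^ (i * j)) := fun i j hj => by
    rw [← pow_mul, add_mul, pow_add, h4 j hj, neg_one_mul]
  rcases lt_or_ge i 4 with hi4 | hi4
  · interval_cases i
    · exact ⟨1, 0, 0, 0, fun j _ => by simp⟩
    · exact ⟨0, 1, 0, 0, fun j _ => by simp⟩
    · exact ⟨0, 0, 1, 0, fun j _ => by simp [pow_mul]⟩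
    · exact ⟨0, 0, 0, 1, fun j _ => by simp [pow_mul]⟩
  · obtain ⟨i, rfl⟩ := Nat.exists_eq_add_of_le hi4
    have hi' : i < 4 := by omega
    interval_cases i
    · exact ⟨-1, 0, 0, 0, fun j hj => by rw [h _ j hj]; simp⟩
    · exact ⟨0, -1, 0, 0, fun j hj => by rw [h _ j hj]; simp⟩
    · exact ⟨0, 0, -1, 0, fun j hj => by rw [h _ j hj]; simp⟩
    · exact ⟨0, 0, 0, -1, fun j hj => by rw [h _ j hj]; simp⟩

theorem exists_jacobiSum_pow_eq {θ : MulChar F K} (hθ : θ ^ 8 = 1) {ζ : K}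
    (hζ : IsPrimitiveRoot ζ 8) :
    ∃ c₀ c₁ c₂ c₃ : ℤ, ∀ j, Odd j →
      jacobiSum (θ ^ j) (θ ^ 4) = c₀ + c₁ * ζ ^ j + c₂ * ζ ^ (2 * j) + c₃ * ζ ^ (3 * j) := by
  have hval : ∀ t, θ t = 0 ∨ θ t ^ 8 = 1 := fun t => by
    by_cases ht : IsUnit t
    · right
      rw [← MulChar.pow_apply' _ (by norm_num), hθ, MulChar.one_apply ht]
    · exact Or.inl (MulChar.map_nonunit θ ht)
  have hv : ∀ t, θ t * θ (1 - t) ^ 4 = 0 ∨ (θ t * θ (1 - t) ^ 4) ^ 8 = 1 := fun t => by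
    rcases hval t with h | h
    · exact Or.inl (by rw [h, zero_mul])
    rcases hval (1 - t) with h' | h'
    · exact Or.inl (by rw [h']; ring)
    · exact Or.inr (by rw [mul_pow, h, ← pow_mul, mul_comm 4 8, pow_mul, h', one_pow, one_mul])
  choose d₀ d₁ d₂ d₃ hd using fun t => exists_pow_eq_sum_of_pow_eight_eq_one hζ (hv t)
  refine ⟨∑ t, d₀ t, ∑ t, d₁ t, ∑ t, d₂ t, ∑ t, d₃ t, fun j hj => ?_⟩
  push_cast
  rw [sum_mul, sum_mul, sum_mul, ← sum_add_distrib, ← sum_add_distrib, ← sum_add_distrib, jacobiSum]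
  refine sum_congr rfl fun t _ => ?_
  rw [← hd t j hj, mul_pow, ← pow_mul, MulChar.pow_apply' _ hj.pos.ne',
    MulChar.pow_apply' _ (by norm_num)]
  obtain ⟨k, rfl⟩ := hj
  rcases hval (1 - t) with h | h
  · simp [h]
  · rw [show 4 * (2 * k + 1) = 8 * k + 4 by ring, pow_add (θ (1 - t)), pow_mul (θ (1 - t)), h,
      one_pow, one_mul]

theorem exists_sq_add_two_mul_sq_of_jacobiSum [CharZero K] {θ : MulChar F K} (hθ : θ ^ 8 = 1)
    (hθ4 : θ ^ 4 ≠ 1) {ζ : K} (hζ : IsPrimitiveRoot ζ 8) :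
    ∃ a b : ℤ, jacobiSum θ (θ ^ 4) + jacobiSum θ⁻¹ (θ ^ 4) = 2 * a ∧
      jacobiSum θ (θ ^ 4) * jacobiSum θ⁻¹ (θ ^ 4) = Fintype.card F ∧
      a ^ 2 + 2 * b ^ 2 = Fintype.card F := by
  have hinv : ∀ i j, i + j = 8 → (θ ^ i)⁻¹ = θ ^ j := fun i j h => by
    rw [inv_eq_iff_mul_eq_one, ← pow_add, h, hθ]
  have hmod : ∀ i, θ ^ (8 + i) = θ ^ i := fun i => by rw [pow_add, hθ, one_mul]
  have hneg : ∀ j, Odd j → (θ ^ j) (-1) = θ (-1) := fun j hj => by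
    rw [MulChar.pow_apply' _ hj.pos.ne', ← map_pow, hj.neg_one_pow]
  have h13 : jacobiSum (θ ^ 1) (θ ^ 4) = jacobiSum (θ ^ 3) (θ ^ 4) := by
    rw [jacobiSum_eq_neg_one_mul, jacobiSum_eq_neg_one_mul (θ ^ 3), ← pow_add, ← pow_add,
      hinv _ 3 rfl, hinv _ 1 rfl, jacobiSum_comm (θ ^ 3), hneg _ (by decide), hneg _ (by decide)]
  have h57 : jacobiSum (θ ^ 5) (θ ^ 4) = jacobiSum (θ ^ 7) (θ ^ 4) := by
    rw [jacobiSum_eq_neg_one_mul, jacobiSum_eq_neg_one_mul (θ ^ 7), ← pow_add, ← pow_add,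
      hmod 1, hmod 3, hinv _ 7 rfl, hinv _ 5 rfl, jacobiSum_comm (θ ^ 7), hneg _ (by decide),
      hneg _ (by decide)]
  have h17 : jacobiSum (θ ^ 1) (θ ^ 4) * jacobiSum (θ ^ 7) (θ ^ 4) = (Fintype.card F : K) := by
    rw [← hinv 1 7 rfl]
    nth_rewrite 2 [← hinv 4 4 rfl]
    refine jacobiSum_mul_jacobiSum_inv ?_ ?_ hθ4 ?_
    · rw [(CharP.ringChar_zero_iff_CharZero K).2 ‹_›]
      exact fun h => CharP.ringChar_ne_zero_of_finite F h.symm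
    · rw [pow_one]
      rintro rfl
      exact hθ4 (one_pow 4)
    · rw [← pow_add]
      intro h
      refine hθ4 ?_
      rw [← one_pow 4, ← h, ← pow_mul, hmod (8 + 4), hmod]
  have hinv7 : θ⁻¹ = θ ^ 7 := by rw [← hinv 1 7 rfl, pow_one]
  obtain ⟨c₀, c₁, c₂, c₃, hc⟩ := exists_jacobiSum_pow_eq hθ hζ
  have hζ4 : ζ ^ 4 = -1 := by
    have h : ζ ^ 4 * ζ ^ 4 = 1 := by rw [← pow_add, hζ.pow_eq_one]
    exact (mul_self_eq_one_iff.1 h).resolve_left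
      (hζ.pow_ne_one_of_pos_of_lt (by norm_num) (by norm_num))
  have h0 : ζ ≠ 0 := hζ.ne_zero (by norm_num)
  have h2 : ζ ^ 2 ≠ 1 := hζ.pow_ne_one_of_pos_of_lt (by norm_num) (by norm_num)
  rw [hc 1 (by decide), hc 3 (by decide)] at h13
  rw [hc 5 (by decide), hc 7 (by decide)] at h57
  have e7 : jacobiSum (θ ^ 7) (θ ^ 4) = c₀ - c₁ * ζ ^ 3 - c₂ * ζ ^ 2 - c₃ * ζ := by
    rw [hc 7 (by decide)]
    linear_combination (c₁ * ζ ^ 3 + c₂ * (ζ ^ 10 - ζ ^ 6 + ζ ^ 2) +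
      c₃ * (ζ ^ 17 - ζ ^ 13 + ζ ^ 9 - ζ ^ 5 + ζ)) * hζ4
  have e1 : jacobiSum (θ ^ 1) (θ ^ 4) = c₀ + c₁ * ζ + c₂ * ζ ^ 2 + c₃ * ζ ^ 3 := by
    rw [hc 1 (by decide)]
    ring
  have hc2 : (c₂ : K) = 0 := by
    have h : 4 * (c₂ * ζ ^ 2) = 0 := by
      linear_combination h13 + h57 + (
        c₁ * (ζ ^ 3 - ζ) + c₂ * (ζ ^ 10 - 2 * ζ ^ 6 + 3 * ζ ^ 2)
        + c₃ * (ζ ^ 9 - ζ ^ 3) * (1 - ζ ^ 4 + ζ ^ 8)) * hζ4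
    simpa [h0] using h
  have hc13 : (c₁ : K) = c₃ := by
    have h : (c₁ - c₃) * (ζ * (1 - ζ ^ 2)) = 0 := by
      rw [hc2] at h13
      linear_combination h13 + c₃ * (ζ ^ 5 - ζ) * hζ4
    rcases mul_eq_zero.1 h with h | h
    · exact sub_eq_zero.1 h
    · exact absurd h (mul_ne_zero h0 (sub_ne_zero.2 h2.symm))
  rw [pow_one] at h17 e1
  rw [hinv7]
  refine ⟨c₀, c₁, ?_, h17, ?_⟩
  · rw [e1, e7, hc2, hc13]
    ring
  · rw [e1, e7, hc2, hc13] at h17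
    have h : ((c₀ ^ 2 + 2 * c₁ ^ 2 : ℤ) : K) = ((Fintype.card F : ℤ) : K) := by
      push_cast
      rw [hc13]
      linear_combination h17 + c₃ ^ 2 * (2 + ζ ^ 2) * hζ4
    exact_mod_cast h

end JacobiSum

section QuadraticForm

theorem sq_eq_sq_of_dvd_sub {q a b X Y : ℤ} (hq : 0 < q) (hab : a ^ 2 + 2 * b ^ 2 = q)
    (hXY : X ^ 2 + 2 * Y ^ 2 = q) (h : q ∣ a * Y - b * X) : a ^ 2 = X ^ 2 := by
  obtain ⟨k, hk⟩ := h
  have hid : (a * X + 2 * b * Y) ^ 2 + 2 * (a * Y - b * X) ^ 2 = q ^ 2 := by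
    rw [sq q]
    nth_rewrite 1 [← hab]
    rw [← hXY]
    ring
  have hk0 : k = 0 := by
    by_contra hk0
    have hk1 : 0 < k ^ 2 := by positivity
    replace hk1 : 1 ≤ k ^ 2 := hk1
    rw [hk] at hid
    nlinarith [sq_nonneg (a * X + 2 * b * Y), mul_pos hq hq,
      mul_le_mul_of_nonneg_left hk1 (mul_pos hq hq).le]
  rw [hk0, mul_zero, sub_eq_zero] at hk
  have : q * a ^ 2 = q * X ^ 2 := by
    nth_rewrite 1 [← hXY]
    rw [← hab]
    linear_combination 2 * (a * Y + b * X) * hk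
  exact mul_left_cancel₀ hq.ne' this

theorem sq_eq_sq_of_add_two_mul_sq_eq_prime {p : ℕ} (hp : p.Prime) {a b x y : ℤ}
    (hab : a ^ 2 + 2 * b ^ 2 = p) (hxy : x ^ 2 + 2 * y ^ 2 = p) : a ^ 2 = x ^ 2 := by
  have hp0 : (0 : ℤ) < p := by exact_mod_cast hp.pos
  have h : (p : ℤ) ∣ (a * y - b * x) * (a * y + b * x) :=
    ⟨y ^ 2 - b ^ 2, by linear_combination y ^ 2 * hab - b ^ 2 * hxy⟩
  rcases (Nat.prime_iff_prime_int.1 hp).dvd_or_dvd h with h | h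
  · exact sq_eq_sq_of_dvd_sub hp0 hab hxy h
  · exact sq_eq_sq_of_dvd_sub (b := -b) hp0 (by rwa [neg_sq]) hxy
      (by rwa [neg_mul, sub_neg_eq_add])

theorem eq_or_eq_neg_of_add_two_mul_sq_eq_prime_sq {p : ℕ} (hp : p.Prime) (hp2 : p ≠ 2)
    {a b x y : ℤ} (hab : a ^ 2 + 2 * b ^ 2 = p ^ 2) (ha : ¬ (p : ℤ) ∣ a)
    (hxy : x ^ 2 + 2 * y ^ 2 = p) : a = 2 * x ^ 2 - p ∨ a = -(2 * x ^ 2 - p) := by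
  have hpZ := Nat.prime_iff_prime_int.1 hp
  have hp0 : (0 : ℤ) < p := by exact_mod_cast hp.pos
  have h2 : ¬ (p : ℤ) ∣ 2 := fun h => hp2 ((Nat.prime_dvd_prime_iff_eq hp Nat.prime_two).1
    (by exact_mod_cast h))
  have hXY : (2 * x ^ 2 - p) ^ 2 + 2 * (2 * x * y) ^ 2 = (p : ℤ) ^ 2 := by
    rw [← hxy]
    ring
  have hY : ¬ (p : ℤ) ∣ 2 * x * y := by
    intro h
    have hx : ¬ (p : ℤ) ∣ x := fun hx => by
      obtain ⟨k, rfl⟩ := hx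
      have hy : (p : ℤ) ∣ y := by
        have : (p : ℤ) ∣ 2 * y ^ 2 := ⟨1 - p * k ^ 2, by linear_combination hxy⟩
        exact hpZ.dvd_of_dvd_pow ((hpZ.dvd_or_dvd this).resolve_left h2)
      obtain ⟨l, rfl⟩ := hy
      have : (p : ℤ) * (p * (k ^ 2 + 2 * l ^ 2)) = p * 1 := by linear_combination hxy
      have := mul_left_cancel₀ hp0.ne' this
      exact hpZ.not_dvd_one ⟨_, this.symm⟩
    have hy : (p : ℤ) ∣ y := (hpZ.dvd_or_dvd h).resolve_left
      fun h => (hpZ.dvd_or_dvd h).elim h2 hx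
    obtain ⟨l, rfl⟩ := hy
    exact hx (hpZ.dvd_of_dvd_pow (n := 2) ⟨1 - 2 * p * l ^ 2, by linear_combination hxy⟩)
  have h : (p : ℤ) ^ 2 ∣ (a * (2 * x * y) - b * (2 * x ^ 2 - p)) *
      (a * (2 * x * y) + b * (2 * x ^ 2 - p)) :=
    ⟨(2 * x * y) ^ 2 - b ^ 2, by linear_combination (2 * x * y) ^ 2 * hab - b ^ 2 * hXY⟩
  have hsum : ¬ ((p : ℤ) ∣ (a * (2 * x * y) - b * (2 * x ^ 2 - p)) ∧
      (p : ℤ) ∣ (a * (2 * x * y) + b * (2 * x ^ 2 - p))) := by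
    rintro ⟨h, h'⟩
    have h3 := dvd_add h h'
    rw [show a * (2 * x * y) - b * (2 * x ^ 2 - p) + (a * (2 * x * y) + b * (2 * x ^ 2 - p))
      = 2 * (a * (2 * x * y)) by ring] at h3
    exact (hpZ.dvd_or_dvd h3).elim h2 fun h4 => (hpZ.dvd_or_dvd h4).elim ha hY
  rw [← sq_eq_sq_iff_eq_or_eq_neg]
  by_cases h1 : (p : ℤ) ∣ a * (2 * x * y) - b * (2 * x ^ 2 - p)
  · have := (Prime.coprime_iff_not_dvd hpZ).2 fun h' => hsum ⟨h1, h'⟩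
    exact sq_eq_sq_of_dvd_sub (pow_pos hp0 2) hab hXY (this.pow_left.dvd_of_dvd_mul_right h)
  · have := (Prime.coprime_iff_not_dvd hpZ).2 h1
    exact sq_eq_sq_of_dvd_sub (b := -b) (pow_pos hp0 2) (by rwa [neg_sq]) hXY
      (by rw [neg_mul, sub_neg_eq_add]; exact this.pow_left.dvd_of_dvd_mul_left h)

theorem dvd_of_dvd_sq_add_sq_of_mod_four {p : ℕ} (hp : p.Prime) (hp4 : p % 4 = 3) {a b : ℤ}
    (h : (p : ℤ) ∣ a ^ 2 + b ^ 2) : (p : ℤ) ∣ a := by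
  have : Fact p.Prime := ⟨hp⟩
  by_contra ha
  have ha0 : (a : ZMod p) ≠ 0 := by rwa [Ne, ZMod.intCast_zmod_eq_zero_iff_dvd]
  have h1 : (a : ZMod p) ^ 2 + (b : ZMod p) ^ 2 = 0 := by
    have := (ZMod.intCast_zmod_eq_zero_iff_dvd (a ^ 2 + b ^ 2) p).2 h
    exact_mod_cast this
  have h2 : IsSquare (-1 : ZMod p) := ⟨b / a, by
    field_simp
    linear_combination -h1⟩
  exact (ZMod.exists_sq_eq_neg_one_iff.1 h2) hp4

end QuadraticForm

namespace TeichmullerLift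

variable {p : ℕ} {F K : Type*} [Field F] [Field K] (T : TeichmullerLift p F K)

theorem intCast_dvd_of_congrMod {a : ℤ} (hp : p.Prime)
    (h : CongrMod T.O (p : K) (a : K) 0) : (p : ℤ) ∣ a := by
  by_contra ha
  obtain ⟨w, hw, h⟩ := h
  have hc : IsCoprime (p : ℤ) a :=
    (Prime.coprime_iff_not_dvd (Nat.prime_iff_prime_int.1 hp)).2 ha
  obtain ⟨u, v, huv⟩ := hc
  have huv' : (u : K) * p + v * a = 1 := by exact_mod_cast congrArg (Int.cast : ℤ → K) huv
  have hmul : (p : K) * (u + v * w) = 1 := by linear_combination huv' - v * h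
  refine T.inv_natCast_self_notMem ?_
  rw [inv_eq_of_mul_eq_one_right hmul]
  exact T.O.add_mem (intCast_mem T.O u) (T.O.mul_mem (intCast_mem T.O v) hw)

/-- The multiplicative section, regarded as a multiplicative character. -/
def mulChar : MulChar F K where
  toMonoidHom := T.τ
  map_nonunit' a ha := by
    rw [isUnit_iff_ne_zero, not_not] at ha
    rw [ha]
    exact T.map_zero

@[simp]
theorem mulChar_apply (t : F) : T.mulChar t = T.τ t := rfl

theorem mulChar_pow_apply_mem {k : ℕ} (hk : k ≠ 0) (t : F) : (T.mulChar ^ k) t ∈ T.O := by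
  rw [MulChar.pow_apply' _ hk]
  exact T.O.pow_mem (T.map_mem t) k

variable [Fintype F] {N : ℕ}

theorem jacobiSum_mem (χ ψ : MulChar F K) (hχ : ∀ t, χ t ∈ T.O) (hψ : ∀ t, ψ t ∈ T.O) :
    jacobiSum χ ψ ∈ T.O :=
  T.O.sum_mem fun t _ => T.O.mul_mem (hχ t) (hψ (1 - t))

theorem exists_isPrimitiveRoot (hcard : Fintype.card F = N + 1) :
    ∃ g : F, IsPrimitiveRoot (T.τ g) N := by
  classical
  obtain ⟨g, hg⟩ := IsCyclic.exists_generator (α := Fˣ)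
  refine ⟨g, IsPrimitiveRoot.map_of_injective (IsPrimitiveRoot.coe_units_iff.2 ?_) T.injective⟩
  have hN : orderOf g = N := by
    rw [orderOf_eq_card_of_forall_mem_zpowers hg, Nat.card_eq_fintype_card, Fintype.card_units,
      hcard, Nat.add_sub_cancel]
  exact hN ▸ IsPrimitiveRoot.orderOf g

theorem mulChar_pow_eq_one (hcard : Fintype.card F = N + 1) : T.mulChar ^ N = 1 := by
  classical
  rw [← MulChar.pow_card_eq_one T.mulChar, Fintype.card_units, hcard, Nat.add_sub_cancel]

/-- The Jacobi sum of an octic character and the quadratic character, its conjugate, and the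
representation of the order of the field by the form `a ^ 2 + 2 * b ^ 2` they provide. -/
theorem exists_conj_of_sum_pow_mul_one_sub_pow [CharZero K] {m : ℕ} (hm : 0 < m)
    (hcard : Fintype.card F = 8 * m + 1) :
    ∃ J ∈ T.O, ∃ a b : ℤ, (∑ t, T.τ t ^ (7 * m) * T.τ (1 - t) ^ (4 * m)) + J = 2 * a ∧
      (∑ t, T.τ t ^ (7 * m) * T.τ (1 - t) ^ (4 * m)) * J = Fintype.card F ∧
      a ^ 2 + 2 * b ^ 2 = Fintype.card F := by
  have h1 := T.mulChar_pow_eq_one hcard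
  obtain ⟨g, hg⟩ := T.exists_isPrimitiveRoot hcard
  set θ := T.mulChar ^ (7 * m) with hθ
  have hθ8 : θ ^ 8 = 1 := by
    rw [hθ, ← pow_mul, show 7 * m * 8 = 8 * m * 7 by ring, pow_mul, h1, one_pow]
  have hθ4 : θ ^ 4 = T.mulChar ^ (4 * m) := by
    rw [hθ, ← pow_mul, show 7 * m * 4 = 8 * m * 3 + 4 * m by ring, pow_add, pow_mul, h1, one_pow,
      one_mul]
  have hinv : θ⁻¹ = T.mulChar ^ m := by
    rw [inv_eq_iff_mul_eq_one, hθ, ← pow_add, show 7 * m + m = 8 * m by ring, h1]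
  have hne : θ ^ 4 ≠ 1 := by
    intro h
    have hg0 : T.τ g ≠ 0 := hg.ne_zero (by omega)
    have h2 : T.τ g ^ (4 * m) = 1 := by
      rw [← mulChar_apply, ← MulChar.pow_apply' _ (by omega), ← hθ4, h, MulChar.one_apply]
      exact isUnit_iff_ne_zero.2 fun h0 => hg0 (by rw [h0, T.map_zero])
    exact hg.pow_ne_one_of_pos_of_lt (by omega) (by omega) h2
  obtain ⟨a, b, hab⟩ := exists_sq_add_two_mul_sq_of_jacobiSum hθ8 hne
    (hg.pow (by omega) (mul_comm 8 m))
  refine ⟨jacobiSum θ⁻¹ (θ ^ 4), ?_, a, b, ?_⟩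
  · rw [hinv, hθ4]
    exact T.jacobiSum_mem _ _ (T.mulChar_pow_apply_mem hm.ne')
      (T.mulChar_pow_apply_mem (by omega))
  · have hsum : ∑ t, T.τ t ^ (7 * m) * T.τ (1 - t) ^ (4 * m) = jacobiSum θ (θ ^ 4) := by
      rw [hθ4, hθ, jacobiSum]
      refine sum_congr rfl fun t _ => ?_
      rw [MulChar.pow_apply' _ (by omega), MulChar.pow_apply' _ (by omega), mulChar_apply,
        mulChar_apply]
    rwa [hsum]

end TeichmullerLift

theorem not_prime_dvd_choose {p n k : ℕ} (hp : p.Prime) (hn : n < p) (hk : k ≤ n) :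
    ¬ p ∣ n.choose k := fun h =>
  hn.not_ge (hp.dvd_factorial.1 (Nat.choose_mul_factorial_mul_factorial hk ▸
    (h.mul_right _).mul_right _))

namespace TeichmullerLift

variable {p : ℕ} {F K : Type*} [Field F] [Field K]

theorem sum_pow_mul_one_sub_pow_mem [Fintype F] (T : TeichmullerLift p F K) (k l : ℕ) :
    ∑ t, T.τ t ^ k * T.τ (1 - t) ^ l ∈ T.O :=
  T.O.sum_mem fun t _ => T.O.mul_mem (T.O.pow_mem (T.map_mem t) k)
    (T.O.pow_mem (T.map_mem (1 - t)) l)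

variable [CharZero K]

theorem harmonic_combination_mem (T : TeichmullerLift p F K) (hp : p.Prime) (hp2 : p ≠ 2)
    {k l n : ℕ} (hk : k < p) (hl : l < p) (hn : n < p) :
    -harmonicSum K n + (3 / 4 * harmonicSum K l + 1 / 4 * harmonicSum K k) ∈ T.O := by
  have hO := T.inv_natCast_mem
  have h4 : (1 / 4 : K) ∈ T.O := by
    rw [show (1 / 4 : K) = ((2 : ℕ) : K) * 8⁻¹ by norm_num]
    exact T.O.mul_mem (T.natCast_mem 2) (inv_eight_mem hp hp2 hO)
  have h34 : (3 / 4 : K) ∈ T.O := by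
    rw [show (3 / 4 : K) = ((3 : ℕ) : K) * (1 / 4) by norm_num]
    exact T.O.mul_mem (T.natCast_mem 3) h4
  exact T.O.add_mem (T.O.neg_mem (harmonicSum_mem hO hn))
    (T.O.add_mem (T.O.mul_mem h34 (harmonicSum_mem hO hl))
      (T.O.mul_mem h4 (harmonicSum_mem hO hk)))

theorem not_dvd_den_of_ratCast_mem (T : TeichmullerLift p F K) (hp : p.Prime) {r : ℚ}
    (hr : (r : K) ∈ T.O) : ¬ p ∣ r.den := by
  rintro ⟨d, hd⟩
  have hnum : ¬ (p : ℤ) ∣ r.num := fun h =>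
    hp.one_lt.ne' <| Nat.dvd_one.1 <| r.reduced ▸
      Nat.dvd_gcd (Int.natCast_dvd.1 h) ⟨d, hd⟩
  have hd0 : (d : K) ≠ 0 := Nat.cast_ne_zero.2 fun h => r.den_nz (by rw [hd, h, mul_zero])
  have hp0 : (p : K) ≠ 0 := Nat.cast_ne_zero.2 hp.ne_zero
  have hn0 : (r.num : K) ≠ 0 := Int.cast_ne_zero.2 fun h => hnum (h ▸ dvd_zero _)
  refine T.inv_natCast_self_notMem ?_
  rw [show (p : K)⁻¹ = d * r * (r.num : K)⁻¹ by
    rw [Rat.cast_def, hd]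
    push_cast
    field_simp]
  exact T.O.mul_mem (T.O.mul_mem (T.natCast_mem d) hr)
    (inv_intCast_mem T.inv_natCast_mem hnum)

variable [Fintype F]

theorem choose_sq_congr_of_mod_eight_eq_one (T : TeichmullerLift p F K) (hp : p.Prime)
    (hcard : Fintype.card F = p) {m n : ℕ} (hpm : 8 * m + 1 = p) (hn : n = 4 * m) {x y : ℤ}
    (hxy : x ^ 2 + 2 * y ^ 2 = p) :
    CongrMod T.O ((p : K) ^ 2)
      ((n.choose m : K) ^ 2 * (1 + p * (-harmonicSum K n +
        (3 / 4 * harmonicSum K (3 * m) + 1 / 4 * harmonicSum K m))))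
      (4 * (x : K) ^ 2 - 2 * p) := by
  have hm : 0 < m := Nat.pos_of_ne_zero fun h => hp.one_lt.ne (by omega)
  have hp2 : p ≠ 2 := by omega
  have hpO := T.natCast_mem p
  have hchoose := not_prime_dvd_choose hp (n := n) (k := m) (by omega) (by omega)
  refine (T.sq_sum_pow_mul_one_sub_pow_congr hp hp2 hcard hm hpm hn rfl).symm.trans ?_
  obtain ⟨w, hw, hJE⟩ := T.sq_sum_pow_mul_one_sub_pow_congr hp hp2 hcard hm hpm hn rfl
  have hh := T.harmonic_combination_mem hp hp2 (k := m) (l := 3 * m) (n := n) (by omega)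
    (by omega) (by omega)
  obtain ⟨J', hJ', a, b, hadd, hmul, hab⟩ :=
    T.exists_conj_of_sum_pow_mul_one_sub_pow hm (hcard.trans hpm.symm)
  have hJ := T.sum_pow_mul_one_sub_pow_mem (7 * m) (4 * m)
  rw [hn] at hJE hh hchoose ⊢
  rw [hcard] at hmul hab
  generalize ∑ t, T.τ t ^ (7 * m) * T.τ (1 - t) ^ (4 * m) = J at *
  generalize -harmonicSum K (4 * m) + (3 / 4 * harmonicSum K (3 * m) + 1 / 4 * harmonicSum K m)
    = h at *
  have hax : (a : K) ^ 2 = (x : K) ^ 2 := by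
    exact_mod_cast congrArg (Int.cast : ℤ → K) (sq_eq_sq_of_add_two_mul_sq_eq_prime hp hab hxy)
  rcases T.prime J hJ J' hJ' ⟨1, T.O.one_mem, by rw [hmul]; ring⟩ with ⟨v, hv, e⟩ | ⟨v, hv, e⟩
  · refine absurd ?_ hchoose
    refine hp.dvd_of_dvd_pow (n := 2) ?_
    have : (p : ℤ) ∣ (((4 * m).choose m ^ 2 : ℕ) : ℤ) := by
      refine T.intCast_dvd_of_congrMod hp
        ⟨p * v ^ 2 - p * w - ((4 * m).choose m : K) ^ 2 * h, ?_, ?_⟩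
      · exact T.O.sub_mem (T.O.sub_mem (T.O.mul_mem hpO (T.O.pow_mem hv 2)) (T.O.mul_mem hpO hw))
          (T.O.mul_mem (T.O.pow_mem (T.natCast_mem _) 2) hh)
      · push_cast
        linear_combination (J + p * v) * e - hJE
    exact_mod_cast this
  · refine ⟨-v ^ 2, T.O.neg_mem (T.O.pow_mem hv 2), ?_⟩
    linear_combination (J + J' + 2 * a) * hadd - 2 * hmul + 4 * hax - (J' + p * v) * e

theorem choose_sq_congr_of_mod_eight_eq_three [CharP F p] (T : TeichmullerLift p F K)
    (hp : p.Prime) (hcard : Fintype.card F = p ^ 2) {m n : ℕ} (hm : 0 < m)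
    (hpm : 8 * m + 3 = p) (hn : n = 4 * m + 1) {x y : ℤ} (hxy : x ^ 2 + 2 * y ^ 2 = p) :
    CongrMod T.O ((p : K) ^ 2)
      ((n.choose m : K) ^ 2 * (1 + p * (-harmonicSum K n +
        (3 / 4 * harmonicSum K (3 * m + 1) + 1 / 4 * harmonicSum K m))))
      (4 * (x : K) ^ 2 - 2 * p) := by
  have hp2 : p ≠ 2 := by omega
  have hpO := T.natCast_mem p
  have hchoose := not_prime_dvd_choose hp (n := n) (k := m) (by omega) (by omega)
  obtain ⟨M, hM, hM4⟩ : ∃ M, p ^ 2 = 8 * M + 1 ∧ 4 * M = (p + 1) * n :=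
    ⟨(4 * m + 1) * (2 * m + 1), by rw [← hpm]; ring, by rw [← hpm, hn]; ring⟩
  have hM0 : 0 < M := by nlinarith [hp.two_le]
  have hJE' := T.sum_pow_mul_one_sub_pow_congr_of_mod_eight hp hcard (A := 7 * M) hm hpm hn
    (by omega)
  have hh := T.harmonic_combination_mem hp hp2 (k := m) (l := 3 * m + 1) (n := n) (by omega)
    (by omega) (by omega)
  obtain ⟨J', hJ', a, b, hadd, hmul, hab⟩ :=
    T.exists_conj_of_sum_pow_mul_one_sub_pow hM0 (hcard.trans hM)
  have hJ := T.sum_pow_mul_one_sub_pow_mem (7 * M) (4 * M)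
  rw [hM4] at hmul hJ hadd
  refine hJE'.symm.trans ?_
  obtain ⟨w, hw, hJE⟩ := hJE'
  rw [hcard] at hmul hab
  push_cast at hmul hab
  generalize ∑ t, T.τ t ^ (7 * M) * T.τ (1 - t) ^ ((p + 1) * n) = J at *
  generalize -harmonicSum K n + (3 / 4 * harmonicSum K (3 * m + 1) + 1 / 4 * harmonicSum K m)
    = h at *
  have hdvd : ∀ c : ℤ, CongrMod T.O (p : K) J c → (p : ℤ) ∣ (n.choose m : ℤ) ^ 2 - c := by
    rintro c ⟨v, hv, e⟩
    refine T.intCast_dvd_of_congrMod hp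
      ⟨v - p * w - (n.choose m : K) ^ 2 * h, ?_, ?_⟩
    · exact T.O.sub_mem (T.O.sub_mem hv (T.O.mul_mem hpO hw))
        (T.O.mul_mem (T.O.pow_mem (T.natCast_mem _) 2) hh)
    · push_cast
      linear_combination e - hJE
  have hJ0 : ¬ CongrMod T.O (p : K) J 0 := fun h0 => hchoose <| by
    have := hdvd 0 (by simpa using h0)
    rw [sub_zero] at this
    exact hp.dvd_of_dvd_pow (n := 2) (by exact_mod_cast this)
  have hpK : (p : K) ≠ 0 := Nat.cast_ne_zero.2 hp.ne_zero
  obtain ⟨v, hv, e⟩ := (T.prime J hJ J' hJ' ⟨p, hpO, by rw [hmul]; ring⟩).resolve_left hJ0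
  obtain ⟨u, hu, e'⟩ := (T.prime J hJ v hv ⟨1, T.O.one_mem,
    mul_left_cancel₀ hpK (by linear_combination hmul - J * e)⟩).resolve_left hJ0
  have hJa : J = 2 * a - p ^ 2 * u := by linear_combination hadd - e - p * e'
  have ha : ¬ (p : ℤ) ∣ a := by
    rintro ⟨k, rfl⟩
    refine hJ0 ⟨2 * k - p * u, T.O.sub_mem ?_ (T.O.mul_mem hpO hu), ?_⟩
    · exact_mod_cast intCast_mem T.O (2 * k)
    · rw [hJa]
      push_cast
      ring
  rcases eq_or_eq_neg_of_add_two_mul_sq_eq_prime_sq hp hp2 hab ha hxy with rfl | rfl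
  · refine ⟨-u, T.O.neg_mem hu, ?_⟩
    rw [hJa]
    push_cast
    ring
  · have h1 := hdvd (-(2 * x) ^ 2) ⟨2 - p * u, T.O.sub_mem ?_ (T.O.mul_mem hpO hu), by
      rw [hJa]
      push_cast
      ring⟩
    · rw [sub_neg_eq_add] at h1
      exact absurd (by exact_mod_cast dvd_of_dvd_sq_add_sq_of_mod_four hp (by omega) h1) hchoose
    · exact_mod_cast T.natCast_mem 2

end TeichmullerLift

theorem TeichmullerLift.pCong_two_of_congrMod {p : ℕ} {F K : Type*} [Field F] [Field K]
    [CharZero K] (T : TeichmullerLift p F K) (hp : p.Prime) {u v : ℚ}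
    (h : CongrMod T.O ((p : K) ^ 2) u v) : pCong p 2 u v := by
  obtain ⟨w, hw, e⟩ := h
  refine T.not_dvd_den_of_ratCast_mem hp ?_
  have hp0 : (p : K) ≠ 0 := Nat.cast_ne_zero.2 hp.ne_zero
  push_cast
  rwa [e, mul_div_cancel_left₀ _ (pow_ne_zero 2 hp0)]

section Assembly

variable {K : Type*} [Field K] [CharZero K] {O : Subring K} {p n k l a : ℕ}

theorem sum_centralBinom_div_congr (hp : p.Prime) (hp7 : 7 < p)
    (hO : ∀ k : ℕ, ¬ p ∣ k → (k : K)⁻¹ ∈ O) (hn : 2 * n + 1 = p)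
    (hkl : k + l = n) (ha : 0 < a) (ha8 : a < 8) (hka : 8 * k + a = p) :
    CongrMod O ((p : K) ^ 2)
      (∑ j ∈ range p, ((2 * j).choose j : K) ^ 2 / 16 ^ j * ((p : K) / (8 * j + a)))
      ((n.choose k : K) ^ 2 * (1 + p * (-harmonicSum K n +
        (3 / 4 * harmonicSum K l + 1 / 4 * harmonicSum K k)))) := by
  have h := mul_sum_centralBinom_congr hp hp7 hO hn hkl one_pos ha ha8 (by omega)
  rw [Nat.cast_one, one_mul] at h
  convert h using 6 <;> norm_num

theorem three_mul_sum_centralBinom_div_congr (hp : p.Prime) (hp7 : 7 < p)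
    (hO : ∀ k : ℕ, ¬ p ∣ k → (k : K)⁻¹ ∈ O) (hn : 2 * n + 1 = p)
    (hkl : k + l = n) (ha : 0 < a) (ha8 : a < 8) (hla : 8 * l + a = 3 * p) :
    CongrMod O ((p : K) ^ 2)
      (3 * ∑ j ∈ range p, ((2 * j).choose j : K) ^ 2 / 16 ^ j * ((p : K) / (8 * j + a)))
      ((n.choose k : K) ^ 2 * (1 + p * (-harmonicSum K n +
        (3 / 4 * harmonicSum K l + 1 / 4 * harmonicSum K k)))) := by
  have h := mul_sum_centralBinom_congr hp hp7 hO hn ((add_comm l k).trans hkl) three_pos ha ha8 hla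
  rw [← hkl, Nat.choose_symm_add, hkl]
  rw [Nat.cast_ofNat] at h
  convert h using 5
  ring

end Assembly

theorem stmt14 (p : ℕ) (hp : p.Prime) (hp3 : 3 < p)
    (hp8 : p % 8 = 1 ∨ p % 8 = 3) (x y : ℤ)
    (hxy : (p : ℤ) = x ^ 2 + 2 * y ^ 2) :
    pCong p 2
      ((2 - (-1 : ℚ) ^ ((p - 1) / 2)) *
        ∑ k ∈ Finset.range p,
          ((2 * k).choose k : ℚ) ^ 2 / 16 ^ k * ((p : ℚ) / (8 * (k : ℚ) + 1)))
      ((2 + (-1 : ℚ) ^ ((p - 1) / 2)) *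
        ∑ k ∈ Finset.range p,
          ((2 * k).choose k : ℚ) ^ 2 / 16 ^ k * ((p : ℚ) / (8 * (k : ℚ) + 3))) ∧
    pCong p 2
      ((2 + (-1 : ℚ) ^ ((p - 1) / 2)) *
        ∑ k ∈ Finset.range p,
          ((2 * k).choose k : ℚ) ^ 2 / 16 ^ k * ((p : ℚ) / (8 * (k : ℚ) + 3)))
      (4 * (x : ℚ) ^ 2 - 2 * (p : ℚ)) := by
  have : Fact p.Prime := ⟨hp⟩
  rcases hp8 with hp8 | hp8
  · obtain ⟨m, hm⟩ : ∃ m, 8 * m + 1 = p := ⟨p / 8, by omega⟩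
    have hsign : (-1 : ℚ) ^ ((p - 1) / 2) = 1 := by
      rw [show (p - 1) / 2 = 2 * (2 * m) by omega, pow_mul, neg_one_sq, one_pow]
    let T := WittVector.teichmullerLift p (ZMod p)
    have h1 := sum_centralBinom_div_congr (n := 4 * m) (k := m) (l := 3 * m) (a := 1) hp (by omega)
      T.inv_natCast_mem (by omega) (by omega) (by omega) (by omega) hm
    have h3 := three_mul_sum_centralBinom_div_congr (n := 4 * m) (k := m) (l := 3 * m) (a := 3) hp
      (by omega) T.inv_natCast_mem (by omega) (by omega) (by omega) (by omega) (by omega)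
    have hx := T.choose_sq_congr_of_mod_eight_eq_one hp (ZMod.card p) hm rfl hxy.symm
    rw [hsign, show (2 - 1 : ℚ) = 1 by norm_num, show (2 + 1 : ℚ) = 3 by norm_num, one_mul]
    constructor <;> apply T.pCong_two_of_congrMod hp <;> push_cast at h1 h3 ⊢
    exacts [h1.trans h3.symm, h3.trans hx]
  · obtain ⟨m, hm⟩ : ∃ m, 8 * m + 3 = p := ⟨p / 8, by omega⟩
    have hsign : (-1 : ℚ) ^ ((p - 1) / 2) = -1 := by
      rw [show (p - 1) / 2 = 2 * (2 * m) + 1 by omega, pow_succ, pow_mul, neg_one_sq, one_pow,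
        one_mul]
    have := Fintype.ofFinite (GaloisField p 2)
    have hcard : Fintype.card (GaloisField p 2) = p ^ 2 := by
      rw [← Nat.card_eq_fintype_card, GaloisField.card p 2 two_ne_zero]
    let T := WittVector.teichmullerLift p (GaloisField p 2)
    have h3 := sum_centralBinom_div_congr (n := 4 * m + 1) (k := m) (l := 3 * m + 1) (a := 3) hp
      (by omega) T.inv_natCast_mem (by omega) (by omega) (by omega) (by omega) hm
    have h1 := three_mul_sum_centralBinom_div_congr (n := 4 * m + 1) (k := m) (l := 3 * m + 1)
      (a := 1) hp (by omega) T.inv_natCast_mem (by omega) (by omega) (by omega) (by omega)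
      (by omega)
    have hx := T.choose_sq_congr_of_mod_eight_eq_three hp hcard (by omega) hm rfl hxy.symm
    rw [hsign, show (2 - -1 : ℚ) = 3 by norm_num, show (2 + -1 : ℚ) = 1 by norm_num, one_mul]
    constructor <;> apply T.pCong_two_of_congrMod hp <;> push_cast at h1 h3 ⊢
    exacts [h1.trans h3.symm, h3.trans hx]
end

section
/- Let p be a prime with p > 3, and let W_n = Σ_{k=0}^{⌊n/3⌋} C(2k,k)·C(3k,k)·C(n,3k)·(−3)^{n−3k}. If p ≡ 1 (mod 3) and L, M are integers with 4p = L² + 27M² and L ≡ 1 (mod 3), then Σ_{n=0}^{p−1} W_n/(−3)^n ≡ Σ_{k=0}^{⌊p/3⌋} ( C(2k,k)·C(3k,k)/27^k ) · p/(3k + 1) ≡ −L + p/L (mod p²). If p ≡ 2 (mod 3), then Σ_{n=0}^{p−1} W_n/(−3)^n ≡ Σ_{k=0}^{⌊p/3⌋} ( C(2k,k)·C(3k,k)/27^k ) · p/(3k + 1) ≡ −(p/3)·( ((p−2)/3)! )³ (mod p²). -/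
/-- `W_n = Σ_{k=0}^{⌊n/3⌋} C(2k,k)·C(3k,k)·C(n,3k)·(−3)^{n−3k}`. -/
def W (n : ℕ) : ℤ :=
  ∑ k ∈ Finset.range (n / 3 + 1),
    ((2 * k).choose k : ℤ) * ((3 * k).choose k : ℤ) * (n.choose (3 * k) : ℤ) *
      (-3 : ℤ) ^ (n - 3 * k)

/-- The `p`-integers form a subring of `ℚ`. -/
def pIntSubring (p : ℕ) [hp : Fact p.Prime] : Subring ℚ where
  carrier := {x | isPInt p x}
  mul_mem' {x y} hx hy h :=
    (hp.out.dvd_mul.1 (h.trans (Rat.mul_den_dvd x y))).elim hx hy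
  add_mem' {x y} hx hy h :=
    (hp.out.dvd_mul.1 (h.trans (Rat.add_den_dvd x y))).elim hx hy
  one_mem' := by simp [isPInt, hp.out.one_lt.ne']
  zero_mem' := by simp [isPInt, hp.out.one_lt.ne']
  neg_mem' {x} hx := by simpa [isPInt] using hx

section PIntegers

variable {p : ℕ} [hp : Fact p.Prime]

lemma mem_pIntSubring {x : ℚ} : x ∈ pIntSubring p ↔ isPInt p x := Iff.rfl

lemma inv_intCast_mem_pIntSubring {n : ℤ} (hn : ¬ (p : ℤ) ∣ n) :
    ((n : ℚ))⁻¹ ∈ pIntSubring p := by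
  rw [mem_pIntSubring, isPInt]
  intro h
  apply hn
  have h0 : n ≠ 0 := by rintro rfl; exact hn (dvd_zero _)
  rw [Rat.inv_intCast_den, if_neg h0] at h
  exact Int.natCast_dvd.2 h

lemma inv_natCast_mem_pIntSubring {n : ℕ} (hn : ¬ p ∣ n) :
    ((n : ℚ))⁻¹ ∈ pIntSubring p := by
  exact_mod_cast inv_intCast_mem_pIntSubring (p := p) (n := n) (by exact_mod_cast hn)

lemma pCong_iff {k : ℕ} {u v : ℚ} :
    pCong p k u v ↔ ∃ z ∈ pIntSubring p, u - v = p ^ k * z := by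
  have h0 : (p : ℚ) ^ k ≠ 0 := pow_ne_zero _ (by exact_mod_cast hp.out.ne_zero)
  constructor
  · intro h
    exact ⟨_, h, by field_simp⟩
  · rintro ⟨z, hz, h⟩
    rw [pCong, h, mul_div_cancel_left₀ _ h0]
    exact hz

lemma pCong_of_dvd {k : ℕ} {a b : ℤ} (h : (p : ℤ) ^ k ∣ a - b) : pCong p k a b := by
  obtain ⟨c, hc⟩ := h
  exact pCong_iff.2 ⟨c, intCast_mem _ _, by exact_mod_cast hc⟩

lemma pCong_refl {k : ℕ} (u : ℚ) : pCong p k u u :=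
  pCong_iff.2 ⟨0, zero_mem _, by simp⟩

lemma pCong.trans {k : ℕ} {u v w : ℚ} (h : pCong p k u v) (h' : pCong p k v w) :
    pCong p k u w := by
  obtain ⟨z, hz, h⟩ := pCong_iff.1 h
  obtain ⟨z', hz', h'⟩ := pCong_iff.1 h'
  exact pCong_iff.2 ⟨z + z', add_mem hz hz', by linear_combination h + h'⟩

lemma pCong.add {k : ℕ} {u v u' v' : ℚ} (h : pCong p k u v) (h' : pCong p k u' v') :
    pCong p k (u + u') (v + v') := by
  obtain ⟨z, hz, h⟩ := pCong_iff.1 h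
  obtain ⟨z', hz', h'⟩ := pCong_iff.1 h'
  exact pCong_iff.2 ⟨z + z', add_mem hz hz', by linear_combination h + h'⟩

lemma pCong.mul_left {k : ℕ} {u v c : ℚ} (hc : c ∈ pIntSubring p) (h : pCong p k u v) :
    pCong p k (c * u) (c * v) := by
  obtain ⟨z, hz, h⟩ := pCong_iff.1 h
  exact pCong_iff.2 ⟨c * z, mul_mem hc hz, by linear_combination c * h⟩

lemma pCong.prime_mul {k : ℕ} {u v : ℚ} (h : pCong p k u v) :
    pCong p (k + 1) (p * u) (p * v) := by
  obtain ⟨z, hz, h⟩ := pCong_iff.1 h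
  exact pCong_iff.2 ⟨z, hz, by linear_combination (p : ℚ) * h⟩

lemma pCong.of_mul_left {k : ℕ} {u v c : ℚ} (hc : c⁻¹ ∈ pIntSubring p) (h0 : c ≠ 0)
    (h : pCong p k (c * u) (c * v)) : pCong p k u v := by
  simpa [h0] using h.mul_left hc

lemma pCong_sum {ι : Type*} {k : ℕ} {s : Finset ι} {u v : ι → ℚ}
    (h : ∀ i ∈ s, pCong p k (u i) (v i)) : pCong p k (∑ i ∈ s, u i) (∑ i ∈ s, v i) := by
  rw [pCong, ← Finset.sum_sub_distrib, Finset.sum_div]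
  exact (pIntSubring p).sum_mem h

end PIntegers

lemma dvd_choose_prime_sub_one {p : ℕ} (hp : p.Prime) {j : ℕ} (hj : j < p) :
    (p : ℤ) ∣ ((p - 1).choose j : ℤ) - (-1) ^ j := by
  induction j with
  | zero => simp
  | succ j ih =>
    have h1 : p ∣ p.choose (j + 1) := hp.dvd_choose_self (by lia) hj
    have h2 : p.choose (j + 1) = (p - 1).choose j + (p - 1).choose (j + 1) := by
      conv_lhs => rw [← Nat.sub_add_cancel hp.one_le]
      exact Nat.choose_succ_succ _ _
    have h3 : (p : ℤ) ∣ (p - 1).choose j + (p - 1).choose (j + 1) := by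
      exact_mod_cast h2 ▸ h1
    have h4 := dvd_sub h3 (ih (by lia))
    rwa [show ((p - 1).choose j + (p - 1).choose (j + 1) : ℤ) - ((p - 1).choose j - (-1) ^ j) =
      (p - 1).choose (j + 1) - (-1) ^ (j + 1) by ring] at h4

/-- The coefficient `C(2k,k) C(3k,k) / 27^k = (1/3)_k (2/3)_k / k!²`. -/
def trinomialCoeff (k : ℕ) : ℚ := ((2 * k).choose k : ℚ) * ((3 * k).choose k : ℚ) / 27 ^ k

lemma sum_range_choose_eq (n j : ℕ) :
    ∑ i ∈ Finset.range n, i.choose j = n.choose (j + 1) := by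
  induction n with
  | zero => simp
  | succ n ih => rw [Finset.sum_range_succ, ih, Nat.choose_succ_succ, add_comm]

lemma sum_W_div_pow (p : ℕ) : ∑ n ∈ Finset.range p, (W n : ℚ) / (-3) ^ n =
    ∑ k ∈ Finset.range (p / 3 + 1),
      trinomialCoeff k * ((-1) ^ k * (p.choose (3 * k + 1) : ℚ)) := by
  have h : ∀ n ∈ Finset.range p, (W n : ℚ) / (-3) ^ n =
      ∑ k ∈ Finset.range (p / 3 + 1), trinomialCoeff k * ((-1) ^ k * (n.choose (3 * k) : ℚ)) := by
    intro n hn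
    rw [Finset.mem_range] at hn
    rw [W, Int.cast_sum, Finset.sum_div]
    have hle : n / 3 + 1 ≤ p / 3 + 1 := by lia
    rw [← Finset.sum_subset (Finset.range_mono hle)]
    · refine Finset.sum_congr rfl fun k hk => ?_
      rw [Finset.mem_range] at hk
      have hk' : 3 * k ≤ n := by lia
      have e : (-3 : ℚ) ^ n = (-3) ^ (n - 3 * k) * ((-1) ^ k * 27 ^ k) := by
        rw [← mul_pow, show ((-1 : ℚ) * 27) = (-3) ^ 3 by norm_num, ← pow_mul, ← pow_add,
          Nat.sub_add_cancel hk']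
      have e1 : ((-1 : ℚ) ^ k) * (-1) ^ k = 1 := by rw [← mul_pow]; norm_num
      have e2 : (-1 : ℚ) ^ k ≠ 0 := by simp
      rw [e, trinomialCoeff]
      push_cast
      field_simp
      linear_combination (-(((2 * k).choose k : ℚ) * ((3 * k).choose k : ℚ) *
        (n.choose (3 * k) : ℚ))) * e1
    · intro k _ hk
      rw [Finset.mem_range] at hk
      rw [Nat.choose_eq_zero_of_lt (show n < 3 * k by lia)]
      simp
  rw [Finset.sum_congr rfl h, Finset.sum_comm]
  refine Finset.sum_congr rfl fun k _ => ?_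
  rw [← Finset.mul_sum, ← Finset.mul_sum, ← Nat.cast_sum]
  congr 3
  exact sum_range_choose_eq p (3 * k)

section Terms

variable {p : ℕ} [hp : Fact p.Prime]

lemma inv_three_mem_pIntSubring (hp3 : 3 < p) : ((3 : ℚ))⁻¹ ∈ pIntSubring p := by
  exact_mod_cast inv_natCast_mem_pIntSubring (p := p) (n := 3)
    (Nat.not_dvd_of_pos_of_lt (by lia) hp3)

lemma trinomialCoeff_mem (hp3 : 3 < p) (k : ℕ) : trinomialCoeff k ∈ pIntSubring p := by
  rw [trinomialCoeff, div_eq_mul_inv, show (27 : ℚ) ^ k = (3 ^ 3) ^ k by norm_num, ← inv_pow,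
    ← inv_pow]
  exact mul_mem (mul_mem (natCast_mem _ _) (natCast_mem _ _))
    (pow_mem (pow_mem (inv_three_mem_pIntSubring hp3) _) _)

lemma inv_three_mul_add_one_mem {k : ℕ} (hk : 3 * k + 1 < p) :
    (3 * (k : ℚ) + 1)⁻¹ ∈ pIntSubring p := by
  exact_mod_cast inv_natCast_mem_pIntSubring (p := p) (n := 3 * k + 1)
    (Nat.not_dvd_of_pos_of_lt (by lia) hk)

lemma pCong_sum_W (hp3 : 3 < p) :
    pCong p 2 (∑ n ∈ Finset.range p, (W n : ℚ) / (-3) ^ n)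
      (∑ k ∈ Finset.range (p / 3 + 1), trinomialCoeff k * ((p : ℚ) / (3 * (k : ℚ) + 1))) := by
  rw [sum_W_div_pow]
  refine pCong_sum fun k hk => (?_ : pCong p 2 _ _).mul_left (trinomialCoeff_mem hp3 k)
  rw [Finset.mem_range] at hk
  have hp0 : (p : ℚ) ≠ 0 := by exact_mod_cast hp.out.ne_zero
  have h3 : ¬ 3 ∣ p := fun h => by
    have := (Nat.prime_dvd_prime_iff_eq Nat.prime_three hp.out).1 h
    lia
  have hk0 : (3 * (k : ℚ) + 1) ≠ 0 := by positivity
  have e1 : ((-1 : ℚ) ^ k) * (-1) ^ k = 1 := by rw [← mul_pow]; norm_num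
  have hodd : p % 2 = 1 := hp.out.eq_two_or_odd.resolve_left (by lia)
  rcases (show 3 * k + 1 = p ∨ 3 * k + 1 < p by lia) with h | h
  · have hk2 : Even k := by rw [Nat.even_iff]; lia
    have hpk : (p : ℚ) = 3 * k + 1 := by exact_mod_cast h.symm
    rw [h, Nat.choose_self, hk2.neg_one_pow, hpk, div_self hk0]
    simpa using pCong_refl 1
  · have hc : ((3 * k + 1 : ℕ) : ℚ) * p.choose (3 * k + 1) = p * (p - 1).choose (3 * k) := by
      have := Nat.add_one_mul_choose_eq (p - 1) (3 * k)
      rw [Nat.sub_add_cancel hp.out.one_le] at this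
      rw [mul_comm]
      exact_mod_cast this.symm
    push_cast at hc
    have hA := (pCong_of_dvd (p := p) (k := 1) (a := (p - 1).choose (3 * k))
      (b := (-1) ^ (3 * k)) (by
        rw [pow_one]
        exact dvd_choose_prime_sub_one hp.out (by lia))).prime_mul.mul_left
      (mul_mem (inv_three_mul_add_one_mem h) (pow_mem (neg_mem (one_mem _)) k))
    convert hA using 1
    · push_cast
      field_simp
      linear_combination hc
    · push_cast
      have e3 : (-1 : ℚ) ^ (3 * k) = (-1) ^ k := by rw [pow_mul]; norm_num
      rw [e3]
      field_simp
      linear_combination -e1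

end Terms

/-- The coefficient `(-1)^k C(m,k) C(m+k,k) = (-m)_k (m+1)_k / k!²`. -/
def legendreCoeff (m k : ℕ) : ℚ := (-1) ^ k * (m.choose k : ℚ) * ((m + k).choose k : ℚ)

lemma trinomialCoeff_succ (k : ℕ) : 9 * ((k : ℚ) + 1) ^ 2 * trinomialCoeff (k + 1) =
    (3 * k + 1) * (3 * k + 2) * trinomialCoeff k := by
  have h (k : ℕ) : trinomialCoeff k * ((k.factorial : ℚ) ^ 3 * 27 ^ k) =
      ((3 * k).factorial : ℚ) := by
    have h1 : (2 * k).choose k * k.factorial * k.factorial = (2 * k).factorial := by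
      have := Nat.choose_mul_factorial_mul_factorial (show k ≤ 2 * k by lia)
      rwa [show 2 * k - k = k by lia] at this
    have h2 : (3 * k).choose k * k.factorial * (2 * k).factorial = (3 * k).factorial := by
      have := Nat.choose_mul_factorial_mul_factorial (show k ≤ 3 * k by lia)
      rwa [show 3 * k - k = 2 * k by lia] at this
    rw [← h2, ← h1, trinomialCoeff]
    push_cast
    field_simp
  have hk := h k
  have hk1 := h (k + 1)
  rw [show 3 * (k + 1) = 3 * k + 1 + 1 + 1 by ring, Nat.factorial_succ, Nat.factorial_succ,
    Nat.factorial_succ, Nat.factorial_succ] at hk1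
  push_cast at hk1
  rw [← hk] at hk1
  have hf : (k.factorial : ℚ) ≠ 0 := by exact_mod_cast k.factorial_ne_zero
  have hk0 : (k : ℚ) + 1 ≠ 0 := by positivity
  have : (3 * ((k : ℚ) + 1)) * (k.factorial : ℚ) ^ 3 * 27 ^ k ≠ 0 := by positivity
  apply mul_left_cancel₀ this
  linear_combination hk1

lemma cast_choose_succ (m k : ℕ) :
    ((k : ℚ) + 1) * m.choose (k + 1) = ((m : ℚ) - k) * m.choose k := by
  rcases le_or_gt k m with h | h
  · have := Nat.choose_succ_right_eq m k
    rw [← Nat.cast_sub h, mul_comm, mul_comm ((m - k : ℕ) : ℚ)]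
    exact_mod_cast this
  · rw [Nat.choose_eq_zero_of_lt h, Nat.choose_eq_zero_of_lt (by lia)]
    simp

lemma legendreCoeff_succ (m k : ℕ) : ((k : ℚ) + 1) ^ 2 * legendreCoeff m (k + 1) =
    -((m : ℚ) - k) * (m + k + 1) * legendreCoeff m k := by
  have h1 := cast_choose_succ m k
  have h2 : ((k : ℚ) + 1) * (m + (k + 1)).choose (k + 1) = (m + k + 1) * (m + k).choose k := by
    have := Nat.add_one_mul_choose_eq (m + k) k
    rw [mul_comm ((k : ℚ) + 1)]
    exact_mod_cast this.symm
  simp only [legendreCoeff, pow_succ]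
  linear_combination (-(-1 : ℚ) ^ k) * (((k : ℚ) + 1) * (m + (k + 1)).choose (k + 1)) * h1 +
    (-(-1 : ℚ) ^ k) * ((m : ℚ) - k) * m.choose k * h2

lemma legendreCoeff_zero (m : ℕ) : legendreCoeff m 0 = 1 := by simp [legendreCoeff]

lemma trinomialCoeff_zero : trinomialCoeff 0 = 1 := by simp [trinomialCoeff]

lemma pCong_trinomialCoeff_legendreCoeff {p : ℕ} [hp : Fact p.Prime] {m k : ℕ}
    (hm : 3 * m + 1 = p ∨ 3 * m + 2 = p) (hk : k ≤ m) :
    pCong p 1 (trinomialCoeff k) (legendreCoeff m k) := by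
  induction k with
  | zero => rw [legendreCoeff_zero, trinomialCoeff_zero]; exact pCong_refl 1
  | succ k ih =>
    have hk0 : 3 * ((k : ℚ) + 1) ≠ 0 := by positivity
    have hinv : (3 * ((k : ℚ) + 1))⁻¹ ∈ pIntSubring p := by
      exact_mod_cast inv_natCast_mem_pIntSubring (p := p) (n := 3 * (k + 1))
        (Nat.not_dvd_of_pos_of_lt (by lia) (by lia))
    refine pCong.of_mul_left (c := (3 * ((k : ℚ) + 1)) ^ 2)
      (by rw [← inv_pow]; exact pow_mem hinv 2) (pow_ne_zero _ hk0) ?_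
    rw [show (3 * ((k : ℚ) + 1)) ^ 2 = 9 * ((k : ℚ) + 1) ^ 2 by ring, trinomialCoeff_succ,
      mul_assoc 9, legendreCoeff_succ]
    obtain ⟨z, hz, h⟩ := pCong_iff.1 (ih (by lia))
    have hU : legendreCoeff m k ∈ pIntSubring p := by
      rw [legendreCoeff]
      exact mul_mem (mul_mem (pow_mem (neg_mem (one_mem _)) _) (natCast_mem _ _)) (natCast_mem _ _)
    rcases hm with hm | hm
    · have hm' : (p : ℚ) = 3 * m + 1 := by exact_mod_cast hm.symm
      refine pCong_iff.2 ⟨((3 * k + 1 : ℕ) : ℚ) * ((3 * k + 2 : ℕ) : ℚ) * z +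
        ((p + 1 : ℕ) : ℚ) * legendreCoeff m k, add_mem (mul_mem (mul_mem (natCast_mem _ _)
          (natCast_mem _ _)) hz) (mul_mem (natCast_mem _ _) hU), ?_⟩
      push_cast
      rw [hm'] at h ⊢
      linear_combination (3 * (k : ℚ) + 1) * (3 * k + 2) * h
    · have hm' : (p : ℚ) = 3 * m + 2 := by exact_mod_cast hm.symm
      refine pCong_iff.2 ⟨((3 * k + 1 : ℕ) : ℚ) * ((3 * k + 2 : ℕ) : ℚ) * z +
        (((p : ℤ) - 1 : ℤ) : ℚ) * legendreCoeff m k, add_mem (mul_mem (mul_mem (natCast_mem _ _)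
          (natCast_mem _ _)) hz) (mul_mem (intCast_mem _ _) hU), ?_⟩
      push_cast
      rw [hm'] at h ⊢
      linear_combination (3 * (k : ℚ) + 1) * (3 * k + 2) * h

lemma alternating_sum_choose_mul_choose (m K : ℕ) :
    ∑ k ∈ Finset.range (K + 1), (-1 : ℚ) ^ k * ((m + 1).choose k : ℚ) * ((m + k).choose k : ℚ) =
      (-1) ^ K * (m.choose K : ℚ) * ((m + 1 + K).choose K : ℚ) := by
  induction K with
  | zero => simp
  | succ K ih =>
    rw [Finset.sum_range_succ, ih]
    have h1 : ((m + 1).choose (K + 1) : ℚ) = m.choose K + m.choose (K + 1) := by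
      exact_mod_cast Nat.choose_succ_succ m K
    have h2 : ((m + 1 + (K + 1)).choose (K + 1) : ℚ) =
        (m + 1 + K).choose K + (m + (K + 1)).choose (K + 1) := by
      rw [show m + (K + 1) = m + 1 + K by ring]
      exact_mod_cast Nat.choose_succ_succ (m + 1 + K) K
    have h3 := cast_choose_succ m K
    have h4 := cast_choose_succ (m + 1 + K) K
    rw [show m + 1 + K = m + (K + 1) by ring] at h4 h2
    push_cast at h4
    rw [show m + 1 + K = m + (K + 1) by ring, h1, h2, pow_succ]
    have hK : (K : ℚ) + 1 ≠ 0 := by positivity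
    apply mul_left_cancel₀ hK
    linear_combination (-1 : ℚ) ^ K * (m + (K + 1)).choose K * h3 -
      (-1 : ℚ) ^ K * m.choose K * h4

lemma legendreCoeff_succ_left (m k : ℕ) (hk : k ≤ m + 1) (x : ℚ) :
    (x + m + 1) * legendreCoeff (m + 1) k - (m + 1 - x) * legendreCoeff m k =
      2 * (k + x) * ((-1 : ℚ) ^ k * ((m + 1).choose k : ℚ) * ((m + k).choose k : ℚ)) := by
  have h1 : (m.choose k : ℚ) * (m + 1) = (m + 1).choose k * ((m : ℚ) + 1 - k) := by
    have := Nat.choose_mul_succ_eq m k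
    rw [show ((m : ℚ) + 1 - k) = ((m + 1 - k : ℕ) : ℚ) by rw [Nat.cast_sub hk]; push_cast; ring]
    exact_mod_cast this
  have h2 : ((m + k).choose k : ℚ) * (m + k + 1) = (m + 1 + k).choose k * ((m : ℚ) + 1) := by
    have := Nat.choose_mul_succ_eq (m + k) k
    rw [show m + k + 1 - k = m + 1 by lia, show m + k + 1 = m + 1 + k by ring] at this
    rw [show ((m : ℚ) + k + 1) = m + 1 + k by ring]
    exact_mod_cast this
  have hm : (m : ℚ) + 1 ≠ 0 := by positivity
  apply mul_left_cancel₀ hm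
  simp only [legendreCoeff]
  linear_combination (-(-1 : ℚ) ^ k * (x + m + 1) * (m + 1).choose k) * h2 -
    (-1 : ℚ) ^ k * (m + 1 - x) * (m + k).choose k * h1

/-- The partial fraction expansion of `∏ (j + 1 - x) / ∏ (x + j)`. -/
lemma prod_mul_sum_legendreCoeff_div (x : ℚ) (hx : ∀ j : ℕ, (j : ℚ) + x ≠ 0) (m : ℕ) :
    (∏ j ∈ Finset.range (m + 1), ((j : ℚ) + x)) *
      ∑ k ∈ Finset.range (m + 1), legendreCoeff m k / ((k : ℚ) + x) =
    ∏ j ∈ Finset.range m, ((j : ℚ) + 1 - x) := by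
  induction m with
  | zero =>
    have := hx 0
    simp only [Nat.cast_zero, zero_add] at this
    simp [legendreCoeff, this]
  | succ m ih =>
    rw [Finset.prod_range_succ _ (m + 1), Finset.prod_range_succ (fun j : ℕ => (j : ℚ) + 1 - x),
      ← ih, mul_assoc, mul_assoc]
    congr 1
    have h0 : ∑ k ∈ Finset.range (m + 1), legendreCoeff m k / ((k : ℚ) + x) =
        ∑ k ∈ Finset.range (m + 1 + 1), legendreCoeff m k / ((k : ℚ) + x) := by
      rw [Finset.sum_range_succ _ (m + 1)]
      simp [legendreCoeff]
    rw [h0, ← sub_eq_zero, Finset.mul_sum, mul_comm (∑ k ∈ _, _), Finset.mul_sum,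
      ← Finset.sum_sub_distrib]
    have h1 := alternating_sum_choose_mul_choose m (m + 1)
    rw [Nat.choose_succ_self, Nat.cast_zero, mul_zero, zero_mul] at h1
    rw [← mul_zero 2, ← h1, Finset.mul_sum]
    refine Finset.sum_congr rfl fun k hk => ?_
    have h2 := legendreCoeff_succ_left m k (by have := Finset.mem_range.1 hk; lia) x
    have := hx k
    push_cast
    field_simp
    linear_combination h2

lemma prod_mul_sum_legendreCoeff_div_three (m : ℕ) :
    (∏ j ∈ Finset.range (m + 1), (3 * (j : ℚ) + 1)) *
      ∑ k ∈ Finset.range (m + 1), legendreCoeff m k / (3 * (k : ℚ) + 1) =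
    ∏ j ∈ Finset.range m, (3 * (j : ℚ) + 2) := by
  have h := prod_mul_sum_legendreCoeff_div (1 / 3) (fun j => by positivity) m
  have e1 : ∏ j ∈ Finset.range (m + 1), (3 * (j : ℚ) + 1) =
      3 ^ (m + 1) * ∏ j ∈ Finset.range (m + 1), ((j : ℚ) + 1 / 3) := by
    conv_rhs => rw [← Finset.card_range (m + 1), ← Finset.prod_const, Finset.card_range,
      ← Finset.prod_mul_distrib]
    exact Finset.prod_congr rfl fun j _ => by ring
  have e2 : ∏ j ∈ Finset.range m, (3 * (j : ℚ) + 2) =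
      3 ^ m * ∏ j ∈ Finset.range m, ((j : ℚ) + 1 - 1 / 3) := by
    conv_rhs => rw [← Finset.card_range m, ← Finset.prod_const, Finset.card_range,
      ← Finset.prod_mul_distrib]
    exact Finset.prod_congr rfl fun j _ => by ring
  have e3 : ∑ k ∈ Finset.range (m + 1), legendreCoeff m k / ((k : ℚ) + 1 / 3) =
      3 * ∑ k ∈ Finset.range (m + 1), legendreCoeff m k / (3 * (k : ℚ) + 1) := by
    rw [Finset.mul_sum]
    refine Finset.sum_congr rfl fun k _ => ?_
    have : 3 * (k : ℚ) + 1 ≠ 0 := by positivity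
    have : (k : ℚ) + 1 / 3 ≠ 0 := by positivity
    field_simp
  rw [e3] at h
  rw [e1, e2, ← h]
  ring

lemma sum_trinomialCoeff_of_lt {p : ℕ} [hp : Fact p.Prime] {m n : ℕ}
    (hm : 3 * m + 1 = p ∨ 3 * m + 2 = p) (hn : n ≤ m + 1) (hlt : 3 * n < p + 2) :
    pCong p 2 (∑ k ∈ Finset.range n, trinomialCoeff k * ((p : ℚ) / (3 * (k : ℚ) + 1)))
      (p * ∑ k ∈ Finset.range n, legendreCoeff m k / (3 * (k : ℚ) + 1)) := by
  rw [Finset.mul_sum]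
  refine pCong_sum fun k hk => ?_
  rw [Finset.mem_range] at hk
  convert (pCong_trinomialCoeff_legendreCoeff hm (k := k) (by lia)).prime_mul.mul_left
    (inv_three_mul_add_one_mem (p := p) (k := k) (by lia)) using 1
  · ring
  · ring

/-- A half of Wilson's theorem. -/
lemma factorial_mul_factorial_eq {p : ℕ} [hp : Fact p.Prime] {m : ℕ} (hm : m < p) :
    ((m.factorial : ZMod p)) * ((p - 1 - m).factorial : ZMod p) = -(-1) ^ m := by
  have h1 : ((p - 1).choose m : ZMod p) = (-1) ^ m := by
    have := dvd_choose_prime_sub_one hp.out hm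
    rw [← ZMod.intCast_zmod_eq_zero_iff_dvd] at this
    push_cast at this
    exact sub_eq_zero.1 this
  have h2 := Nat.choose_mul_factorial_mul_factorial (show m ≤ p - 1 by lia)
  have h3 : (((p - 1).choose m * m.factorial * (p - 1 - m).factorial : ℕ) : ZMod p) = -1 := by
    rw [h2, ZMod.wilsons_lemma]
  push_cast at h3
  rw [h1] at h3
  have e1 : ((-1 : ZMod p) ^ m) * (-1) ^ m = 1 := by rw [← mul_pow]; norm_num
  linear_combination (-1) ^ m * h3 - (m.factorial : ZMod p) * (p - 1 - m).factorial * e1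

lemma dvd_prod_of_three_mul_add_two {p : ℕ} [hp : Fact p.Prime] {m : ℕ} (hm : 3 * m + 2 = p) :
    (p : ℤ) ∣ 3 * ∏ j ∈ Finset.range m, (3 * (j : ℤ) + 2) -
      -((m.factorial : ℤ) ^ 3 * ∏ j ∈ Finset.range (m + 1), (3 * (j : ℤ) + 1)) := by
  rw [← ZMod.intCast_zmod_eq_zero_iff_dvd]
  push_cast
  have hm0 : (3 : ZMod p) * m + 2 = 0 := by
    have : ((3 * m + 2 : ℕ) : ZMod p) = 0 := by rw [hm]; simp
    exact_mod_cast this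
  have e1 : ∏ j ∈ Finset.range m, (3 * (j : ZMod p) + 2) = (-3) ^ m * m.factorial := by
    rw [← Finset.prod_range_reflect, ← Finset.prod_range_add_one_eq_factorial, Nat.cast_prod]
    conv_rhs => rw [← Finset.card_range m, ← Finset.prod_const, Finset.card_range,
      ← Finset.prod_mul_distrib]
    refine Finset.prod_congr rfl fun j hj => ?_
    rw [Finset.mem_range] at hj
    rw [Nat.sub_sub, Nat.cast_sub (by lia)]
    push_cast
    linear_combination hm0
  have e2 : ∏ j ∈ Finset.range (m + 1), (3 * (j : ZMod p) + 1) =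
      3 ^ (m + 1) * ((m + 1).ascFactorial (m + 1) : ℕ) := by
    rw [Nat.ascFactorial_eq_prod_range, Nat.cast_prod]
    conv_rhs => rw [← Finset.card_range (m + 1), ← Finset.prod_const, Finset.card_range,
      ← Finset.prod_mul_distrib]
    refine Finset.prod_congr rfl fun j hj => ?_
    push_cast
    linear_combination -hm0
  have e3 := Nat.factorial_mul_ascFactorial m (m + 1)
  have e4 := factorial_mul_factorial_eq (p := p) (m := m) (by lia)
  rw [show p - 1 - m = m + (m + 1) by lia, ← e3] at e4
  push_cast at e4
  rw [e1, e2, neg_pow (3 : ZMod p) m]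
  linear_combination (m.factorial : ZMod p) * 3 ^ (m + 1) * e4

lemma prod_three_mul_add_one_mem {p : ℕ} [hp : Fact p.Prime] {n : ℕ} (hn : 3 * n < p + 2) :
    (∏ j ∈ Finset.range n, (3 * (j : ℚ) + 1))⁻¹ ∈ pIntSubring p := by
  rw [← Finset.prod_inv_distrib]
  refine prod_mem fun j hj => inv_three_mul_add_one_mem ?_
  have := Finset.mem_range.1 hj
  lia

lemma pCong_sum_trinomialCoeff_of_mod_two {p : ℕ} [hp : Fact p.Prime] (hp3 : 3 < p) {m : ℕ}
    (hm : 3 * m + 2 = p) :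
    pCong p 2 (∑ k ∈ Finset.range (m + 1), trinomialCoeff k * ((p : ℚ) / (3 * (k : ℚ) + 1)))
      (-((p : ℚ) / 3) * (m.factorial : ℚ) ^ 3) := by
  refine (sum_trinomialCoeff_of_lt (Or.inr hm) le_rfl (by lia)).trans ?_
  rw [show -((p : ℚ) / 3) * (m.factorial : ℚ) ^ 3 = p * (-(1 / 3) * (m.factorial : ℚ) ^ 3) by ring]
  have hA0 : (∏ j ∈ Finset.range (m + 1), (3 * (j : ℚ) + 1)) ≠ 0 :=
    Finset.prod_ne_zero_iff.2 fun j _ => by positivity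
  refine pCong.prime_mul (k := 1) (pCong.of_mul_left
    (c := 3 * ∏ j ∈ Finset.range (m + 1), (3 * (j : ℚ) + 1)) ?_ (by simpa using hA0) ?_)
  · rw [mul_inv]
    exact mul_mem (inv_three_mem_pIntSubring hp3) (prod_three_mul_add_one_mem (by lia))
  · rw [mul_assoc, prod_mul_sum_legendreCoeff_div_three]
    have := pCong_of_dvd (p := p) (k := 1) (by
      rw [pow_one]; exact dvd_prod_of_three_mul_add_two hm)
    convert this using 1
    · push_cast; ring
    · push_cast; ring

/-- If `p = 3m + 1`, then shifting `(m+1)⋯(2m)` by multiples of `p` does not change it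
modulo `p²`. -/
lemma sq_dvd_prod_sub_prod {p : ℕ} (hp : p.Prime) {m : ℕ} (hm : 3 * m + 1 = p) (hp3 : 3 < p)
    {c : ℤ} (hc : ¬ (p : ℤ) ∣ c) (t : ℤ) :
    (p : ℤ) ^ 2 ∣ ∏ i ∈ Finset.range m, (c * (m + 1 + i) + t * p) -
      ∏ i ∈ Finset.range m, (c * ((m : ℤ) + 1 + i)) := by
  set f : ℕ → ℤ := fun i => c * (m + 1 + i) + t * p with hf
  set g : ℕ → ℤ := fun i => c * (m + 1 + i) with hg
  have hpz : Prime (p : ℤ) := Nat.prime_iff_prime_int.1 hp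
  have hpm : (p : ℤ) = 3 * m + 1 := by exact_mod_cast hm.symm
  have h1 : ∏ i ∈ Finset.range m, f i ≡ ∏ i ∈ Finset.range m, g i [ZMOD p] := by
    refine Int.ModEq.prod fun i _ => ?_
    exact Int.modEq_iff_dvd.2 ⟨-t, by simp only [hf, hg]; ring⟩
  have h2 : (∏ i ∈ Finset.range m, f i) * ∏ i ∈ Finset.range m, f i ≡
      (∏ i ∈ Finset.range m, g i) * ∏ i ∈ Finset.range m, g i [ZMOD (p : ℤ) ^ 2] := by
    nth_rewrite 1 [← Finset.prod_range_reflect f]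
    nth_rewrite 1 [← Finset.prod_range_reflect g]
    rw [← Finset.prod_mul_distrib, ← Finset.prod_mul_distrib]
    refine Int.ModEq.prod fun i hi => ?_
    have hi := Finset.mem_range.1 hi
    refine Int.modEq_iff_dvd.2 ⟨-(t * c + t ^ 2), ?_⟩
    simp only [hf, hg]
    rw [Nat.sub_sub, Nat.cast_sub (by lia)]
    push_cast
    linear_combination t * c * p * hpm
  have h3 : ¬ (p : ℤ) ∣ ∏ i ∈ Finset.range m, f i + ∏ i ∈ Finset.range m, g i := by
    intro h
    have h4 : (p : ℤ) ∣ 2 * ∏ i ∈ Finset.range m, g i := by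
      have := dvd_add h (Int.modEq_iff_dvd.1 h1)
      rwa [show ∏ i ∈ Finset.range m, f i + ∏ i ∈ Finset.range m, g i +
        (∏ i ∈ Finset.range m, g i - ∏ i ∈ Finset.range m, f i) =
          2 * ∏ i ∈ Finset.range m, g i by ring] at this
    rcases hpz.dvd_or_dvd h4 with h5 | h5
    · have := Int.le_of_dvd (by norm_num) h5
      lia
    · obtain ⟨i, hi, h6⟩ := (hpz.dvd_finsetProd_iff g).1 h5
      rcases hpz.dvd_or_dvd h6 with h7 | h7
      · exact hc h7
      · have := Int.le_of_dvd (by positivity) h7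
        have hi := Finset.mem_range.1 hi
        lia
  have h7 : IsCoprime ((p : ℤ) ^ 2) (∏ i ∈ Finset.range m, f i + ∏ i ∈ Finset.range m, g i) :=
    ((hpz.coprime_iff_not_dvd).2 h3).pow_left
  refine h7.dvd_of_dvd_mul_right ?_
  rw [mul_comm, ← mul_self_sub_mul_self]
  exact Int.modEq_iff_dvd.1 h2.symm

lemma prod_range_eq_factorial_mul_choose (m n : ℕ) :
    ∏ i ∈ Finset.range m, ((n : ℤ) + 1 + i) = m.factorial * (n + m).choose m := by
  have h := Nat.ascFactorial_eq_factorial_mul_choose n m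
  rw [Nat.ascFactorial_eq_prod_range] at h
  exact_mod_cast h

lemma trinomialCoeff_mul_sq (m : ℕ) : trinomialCoeff m * (3 ^ m * (m.factorial : ℚ)) ^ 2 =
    (∏ j ∈ Finset.range m, (3 * (j : ℚ) + 1)) * ∏ j ∈ Finset.range m, (3 * (j : ℚ) + 2) := by
  induction m with
  | zero => simp [trinomialCoeff]
  | succ m ih =>
    rw [Finset.prod_range_succ, Finset.prod_range_succ, Nat.factorial_succ]
    push_cast
    linear_combination (3 * (m : ℚ) + 1) * (3 * m + 2) * ih +
      (3 ^ m * (m.factorial : ℚ)) ^ 2 * trinomialCoeff_succ m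

lemma dvd_prod_of_three_mul_add_one {p : ℕ} {m : ℕ} (hm : 3 * m + 1 = p) :
    (p : ℤ) ∣ ∏ j ∈ Finset.range m, (3 * (j : ℤ) + 1) - (-3) ^ m * m.factorial := by
  refine Int.ModEq.dvd ?_
  rw [← Finset.prod_range_add_one_eq_factorial, Nat.cast_prod]
  conv_lhs => rw [← Finset.card_range m, ← Finset.prod_const, Finset.card_range,
    ← Finset.prod_mul_distrib]
  rw [← Finset.prod_range_reflect]
  refine Int.ModEq.prod fun j hj => Int.modEq_iff_dvd.2 ⟨1, ?_⟩
  rw [Finset.mem_range] at hj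
  rw [Nat.sub_sub, ← hm]
  push_cast [Nat.cast_sub (show 1 + j ≤ m by lia)]
  ring

lemma pCong_sum_trinomialCoeff_of_mod_one {p : ℕ} [hp : Fact p.Prime] (hp3 : 3 < p) {m : ℕ}
    (hm : 3 * m + 1 = p) :
    pCong p 2 (∑ k ∈ Finset.range (m + 1), trinomialCoeff k * ((p : ℚ) / (3 * (k : ℚ) + 1)))
      ((2 * m).choose m : ℚ) := by
  have hodd : p % 2 = 1 := hp.out.eq_two_or_odd.resolve_left (by lia)
  have hme : Even m := by rw [Nat.even_iff]; lia
  have hpm : (p : ℚ) = 3 * m + 1 := by exact_mod_cast hm.symm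
  set A := ∏ j ∈ Finset.range m, (3 * (j : ℚ) + 1) with hA
  set B := ∏ j ∈ Finset.range m, (3 * (j : ℚ) + 2) with hB
  set C := ((2 * m).choose m : ℚ) with hC
  set D := 3 ^ m * (m.factorial : ℚ) with hD
  have hA0 : A ≠ 0 := Finset.prod_ne_zero_iff.2 fun j _ => by positivity
  have hAm : A⁻¹ ∈ pIntSubring p := prod_three_mul_add_one_mem (by lia)
  have hD0 : D ≠ 0 := by positivity
  have hDm : D⁻¹ ∈ pIntSubring p := by
    rw [hD, mul_inv, ← inv_pow]
    exact mul_mem (pow_mem (inv_three_mem_pIntSubring hp3) _)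
      (inv_natCast_mem_pIntSubring fun h => by have := (hp.out.dvd_factorial).1 h; lia)
  have hAD : pCong p 1 A D := by
    have h1 := pCong_of_dvd (p := p) (k := 1) (by
      rw [pow_one]; exact dvd_prod_of_three_mul_add_one hm)
    rw [hme.neg_pow] at h1
    convert h1 using 1
    · push_cast; rfl
    · push_cast; rfl
  have hBD : pCong p 2 B (D * C) := by
    have h1 := sq_dvd_prod_sub_prod hp.out hm hp3 (c := 3) (fun h => by
      have := Int.le_of_dvd (by norm_num) h; lia) (-1)
    have h2 := pCong_of_dvd h1
    convert h2 using 1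
    · rw [hB]
      push_cast
      refine Finset.prod_congr rfl fun i _ => ?_
      rw [hpm]; ring
    · rw [Finset.prod_mul_distrib, prod_range_eq_factorial_mul_choose, Finset.prod_const,
        Finset.card_range, hD, hC, two_mul]
      push_cast
      ring
  have hT : trinomialCoeff m * D ^ 2 = A * B := trinomialCoeff_mul_sq m
  have hU : legendreCoeff m m = C := by
    rw [legendreCoeff, hme.neg_one_pow, Nat.choose_self, hC, two_mul]; simp
  have hS : p * ∑ k ∈ Finset.range (m + 1), legendreCoeff m k / (3 * (k : ℚ) + 1) = B / A := by
    have h := prod_mul_sum_legendreCoeff_div_three m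
    rw [Finset.prod_range_succ, ← hpm, ← hA, ← hB] at h
    rw [← h]
    field_simp
  rw [Finset.sum_range_succ, mul_add, hU, ← hpm] at hS
  have hp0 : (p : ℚ) ≠ 0 := by exact_mod_cast hp.out.ne_zero
  rw [mul_div_cancel₀ _ hp0] at hS
  rw [Finset.sum_range_succ, ← hpm, div_self hp0, mul_one]
  refine ((sum_trinomialCoeff_of_lt (Or.inl hm) (by lia) (by lia)).add
    (pCong_refl (trinomialCoeff m))).trans ?_
  obtain ⟨y, hy, hAy⟩ := pCong_iff.1 hAD
  obtain ⟨z, hz, hBz⟩ := pCong_iff.1 hBD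
  have hAS : A ∈ pIntSubring p := prod_mem fun j _ => by
    exact_mod_cast natCast_mem (pIntSubring p) (3 * j + 1)
  have hDS : D ∈ pIntSubring p := by
    rw [hD]
    exact_mod_cast natCast_mem (pIntSubring p) (3 ^ m * m.factorial)
  have hCS : C ∈ pIntSubring p := natCast_mem _ _
  refine pCong_iff.2 ⟨(D * C * y ^ 2 + z * (D ^ 2 + A ^ 2)) * (A⁻¹ * D⁻¹ ^ 2),
    mul_mem (add_mem (mul_mem (mul_mem hDS hCS) (pow_mem hy 2)) (mul_mem hz (add_mem
      (pow_mem hDS 2) (pow_mem hAS 2)))) (mul_mem hAm (pow_mem hDm 2)), ?_⟩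
  rw [eq_sub_of_add_eq hS, eq_div_of_mul_eq (pow_ne_zero 2 hD0) hT]
  field_simp
  rw [eq_add_of_sub_eq hBz]
  linear_combination C * D * (A - D + p * y) * hAy

lemma choose_two_mul_not_dvd {p : ℕ} (hp : p.Prime) {m : ℕ} (hm : 2 * m < p) :
    ¬ p ∣ (2 * m).choose m := fun h => by
  have h1 := Nat.choose_mul_factorial_mul_factorial (show m ≤ 2 * m by lia)
  have h2 : p ∣ (2 * m).factorial := h1 ▸ ((h.mul_right _).mul_right _)
  have := hp.dvd_factorial.1 h2
  lia

lemma sq_dvd_choose_combination {p : ℕ} (hp : p.Prime) (hp3 : 3 < p) {m : ℕ}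
    (hm : 3 * m + 1 = p) :
    (p : ℤ) ^ 2 ∣ ((p : ℤ) - 1) * ((1 - 2 * m) * (2 * m).choose m + 4 * m * (5 * m).choose m) +
      (2 * m).choose m := by
  have hpz : Prime (p : ℤ) := Nat.prime_iff_prime_int.1 hp
  have hpm : (p : ℤ) = 3 * m + 1 := by exact_mod_cast hm.symm
  have h1 := sq_dvd_prod_sub_prod hp hm hp3 (c := 1)
    (fun h => by have := Int.le_of_dvd (by norm_num) h; lia) 1
  have e1 : ∏ i ∈ Finset.range m, ((1 : ℤ) * (m + 1 + i) + 1 * p) =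
      m.factorial * (5 * m + 1).choose m := by
    have := prod_range_eq_factorial_mul_choose m (4 * m + 1)
    rw [show 4 * m + 1 + m = 5 * m + 1 by ring] at this
    rw [← this]
    refine Finset.prod_congr rfl fun i _ => ?_
    push_cast
    rw [hpm]
    ring
  have e2 : ∏ i ∈ Finset.range m, ((1 : ℤ) * (m + 1 + i)) = m.factorial * (2 * m).choose m := by
    have := prod_range_eq_factorial_mul_choose m m
    rw [← two_mul] at this
    rw [← this]
    simp
  rw [e1, e2, ← mul_sub] at h1
  have hf : ¬ (p : ℤ) ∣ m.factorial := by
    norm_cast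
    intro h
    have := hp.dvd_factorial.1 h
    lia
  have h2 := ((hpz.coprime_iff_not_dvd.2 hf).pow_left (m := 2)).dvd_of_dvd_mul_left h1
  have h3 : ((5 * m).choose m : ℤ) * (5 * m + 1) = (5 * m + 1).choose m * (4 * m + 1) := by
    have := Nat.choose_mul_succ_eq (5 * m) m
    rw [show 5 * m + 1 - m = 4 * m + 1 by lia] at this
    exact_mod_cast this
  have h5 : ¬ (p : ℤ) ∣ 5 * m + 1 := fun h => by
    have h6 : (p : ℤ) ∣ 2 * m := by
      have := dvd_sub h (dvd_refl (p : ℤ))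
      rwa [show (5 * m + 1 : ℤ) - p = 2 * m by rw [hpm]; ring] at this
    have := Int.le_of_dvd (by lia) h6
    lia
  refine ((hpz.coprime_iff_not_dvd.2 h5).pow_left (m := 2)).dvd_of_dvd_mul_left ?_
  have h7 := (h2.mul_left (3 * m * 4 * m * (4 * m + 1))).add
    (dvd_mul_right ((p : ℤ) ^ 2) ((2 * m).choose m * (2 * m + 1)))
  convert h7 using 1
  rw [hpm]
  linear_combination 12 * (m : ℤ) ^ 2 * h3

lemma sq_dvd_one_add_pow_sub {R : Type*} [CommRing R] (y : R) (n : ℕ) :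
    y ^ 2 ∣ (1 + y) ^ n - (1 + n * y) := by
  induction n with
  | zero => simp
  | succ n ih =>
    obtain ⟨c, hc⟩ := ih
    refine ⟨c * (1 + y) + n, ?_⟩
    push_cast
    linear_combination (1 + y) * hc

/-- Interpolation of the Teichmüller representative `v` of `u` by powers of `u`. -/
lemma sq_dvd_pow_sub_interpolation {R : Type*} [CommRing R] {p m : ℕ} (hm : 3 * m + 1 = p)
    {u v : R} (h : (p : R) ∣ u - v) (hv : v ^ (3 * m) = 1) :
    (p : R) ^ 2 ∣ v ^ (2 * m) - ((1 - 2 * m) * u ^ (2 * m) + 2 * m * u ^ (5 * m)) := by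
  obtain ⟨s, hs⟩ : (p : R) ∣ u ^ (3 * m) - 1 := hv ▸ h.trans (sub_dvd_pow_sub_pow _ _ _)
  have h1 : (p : R) ^ 2 ∣ u ^ p - v ^ p := by simpa using dvd_sub_pow_of_dvd_sub h 1
  have hvp : v ^ p = v := by rw [← hm, pow_succ, hv, one_mul]
  have hup : u ^ p = u * (1 + p * s) := by
    rw [show u ^ p = u ^ (3 * m) * u by rw [← pow_succ, hm]]
    linear_combination u * hs
  rw [hvp, hup] at h1
  have h2 := h1.trans (sub_dvd_pow_sub_pow _ _ (2 * m))
  have h3 := (Dvd.intro _ (mul_pow (p : R) s 2).symm).trans (sq_dvd_one_add_pow_sub (p * s) (2 * m))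
  have h4 := dvd_sub (h3.mul_left (u ^ (2 * m))) h2
  convert h4 using 1
  rw [mul_pow, show 5 * m = 2 * m + 3 * m by ring, pow_add]
  push_cast
  linear_combination -2 * (m : R) * u ^ (2 * m) * hs

section Teichmuller

variable (p : ℕ) [hp : Fact p.Prime]

/-- The Teichmüller character of `ZMod p` with values in `ℤ_[p]`. -/
noncomputable def teichmullerChar : MulChar (ZMod p) ℤ_[p] where
  toMonoidHom := ((WittVector.equiv p).toRingHom : WittVector p (ZMod p) →* ℤ_[p]).comp
    (WittVector.teichmuller p)
  map_nonunit' a ha := by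
    have : a = 0 := by simpa [isUnit_iff_ne_zero] using ha
    simp [this]

lemma teichmullerChar_apply (x : ZMod p) :
    teichmullerChar p x = WittVector.equiv p (WittVector.teichmuller p x) := rfl

lemma toZMod_teichmullerChar (x : ZMod p) : PadicInt.toZMod (teichmullerChar p x) = x := by
  have h (w : WittVector p (ZMod p)) :
      PadicInt.toZMod (WittVector.equiv p w) = WittVector.constantCoeff w := by
    obtain ⟨n, -, hn⟩ := PadicInt.exists_mem_range (WittVector.equiv p w)
    rw [PadicInt.maximalIdeal_eq_span_p, Ideal.mem_span_singleton] at hn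
    obtain ⟨y, hy⟩ := hn
    rw [sub_eq_iff_eq_add] at hy
    have hw : w = p * (WittVector.equiv p).symm y + n := by
      apply (WittVector.equiv p).injective
      simp [hy]
    rw [hy, hw, map_add, map_add, map_mul, map_mul, map_natCast, map_natCast, map_natCast,
      map_natCast, CharP.cast_eq_zero, zero_mul, zero_mul]
  rw [teichmullerChar_apply, h]
  simp [WittVector.constantCoeff_apply]

variable {p}

lemma toZMod_eq_iff {x y : ℤ_[p]} :
    PadicInt.toZMod x = PadicInt.toZMod y ↔ (p : ℤ_[p]) ∣ x - y := by
  rw [← sub_eq_zero, ← map_sub, ← RingHom.mem_ker, PadicInt.ker_toZMod,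
    PadicInt.maximalIdeal_eq_span_p, Ideal.mem_span_singleton]

lemma teichmullerChar_pow_eq_one_iff {n : ℕ} : teichmullerChar p ^ n = 1 ↔ p - 1 ∣ n := by
  have hF := FiniteField.forall_pow_eq_one_iff (ZMod p) n
  rw [ZMod.card] at hF
  rw [← hF]
  constructor
  · intro h x
    have h1 := congrArg (fun χ : MulChar (ZMod p) ℤ_[p] => PadicInt.toZMod (χ x)) h
    simp only [MulChar.pow_apply_coe, MulChar.one_apply_coe, map_pow, toZMod_teichmullerChar,
      map_one] at h1
    exact Units.ext (by simpa using h1)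
  · intro h
    ext x
    rw [MulChar.pow_apply_coe, MulChar.one_apply_coe, ← map_pow]
    have := h x
    rw [← Units.val_pow_eq_pow_val, this, Units.val_one, map_one]

lemma sum_teichmullerChar_pow {n : ℕ} (hn : n ≠ 0) :
    ∑ x, teichmullerChar p x ^ n = if p - 1 ∣ n then (p : ℤ_[p]) - 1 else 0 := by
  simp_rw [← MulChar.pow_apply' _ hn]
  split_ifs with h
  · rw [teichmullerChar_pow_eq_one_iff.2 h, MulChar.sum_one_eq_card_units, ZMod.card_units,
      Nat.cast_sub hp.out.one_le, Nat.cast_one]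
  · exact MulChar.sum_eq_zero_of_ne_one (fun h' => h (teichmullerChar_pow_eq_one_iff.1 h'))

lemma sum_teichmullerChar_pow_mul {a : ℕ} (ha : a ≠ 0) (N : ℕ) :
    ∑ x, teichmullerChar p x ^ a * (1 - teichmullerChar p x) ^ N =
      ((p : ℤ_[p]) - 1) * ∑ j ∈ (Finset.range (N + 1)).filter (fun j => p - 1 ∣ a + j),
        (-1) ^ j * (N.choose j : ℤ_[p]) := by
  have h (x : ZMod p) : teichmullerChar p x ^ a * (1 - teichmullerChar p x) ^ N =
      ∑ j ∈ Finset.range (N + 1),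
        (-1) ^ j * (N.choose j : ℤ_[p]) * teichmullerChar p x ^ (a + j) := by
    rw [sub_eq_neg_add, add_pow, Finset.mul_sum]
    refine Finset.sum_congr rfl fun j _ => ?_
    rw [neg_pow, one_pow]
    ring
  simp_rw [h]
  rw [Finset.sum_comm, Finset.mul_sum, Finset.sum_filter]
  refine Finset.sum_congr rfl fun j _ => ?_
  rw [← Finset.mul_sum, sum_teichmullerChar_pow (by lia)]
  split_ifs <;> ring

lemma teichmullerChar_pow_eq_one {x : ZMod p} (hx : x ≠ 0) {n : ℕ} (hn : p - 1 ∣ n) :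
    teichmullerChar p x ^ n = 1 := by
  obtain ⟨k, rfl⟩ := hn
  rw [← map_pow, pow_mul, ZMod.pow_card_sub_one_eq_one hx, one_pow, map_one]

lemma jacobiSum_teichmullerChar {m : ℕ} (hm0 : m ≠ 0) (hm : 3 * m + 1 = p) :
    (p : ℤ_[p]) ^ 2 ∣ jacobiSum (teichmullerChar p ^ (2 * m)) (teichmullerChar p ^ (2 * m)) -
      ((p : ℤ_[p]) - 1) * ((1 - 2 * m) * (2 * m).choose m + 4 * m * (5 * m).choose m) := by
  have hm2 : 2 * m ≠ 0 := by lia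
  have hodd : p % 2 = 1 := hp.out.eq_two_or_odd.resolve_left (by lia)
  have hme : Even m := by rw [Nat.even_iff]; lia
  have hp1 : p - 1 = 3 * m := by lia
  have h1 := sum_teichmullerChar_pow_mul (p := p) hm2 (2 * m)
  have h2 := sum_teichmullerChar_pow_mul (p := p) hm2 (5 * m)
  have f1 : (Finset.range (2 * m + 1)).filter (fun j => p - 1 ∣ 2 * m + j) = {m} := by
    ext j
    simp only [Finset.mem_filter, Finset.mem_range, Finset.mem_singleton, hp1]
    constructor
    · rintro ⟨h, q, hq⟩
      have : q < 2 := by by_contra! h'; have := Nat.mul_le_mul_left (3 * m) h'; lia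
      interval_cases q <;> lia
    · rintro rfl
      exact ⟨by lia, 1, by ring⟩
  have f2 : (Finset.range (5 * m + 1)).filter (fun j => p - 1 ∣ 2 * m + j) = {m, 4 * m} := by
    ext j
    simp only [Finset.mem_filter, Finset.mem_range, Finset.mem_singleton, Finset.mem_insert, hp1]
    constructor
    · rintro ⟨h, q, hq⟩
      have : q < 3 := by by_contra! h'; have := Nat.mul_le_mul_left (3 * m) h'; lia
      interval_cases q <;> lia
    · rintro (rfl | rfl)
      · exact ⟨by lia, 1, by ring⟩
      · exact ⟨by lia, 2, by ring⟩
  have hc : (5 * m).choose (4 * m) = (5 * m).choose m :=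
    Nat.choose_symm_of_eq_add (by ring)
  rw [f1, Finset.sum_singleton, hme.neg_one_pow] at h1
  rw [f2, Finset.sum_pair (by lia), hme.neg_one_pow, (hme.mul_left 4).neg_one_pow, hc] at h2
  have h3 : ((p : ℤ_[p]) - 1) * ((1 - 2 * m) * (2 * m).choose m + 4 * m * (5 * m).choose m) =
      ∑ x, teichmullerChar p x ^ (2 * m) * ((1 - 2 * m) * (1 - teichmullerChar p x) ^ (2 * m) +
        2 * m * (1 - teichmullerChar p x) ^ (5 * m)) := by
    have : ∀ x, teichmullerChar p x ^ (2 * m) *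
        ((1 - 2 * m) * (1 - teichmullerChar p x) ^ (2 * m) +
          2 * m * (1 - teichmullerChar p x) ^ (5 * m)) =
        (1 - 2 * m) * (teichmullerChar p x ^ (2 * m) * (1 - teichmullerChar p x) ^ (2 * m)) +
        2 * m * (teichmullerChar p x ^ (2 * m) * (1 - teichmullerChar p x) ^ (5 * m)) :=
      fun x => by ring
    simp_rw [this]
    rw [Finset.sum_add_distrib, ← Finset.mul_sum, ← Finset.mul_sum, h1, h2]
    ring
  rw [h3, jacobiSum, ← Finset.sum_sub_distrib]
  refine Finset.dvd_sum fun x _ => ?_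
  rw [MulChar.pow_apply' _ hm2, MulChar.pow_apply' _ hm2, ← mul_sub]
  refine Dvd.dvd.mul_left ?_ _
  rcases eq_or_ne x 1 with rfl | hx
  · simp [hm0, MulChar.map_zero]
  · refine sq_dvd_pow_sub_interpolation hm (toZMod_eq_iff.1 ?_) (teichmullerChar_pow_eq_one
      (sub_ne_zero.2 hx.symm) (by rw [hp1]))
    simp [toZMod_teichmullerChar]

end Teichmuller

section CubicJacobiSum

lemma exists_int_of_mem_adjoin {R : Type*} [CommRing R] {v x : R} (hv : v ^ 2 + v + 1 = 0)
    (hx : x ∈ Algebra.adjoin ℤ {v}) : ∃ a b : ℤ, x = a + b * v := by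
  induction hx using Algebra.adjoin_induction with
  | mem x hx => exact ⟨0, 1, by simp [Set.mem_singleton_iff.1 hx]⟩
  | algebraMap r => exact ⟨r, 0, by simp⟩
  | add x y _ _ ihx ihy =>
    obtain ⟨a, b, rfl⟩ := ihx
    obtain ⟨c, d, rfl⟩ := ihy
    exact ⟨a + c, b + d, by push_cast; ring⟩
  | mul x y _ _ ihx ihy =>
    obtain ⟨a, b, rfl⟩ := ihx
    obtain ⟨c, d, rfl⟩ := ihy
    exact ⟨a * c - b * d, a * d + b * c - b * d, by push_cast; linear_combination b * d * hv⟩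

lemma IsPrimitiveRoot.sq_add_self_add_one {R : Type*} [CommRing R] [IsDomain R] {μ : R}
    (hμ : IsPrimitiveRoot μ 3) :
    μ ^ 2 + μ + 1 = 0 := by
  have := hμ.geom_sum_eq_zero (by norm_num)
  simp only [Finset.sum_range_succ, Finset.sum_range_zero] at this
  linear_combination this

lemma eq_of_add_mul_eq {R : Type*} [CommRing R] [CharZero R] {μ : R} (hμ : μ ^ 2 + μ + 1 = 0)
    {a b c d : ℤ} (h : (a + b * μ : R) = c + d * μ) : a = c ∧ b = d := by
  have h1 : ((a - c) ^ 2 - (a - c) * (b - d) + (b - d) ^ 2 : ℤ) = 0 := by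
    apply Int.cast_injective (α := R)
    push_cast
    linear_combination (a - c - (b - d) * (μ + 1)) * h + (b - d : R) ^ 2 * hμ
  constructor <;> nlinarith [sq_nonneg (a - c + (b - d)), sq_nonneg (a - c - (b - d))]

variable {R : Type*} [CommRing R] [IsDomain R] {p : ℕ} [hp : Fact p.Prime]

lemma exists_jacobiSum_eq_and_sq_eq {χ : MulChar (ZMod p) R} (hχ : χ ^ 3 = 1) {μ : R}
    (hμ : IsPrimitiveRoot μ 3) : ∃ a b : ℤ, jacobiSum χ χ = a + b * μ ∧
      jacobiSum (χ ^ 2) (χ ^ 2) = a + b * μ ^ 2 := by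
  have hμ0 := hμ.sq_add_self_add_one
  have h (x : ZMod p) : ((χ x, (χ ^ 2) x) : R × R) ∈ Algebra.adjoin ℤ {(μ, μ ^ 2)} := by
    rw [MulChar.pow_apply' _ two_ne_zero]
    rcases eq_or_ne x 0 with rfl | hx
    · rw [MulChar.map_zero, zero_pow two_ne_zero]
      exact Subalgebra.zero_mem _
    · obtain ⟨k, -, hk⟩ := MulChar.exists_apply_eq_pow hχ hμ hx
      have := Subalgebra.pow_mem _ (Algebra.self_mem_adjoin_singleton ℤ (μ, μ ^ 2)) k
      rwa [Prod.pow_mk, ← hk, ← pow_mul, mul_comm, pow_mul, ← hk] at this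
  have hJ : ((jacobiSum χ χ, jacobiSum (χ ^ 2) (χ ^ 2)) : R × R) ∈
      Algebra.adjoin ℤ {(μ, μ ^ 2)} := by
    have := Subalgebra.sum_mem _ fun x (_ : x ∈ Finset.univ) =>
      Subalgebra.mul_mem _ (h x) (h (1 - x))
    convert this using 1
    ext <;> simp [jacobiSum, Prod.fst_sum, Prod.snd_sum]
  obtain ⟨a, b, hab⟩ := exists_int_of_mem_adjoin
    (Prod.ext (by simpa using hμ0) (by simp; linear_combination (μ ^ 2 - μ + 1) * hμ0)) hJ
  exact ⟨a, b, by simpa using congrArg Prod.fst hab, by simpa using congrArg Prod.snd hab⟩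

lemma jacobiSum_mul_jacobiSum_sq [CharZero R] {χ : MulChar (ZMod p) R} (hχ : χ ^ 3 = 1)
    (hχ1 : χ ≠ 1) : jacobiSum χ χ * jacobiSum (χ ^ 2) (χ ^ 2) = p := by
  let f := algebraMap R (FractionRing R)
  have hf : Function.Injective f := IsFractionRing.injective R (FractionRing R)
  have : CharZero (FractionRing R) := charZero_of_injective_algebraMap hf
  have hinv : χ⁻¹ = χ ^ 2 := by rw [inv_eq_iff_mul_eq_one, ← pow_succ', hχ]
  have h1 : χ * χ ≠ 1 := by rwa [← pow_two, ← hinv, Ne, inv_eq_one]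
  apply hf
  have := jacobiSum_mul_jacobiSum_inv (χ := χ.ringHomComp f) (φ := χ.ringHomComp f)
    (by rw [ringChar.eq_zero, ZMod.ringChar_zmod_n]; exact hp.out.ne_zero.symm)
    (MulChar.ringHomComp_ne_one_iff hf |>.2 hχ1) (MulChar.ringHomComp_ne_one_iff hf |>.2 hχ1)
    (by rw [← MulChar.ringHomComp_mul]; exact MulChar.ringHomComp_ne_one_iff hf |>.2 h1)
  rwa [MulChar.ringHomComp_inv, jacobiSum_ringHomComp, jacobiSum_ringHomComp, hinv, ← map_mul,
    ZMod.card, ← map_natCast f] at this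

/-- The cubic Jacobi sum yields a representation `4 p = T ^ 2 + 27 N ^ 2`. -/
lemma exists_jacobiSum_add_eq [CharZero R] (hp3 : 3 ∣ p - 1) {χ : MulChar (ZMod p) R}
    (hχ : χ ^ 3 = 1) (hχ1 : χ ≠ 1) {μ : R} (hμ : IsPrimitiveRoot μ 3) :
    ∃ T N : ℤ, T % 3 = 1 ∧ 4 * (p : ℤ) = T ^ 2 + 27 * N ^ 2 ∧
      jacobiSum χ χ + jacobiSum (χ ^ 2) (χ ^ 2) = T := by
  have hμ0 := hμ.sq_add_self_add_one
  obtain ⟨a, b, hJ, hJ'⟩ := exists_jacobiSum_eq_and_sq_eq hχ hμ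
  obtain ⟨z, hz, hJz⟩ := exists_jacobiSum_eq_neg_one_add (by norm_num) hχ hχ
    (by rwa [ZMod.card]) hμ
  obtain ⟨c, d, rfl⟩ := exists_int_of_mem_adjoin hμ0 hz
  have h1 : (a + b * μ : R) = ((-1 + 3 * d : ℤ) : R) + ((3 * (d - c) : ℤ) : R) * μ := by
    rw [← hJ, hJz]
    push_cast
    linear_combination (c + d * μ - 3 * d) * hμ0
  obtain ⟨rfl, rfl⟩ := eq_of_add_mul_eq hμ0 h1
  have h2 := jacobiSum_mul_jacobiSum_sq hχ hχ1
  rw [hJ, hJ'] at h2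
  refine ⟨2 * (-1 + 3 * d) - 3 * (d - c), d - c, by lia, ?_, ?_⟩
  · apply Int.cast_injective (α := R)
    rw [Int.cast_mul, Int.cast_natCast, ← h2]
    push_cast
    linear_combination (12 * (-1 + 3 * d) * (d - c) + 36 * (d - c) ^ 2 * (μ - 1)) * hμ0
  · rw [hJ, hJ']
    push_cast
    linear_combination 3 * (d - c) * hμ0

end CubicJacobiSum

/-- The representation `4 p = L ^ 2 + 27 M ^ 2` with `L ≡ 1 (mod 3)` determines `L`. -/
lemma eq_of_four_mul_prime_eq {p : ℕ} (hp : p.Prime) {L M T N : ℤ}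
    (hL : 4 * (p : ℤ) = L ^ 2 + 27 * M ^ 2) (hT : 4 * (p : ℤ) = T ^ 2 + 27 * N ^ 2)
    (hL3 : L % 3 = 1) (hT3 : T % 3 = 1) : L = T := by
  have hpz : Prime (p : ℤ) := Nat.prime_iff_prime_int.1 hp
  have hp0 : (0 : ℤ) < p := by exact_mod_cast hp.pos
  have key (N : ℤ) (hT : 4 * (p : ℤ) = T ^ 2 + 27 * N ^ 2) (h : (p : ℤ) ∣ L * N - T * M) :
      L * N = T * M := by
    obtain ⟨q, hq⟩ := h
    have h1 : (4 * (p : ℤ)) ^ 2 = (L * T + 27 * M * N) ^ 2 + 27 * (p * q) ^ 2 := by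
      rw [← hq]
      linear_combination 4 * (p : ℤ) * hL + (L ^ 2 + 27 * M ^ 2) * hT
    have h2 : 27 * q ^ 2 ≤ 16 := by
      refine le_of_mul_le_mul_left ?_ (pow_pos hp0 2)
      nlinarith [sq_nonneg (L * T + 27 * M * N)]
    have h3 : q = 0 := by
      by_contra h
      have := sq_nonneg q
      have : 0 < q ^ 2 := by positivity
      lia
    rw [h3, mul_zero, sub_eq_zero] at hq
    exact hq
  have h : (p : ℤ) ∣ (L * N - T * M) * (L * -N - T * M) :=
    ⟨4 * (M ^ 2 - N ^ 2), by linear_combination N ^ 2 * hL - M ^ 2 * hT⟩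
  have h1 : L ^ 2 * N ^ 2 = T ^ 2 * M ^ 2 := by
    rcases hpz.dvd_or_dvd h with h | h
    · rw [← mul_pow, key N hT h, mul_pow]
    · rw [← neg_sq N, ← mul_pow, key (-N) (by rwa [neg_sq]) h, mul_pow]
  have h2 : (4 * p : ℤ) * (N ^ 2 - M ^ 2) = 0 := by
    linear_combination N ^ 2 * hL - M ^ 2 * hT + h1
  have h3 : N ^ 2 = M ^ 2 := by
    rcases mul_eq_zero.1 h2 with h2 | h2 <;> lia
  rcases sq_eq_sq_iff_eq_or_eq_neg.1 (show L ^ 2 = T ^ 2 by linear_combination hT - hL + 27 * h3)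
    with h | h <;> lia


/-- Gauss's congruence for `(2 m).choose m` modulo `p ^ 2`, where `p = 3 m + 1`. -/
lemma exists_sq_dvd_mul_choose_add {p : ℕ} [hp : Fact p.Prime] {m : ℕ} (hp3 : 3 < p) (hm : 3 * m + 1 = p) :
    ∃ T N : ℤ, T % 3 = 1 ∧ 4 * (p : ℤ) = T ^ 2 + 27 * N ^ 2 ∧
      (p : ℤ) ^ 2 ∣ T * (2 * m).choose m + T ^ 2 - p := by
  have hpp : Prime (p : ℤ_[p]) := PadicInt.prime_p
  set χ : MulChar (ZMod p) ℤ_[p] := teichmullerChar p ^ (2 * m) with hχdef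
  have hne {n : ℕ} (h : ¬ 3 * m ∣ n) : teichmullerChar p ^ n ≠ 1 := fun h' => h (by
    have := teichmullerChar_pow_eq_one_iff.1 h'
    rwa [show p - 1 = 3 * m by lia] at this)
  have hχ : χ ^ 3 = 1 := by
    rw [hχdef, ← pow_mul, teichmullerChar_pow_eq_one_iff]
    exact ⟨2, by lia⟩
  have hχ1 : χ ≠ 1 := hne (Nat.not_dvd_of_pos_of_lt (by lia) (by lia))
  obtain ⟨x, hx⟩ := MulChar.ne_one_iff.1 hχ1
  have hμ : IsPrimitiveRoot (χ x) 3 := by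
    rw [← orderOf_eq_prime (p := 3) ?_ hx]
    · exact IsPrimitiveRoot.orderOf _
    · rw [← MulChar.pow_apply_coe, hχ, MulChar.one_apply_coe]
  obtain ⟨T, N, hT3, hT, hsum⟩ := exists_jacobiSum_add_eq ⟨m, by lia⟩ hχ hχ1 hμ
  refine ⟨T, N, hT3, hT, ?_⟩
  have hmul := jacobiSum_mul_jacobiSum_sq hχ hχ1
  have hC := (Int.castRingHom ℤ_[p]).map_dvd (sq_dvd_choose_combination hp.out hp3 hm)
  have hJ := jacobiSum_teichmullerChar (p := p) (m := m) (by lia) hm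
  rw [← hχdef] at hJ
  obtain ⟨c, hc⟩ := dvd_add hJ (by simpa using hC)
  rw [← add_assoc, sub_add_cancel] at hc
  set J := jacobiSum χ χ
  set J' := jacobiSum (χ ^ 2) (χ ^ 2)
  have hJ' : (p : ℤ_[p]) ∣ J' := by
    refine (hpp.dvd_or_dvd hmul.symm.dvd).resolve_left fun h => ?_
    have h1 : (p : ℤ_[p]) ∣ ((2 * m).choose m : ℕ) := by
      rw [← add_sub_cancel_left J (((2 * m).choose m : ℕ) : ℤ_[p]), hc]
      exact dvd_sub ((dvd_pow_self _ two_ne_zero).mul_right c) h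
    refine choose_two_mul_not_dvd hp.out (m := m) (by lia) ?_
    have := (PadicInt.pow_p_dvd_int_iff 1 ((2 * m).choose m : ℤ)).1 (by simpa using h1)
    exact_mod_cast (pow_one (p : ℤ)) ▸ this
  obtain ⟨d, hd⟩ := hJ'
  have := (PadicInt.pow_p_dvd_int_iff (p := p) 2 (T * (2 * m).choose m + T ^ 2 - p)).1
    ⟨T * c + d ^ 2, by
      push_cast
      rw [← hsum]
      linear_combination (J + J') * hc + hmul + (J' + p * d) * hd⟩
  exact_mod_cast this

lemma pCong_choose_of_mod_one {p : ℕ} [hp : Fact p.Prime] (hp3 : 3 < p) {m : ℕ}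
    (hm : 3 * m + 1 = p) {L M : ℤ} (hL : 4 * (p : ℤ) = L ^ 2 + 27 * M ^ 2) (hL3 : L % 3 = 1) :
    pCong p 2 ((2 * m).choose m : ℚ) (-(L : ℚ) + (p : ℚ) / (L : ℚ)) := by
  obtain ⟨T, N, hT3, hT, h⟩ := exists_sq_dvd_mul_choose_add hp3 hm
  obtain rfl := eq_of_four_mul_prime_eq hp.out hL hT hL3 hT3
  have hL0 : L ≠ 0 := by rintro rfl; simp at hL3
  have hpL : ¬ (p : ℤ) ∣ L := by
    rintro ⟨q, rfl⟩
    have hq : 0 < q ^ 2 := by have := right_ne_zero_of_mul hL0; positivity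
    have h4 : (p : ℤ) * q ^ 2 ≤ 4 := by
      refine le_of_mul_le_mul_left ?_ (show (0 : ℤ) < p by lia)
      nlinarith [sq_nonneg M]
    have h5 : p ≠ 4 := by rintro rfl; exact absurd hp.out (by norm_num)
    have h6 : (p : ℤ) ≤ 4 := by nlinarith
    lia
  have hL0' : (L : ℚ) ≠ 0 := by exact_mod_cast hL0
  refine pCong.of_mul_left (c := L) (inv_intCast_mem_pIntSubring hpL) hL0' ?_
  have := pCong_of_dvd (a := L * (2 * m).choose m) (b := -L ^ 2 + p) (by convert h using 1; ring)
  convert this using 1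
  · push_cast; ring
  · push_cast; field_simp

theorem stmt19 (p : ℕ) (hp : p.Prime) (hp3 : 3 < p) :
    (p % 3 = 1 → ∀ L M : ℤ, 4 * (p : ℤ) = L ^ 2 + 27 * M ^ 2 → L % 3 = 1 →
      pCong p 2 (∑ n ∈ Finset.range p, (W n : ℚ) / (-3) ^ n)
        (∑ k ∈ Finset.range (p / 3 + 1),
          ((2 * k).choose k : ℚ) * ((3 * k).choose k : ℚ) / 27 ^ k *
            ((p : ℚ) / (3 * (k : ℚ) + 1))) ∧
      pCong p 2
        (∑ k ∈ Finset.range (p / 3 + 1),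
          ((2 * k).choose k : ℚ) * ((3 * k).choose k : ℚ) / 27 ^ k *
            ((p : ℚ) / (3 * (k : ℚ) + 1)))
        (-(L : ℚ) + (p : ℚ) / (L : ℚ))) ∧
    (p % 3 = 2 →
      pCong p 2 (∑ n ∈ Finset.range p, (W n : ℚ) / (-3) ^ n)
        (∑ k ∈ Finset.range (p / 3 + 1),
          ((2 * k).choose k : ℚ) * ((3 * k).choose k : ℚ) / 27 ^ k *
            ((p : ℚ) / (3 * (k : ℚ) + 1))) ∧
      pCong p 2
        (∑ k ∈ Finset.range (p / 3 + 1),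
          ((2 * k).choose k : ℚ) * ((3 * k).choose k : ℚ) / 27 ^ k *
            ((p : ℚ) / (3 * (k : ℚ) + 1)))
        (-((p : ℚ) / 3) * ((((p - 2) / 3).factorial : ℚ)) ^ 3)) := by
  have : Fact p.Prime := ⟨hp⟩
  refine ⟨fun h L M hL hL3 => ⟨pCong_sum_W hp3, ?_⟩, fun h => ⟨pCong_sum_W hp3, ?_⟩⟩
  · have hm : 3 * (p / 3) + 1 = p := by lia
    exact (pCong_sum_trinomialCoeff_of_mod_one hp3 hm).trans
      (pCong_choose_of_mod_one hp3 hm hL hL3)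
  · rw [show (p - 2) / 3 = p / 3 by lia]
    exact pCong_sum_trinomialCoeff_of_mod_two hp3 (by lia)
end
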